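/- Let (A_S,S) be any Artin-Tits system and X,Y ⊆ S. An element g ∈ A_S⁺ satisfies gX = Yg (i.e. g ∈ Conj⁺(S;X,Y)) if and only if g is a positive Y-ribbon-X, i.e. g = g_n⋯g_1 where each g_i is an elementary positive X_i-ribbon-X_{i−1} with X_0 = X and X_n = Y. -/

import Mathlib

/-!
Common definitions for formalizing "Normalisateur des sous-groupes paraboliques
des groupes d'Artin-Tits" (E. Godelle).

We fix a Coxeter matrix `M` over a finite index set `B` (Mathlib's convention:
`M s t = 0` encodes `m_{s,t} = ∞`).  The Artin-Tits group `Artin M` is the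
presented group on the braid relations, the Coxeter group is Mathlib's
`M.Group`, and `proj : Artin M →* M.Group` is the canonical projection
(adding the relations `s² = 1`).
-/

namespace ArtinTitsPaper

open List

variable {B : Type*}

/-- The alternating list `[s, t, s, t, ...]` with `n` terms, starting with `s`. -/
def altList (s t : B) : ℕ → List B
  | 0 => []
  | n + 1 => s :: altList t s n

/-- The braid relators `(sts⋯)(tst⋯)⁻¹` (`m_{s,t}` letters each) for `s ≠ t`,
`m_{s,t} ≠ ∞`. -/
def braidRels (M : CoxeterMatrix B) : Set (FreeGroup B) :=
  { r | ∃ s t : B, s ≠ t ∧ M s t ≠ 0 ∧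
      r = ((altList s t (M s t)).map FreeGroup.of).prod *
          (((altList t s (M s t)).map FreeGroup.of).prod)⁻¹ }

/-- The Artin-Tits group associated to the Coxeter matrix `M`. -/
def Artin (M : CoxeterMatrix B) : Type _ := PresentedGroup (braidRels M)

instance (M : CoxeterMatrix B) : Group (Artin M) :=
  QuotientGroup.Quotient.group _

/-- The standard generator of `Artin M` indexed by `s : B` (the image of `S` in `A_S`). -/
def gen (M : CoxeterMatrix B) (s : B) : Artin M := PresentedGroup.of s

theorem altList_eq_reverse_alternatingWord (s t : B) (n : ℕ) :
    altList s t n = (CoxeterSystem.alternatingWord t s n).reverse := by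
  induction n generalizing s t with
  | zero => rfl
  | succ n ih =>
      rw [altList, CoxeterSystem.alternatingWord_succ, List.concat_eq_append,
        List.reverse_append]
      simp [ih]

theorem lift_simple_listProd (M : CoxeterMatrix B) (l : List B) :
    FreeGroup.lift M.simple ((l.map FreeGroup.of).prod) =
      M.toCoxeterSystem.wordProd l := by
  rw [CoxeterSystem.wordProd, map_list_prod, List.map_map]
  simp [Function.comp_def, CoxeterMatrix.toCoxeterSystem_simple]

theorem braid_lift (M : CoxeterMatrix B) :
    ∀ r ∈ braidRels M, FreeGroup.lift M.simple r = 1 := by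
  rintro r ⟨s, t, hst, hm, rfl⟩
  rw [map_mul, map_inv, lift_simple_listProd, lift_simple_listProd,
    altList_eq_reverse_alternatingWord, altList_eq_reverse_alternatingWord,
    CoxeterSystem.wordProd_reverse, CoxeterSystem.wordProd_reverse]
  have hsym : M s t = M t s := M.symmetric s t
  have hb := M.toCoxeterSystem.wordProd_braidWord_eq t s
  rw [CoxeterSystem.braidWord, CoxeterSystem.braidWord, ← hsym] at hb
  rw [hb]
  simp

/-- The canonical projection from the Artin-Tits group onto the Coxeter group
(adding the relations `s² = 1`). -/
def proj (M : CoxeterMatrix B) : Artin M →* M.Group :=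
  PresentedGroup.toGroup (braid_lift M)

/-- The positive monoid `A_S⁺`, the submonoid of `A_S` generated by `S`. -/
def posMon (M : CoxeterMatrix B) : Submonoid (Artin M) :=
  Submonoid.closure (Set.range (gen M))

/-- The submonoid `A_X⁺` of `A_S` generated by `X ⊆ S`. -/
def posMonOn (M : CoxeterMatrix B) (X : Set B) : Submonoid (Artin M) :=
  Submonoid.closure (gen M '' X)

/-- The standard parabolic subgroup `A_X` of `A_S` generated by `X ⊆ S`. -/
def stdSub (M : CoxeterMatrix B) (X : Set B) : Subgroup (Artin M) :=
  Subgroup.closure (gen M '' X)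

/-- The standard parabolic subgroup `W_X` of the Coxeter group `W_S`. -/
def coxSub (M : CoxeterMatrix B) (X : Set B) : Subgroup M.Group :=
  Subgroup.closure (M.simple '' X)

/-- `X ⊆ S` is of spherical type if the Coxeter group `W_X` is finite. -/
def IsSpherical (M : CoxeterMatrix B) (X : Set B) : Prop :=
  Finite (coxSub M X)

/-- `a` left-divides `b` in the positive monoid: `b = a c` with `c ∈ A_S⁺`. -/
def ldvd (M : CoxeterMatrix B) (a b : Artin M) : Prop :=
  ∃ c ∈ posMon M, a * c = b

/-- `a` right-divides `b` in the positive monoid: `b = c a` with `c ∈ A_S⁺`. -/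
def rdvd (M : CoxeterMatrix B) (a b : Artin M) : Prop :=
  ∃ c ∈ posMon M, c * a = b

/-- `d` is the least common multiple `Δ_X` of `X` in `A_X⁺` (for left-divisibility). -/
def IsDelta (M : CoxeterMatrix B) (X : Set B) (d : Artin M) : Prop :=
  d ∈ posMonOn M X ∧
  (∀ s ∈ X, ∃ c ∈ posMonOn M X, gen M s * c = d) ∧
  ∀ m ∈ posMonOn M X, (∀ s ∈ X, ∃ c ∈ posMonOn M X, gen M s * c = m) →
    ∃ c ∈ posMonOn M X, d * c = m

/-- The subset `Xg = {σ_x g : x ∈ X}` of `A_S`. -/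
def leftMul (M : CoxeterMatrix B) (X : Set B) (g : Artin M) : Set (Artin M) :=
  (fun x => gen M x * g) '' X

/-- The subset `gX = {g σ_x : x ∈ X}` of `A_S`. -/
def rightMul (M : CoxeterMatrix B) (X : Set B) (g : Artin M) : Set (Artin M) :=
  (fun x => g * gen M x) '' X

/-- `Conj(S;X,Y) = {g ∈ A_S : gX = Yg}`. -/
def conjSet (M : CoxeterMatrix B) (X Y : Set B) : Set (Artin M) :=
  { g | rightMul M X g = leftMul M Y g }

/-- `Conj⁺(S;X,Y) = {g ∈ A_S⁺ : gX = Yg}`. -/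
def conjPos (M : CoxeterMatrix B) (X Y : Set B) : Set (Artin M) :=
  { g | g ∈ posMon M ∧ rightMul M X g = leftMul M Y g }

/-- The quasi-centralizer `QZ_{A_S}(A_X) = {g ∈ A_S : gX = Xg}`. -/
def QZset (M : CoxeterMatrix B) (X : Set B) : Set (Artin M) :=
  conjSet M X X

/-- The indecomposable component of `Z` containing `t` (vertices of `Z` joined to `t`
by a path of edges `m_{a,b} ≠ 2` in the Coxeter diagram on `Z`). -/
def comp (M : CoxeterMatrix B) (Z : Set B) (t : B) : Set B :=
  { s ∈ Z | Relation.ReflTransGen (fun a b => a ∈ Z ∧ b ∈ Z ∧ a ≠ b ∧ M a b ≠ 2) t s }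

/-- `Z` is indecomposable: it admits no nontrivial partition `Z = Z₁ ∪ Z₂` with
`m_{a,b} = 2` for `a ∈ Z₁`, `b ∈ Z₂`. -/
def Indecomp (M : CoxeterMatrix B) (Z : Set B) : Prop :=
  ¬ ∃ Z₁ Z₂ : Set B, Z₁.Nonempty ∧ Z₂.Nonempty ∧ Z₁ ∪ Z₂ = Z ∧ Disjoint Z₁ Z₂ ∧
      ∀ a ∈ Z₁, ∀ b ∈ Z₂, M a b = 2

/-- `g` is an elementary positive `Y`-ribbon-`X`: `g = d_{X,t}` for some `t ∈ S` with
`X(t)` of spherical type, where `d_{X,t} = Δ_{X(t)}` if `t ∈ X` and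
`d_{X,t} = Δ_{X(t)} Δ_{X(t)∖{t}}⁻¹` otherwise, and `Y ⊆ X ∪ {t}` satisfies `Yg = gX`. -/
def IsElemRibbon (M : CoxeterMatrix B) (X Y : Set B) (g : Artin M) : Prop :=
  ∃ t : B, IsSpherical M (comp M (X ∪ {t}) t) ∧
    ((t ∈ X ∧ IsDelta M (comp M (X ∪ {t}) t) g) ∨
      (t ∉ X ∧ ∃ d₁ d₂ : Artin M, IsDelta M (comp M (X ∪ {t}) t) d₁ ∧
        IsDelta M ((comp M (X ∪ {t}) t) \ {t}) d₂ ∧ g = d₁ * d₂⁻¹)) ∧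
    Y ⊆ X ∪ {t} ∧ leftMul M Y g = rightMul M X g

/-- `g` is a positive `Y`-ribbon-`X`: a product `g = g_n ⋯ g_1` of elementary positive
`X_i`-ribbons-`X_{i-1}` with `X_0 = X`, `X_n = Y`. -/
inductive IsRibbon (M : CoxeterMatrix B) : Set B → Set B → Artin M → Prop
  | nil (X : Set B) : IsRibbon M X X 1
  | cons {X Y Z : Set B} {g h : Artin M} :
      IsRibbon M X Y g → IsElemRibbon M Y Z h → IsRibbon M X Z (h * g)

/-- `g` is `X`-reduced: no element of `X` left-divides `g`. -/
def lreduced (M : CoxeterMatrix B) (X : Set B) (g : Artin M) : Prop :=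
  ∀ s ∈ X, ¬ ldvd M (gen M s) g

/-- `g` is reduced-`X`: no element of `X` right-divides `g`. -/
def rreduced (M : CoxeterMatrix B) (X : Set B) (g : Artin M) : Prop :=
  ∀ s ∈ X, ¬ rdvd M (gen M s) g

/-- The set `H_X` of elements `g₁ g₂⁻¹` where `g₁, g₂` are `X`-reduced positive
`X`-ribbons-`X`. -/
def HXset (M : CoxeterMatrix B) (X : Set B) : Set (Artin M) :=
  { g | ∃ g₁ g₂ : Artin M, IsRibbon M X X g₁ ∧ lreduced M X g₁ ∧
      IsRibbon M X X g₂ ∧ lreduced M X g₂ ∧ g = g₁ * g₂⁻¹ }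

/-- The length of a positive element (the common length of its expressions as words
in the generators; junk value `0` outside of `A_S⁺`). -/
noncomputable def len (M : CoxeterMatrix B) (g : Artin M) : ℕ :=
  sInf { n | ∃ l : List B, l.length = n ∧ (l.map (gen M)).prod = g }

/-- The length of an element of the Coxeter group `W_S`. -/
noncomputable def wlen (M : CoxeterMatrix B) (w : M.Group) : ℕ :=
  sInf { n | ∃ l : List B, l.length = n ∧ (l.map M.simple).prod = w }

/-- `g ∈ A_{S,red}`: `g` is positive and has the same length as its image in `W_S`. -/
def Red (M : CoxeterMatrix B) (g : Artin M) : Prop :=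
  g ∈ posMon M ∧ len M g = wlen M (proj M g)

/-- `C` is a simple `s`-chain-`u`: either `C = 1` and `s = u`, or
`C = tst⋯` (`k` letters, `k < m_{s,t}`) with `u ∈ {s,t}` and `C·u = tst⋯` (`k+1` letters). -/
def IsSimpleChain (M : CoxeterMatrix B) (s u : B) (C : Artin M) : Prop :=
  (C = 1 ∧ s = u) ∨
  ∃ t : B, t ≠ s ∧ (u = s ∨ u = t) ∧ ∃ k : ℕ,
    (M s t = 0 ∨ k < M s t) ∧
    C = ((altList t s k).map (gen M)).prod ∧
    C * gen M u = ((altList t s (k + 1)).map (gen M)).prod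

/-- `C` is an `s`-chain-`t`: a product `C₁ ⋯ C_k` of simple chains composing from
origin `s` to target `t`. -/
inductive IsChain (M : CoxeterMatrix B) : B → B → Artin M → Prop
  | single {s u : B} {C : Artin M} : IsSimpleChain M s u C → IsChain M s u C
  | comp {s u v : B} {C D : Artin M} :
      IsChain M s u C → IsSimpleChain M u v D → IsChain M s v (C * D)

section

namespace SmallType

variable {V : Type*}

open Classical in
/-- The simple root indexed by `i`. -/
noncomputable def sroot (i : V) : V → ℤ := Pi.single i 1

theorem sroot_self (i : V) : sroot i i = 1 := by simp [sroot]

theorem sroot_ne {i j : V} (h : j ≠ i) : sroot i j = 0 := by simp [sroot, h]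

theorem sroot_injective : Function.Injective (sroot (V := V)) := by
  intro i j h
  by_contra hne
  have := congrFun h i
  rw [sroot_self, sroot_ne hne] at this
  omega

variable [Fintype V] (G : SimpleGraph V)

open Classical in
/-- The pairing of a vector with the coroot of `i`. -/
noncomputable def pair (i : V) (β : V → ℤ) : ℤ := 2 * β i - ∑ j, if G.Adj i j then β j else 0

/-- The simple reflection indexed by `i`. -/
noncomputable def refl (i : V) (β : V → ℤ) : V → ℤ := β - pair G i β • sroot i

variable {G}

theorem pair_sub_smul (i : V) (β γ : V → ℤ) (c : ℤ) :
    pair G i (β - c • γ) = pair G i β - c * pair G i γ := by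
  classical
  simp only [pair, Pi.sub_apply, Pi.smul_apply, smul_eq_mul, mul_sub, Finset.mul_sum]
  have : ∀ j, (if G.Adj i j then β j - c * γ j else 0) =
      (if G.Adj i j then β j else 0) - c * (if G.Adj i j then γ j else 0) := by
    intro j; split_ifs <;> simp
  simp only [this, Finset.sum_sub_distrib]
  ring

theorem pair_sroot (i j : V) [Decidable (i = j)] [Decidable (G.Adj i j)] : pair G i (sroot j) =
    if i = j then 2 else if G.Adj i j then -1 else 0 := by
  classical
  simp only [pair, sroot, Pi.single_apply]
  have : ∀ k, (if G.Adj i k then if k = j then (1 : ℤ) else 0 else 0) =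
      if k = j then (if G.Adj i j then 1 else 0) else 0 := by
    intro k; split_ifs <;> simp_all
  simp only [this, Finset.sum_ite_eq', Finset.mem_univ, if_true]
  by_cases h : i = j
  · subst h; simp
  · simp [h]; split_ifs <;> simp

theorem pair_refl_self (i : V) (β : V → ℤ) : pair G i (refl G i β) = -pair G i β := by
  classical
  rw [refl, pair_sub_smul, pair_sroot]; simp; ring

theorem pair_refl_adj {i j : V} (h : G.Adj i j) (β : V → ℤ) :
    pair G i (refl G j β) = pair G i β + pair G j β := by
  classical
  rw [refl, pair_sub_smul, pair_sroot, if_neg h.ne, if_pos h]; ring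

theorem pair_refl_nadj {i j : V} (hne : i ≠ j) (h : ¬ G.Adj i j) (β : V → ℤ) :
    pair G i (refl G j β) = pair G i β := by
  classical
  rw [refl, pair_sub_smul, pair_sroot, if_neg hne, if_neg h]; ring

theorem refl_refl (i : V) (β : V → ℤ) : refl G i (refl G i β) = β := by
  rw [refl, pair_refl_self, refl]; simp

theorem refl_comm {i j : V} (hne : i ≠ j) (h : ¬ G.Adj i j) (β : V → ℤ) :
    refl G i (refl G j β) = refl G j (refl G i β) := by
  conv_lhs => rw [refl, pair_refl_nadj hne h, refl]
  conv_rhs => rw [refl, pair_refl_nadj hne.symm (fun h' => h h'.symm), refl]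
  abel

theorem refl_braid {i j : V} (h : G.Adj i j) (β : V → ℤ) :
    refl G i (refl G j (refl G i β)) = refl G j (refl G i (refl G j β)) := by
  have e1 : pair G i (refl G j (refl G i β)) = pair G j β := by
    rw [pair_refl_adj h, pair_refl_adj h.symm, pair_refl_self]; ring
  have e2 : pair G j (refl G i (refl G j β)) = pair G i β := by
    rw [pair_refl_adj h.symm, pair_refl_adj h, pair_refl_self]; ring
  have e3 := pair_refl_adj h β
  have e4 := pair_refl_adj h.symm β
  conv_lhs => rw [refl, e1, refl, e4, refl]
  conv_rhs => rw [refl, e2, refl, e3, refl]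
  module

theorem refl_apply_ne {i j : V} (h : j ≠ i) (β : V → ℤ) : refl G i β j = β j := by
  simp [refl, sroot_ne h]

theorem refl_apply_self (i : V) (β : V → ℤ) : refl G i β i = β i - pair G i β := by
  simp [refl, sroot_self]

theorem refl_of_pair_eq_zero {i : V} {β : V → ℤ} (h : pair G i β = 0) : refl G i β = β := by
  simp [refl, h]

theorem sum_refl (i : V) (β : V → ℤ) : ∑ j, refl G i β j = ∑ j, β j - pair G i β := by
  classical
  simp [refl, sroot, Finset.sum_sub_distrib, ← Finset.mul_sum]

variable (G) in
/-- Positive real roots, generated from the simple roots by height-increasing reflections. -/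
inductive IsRoot : (V → ℤ) → Prop
  | simple (i : V) : IsRoot (sroot i)
  | up (i : V) {β : V → ℤ} : IsRoot β → pair G i β < 0 → IsRoot (refl G i β)

theorem IsRoot.nonneg {β : V → ℤ} (h : IsRoot G β) (j : V) : 0 ≤ β j := by
  induction h with
  | simple i =>
    by_cases hj : j = i
    · subst hj; simp [sroot_self]
    · simp [sroot_ne hj]
  | up i h hp ih =>
    by_cases hj : j = i
    · subst hj; rw [refl_apply_self]; omega
    · rw [refl_apply_ne hj]; exact ih

theorem IsRoot.sum_pos {β : V → ℤ} (h : IsRoot G β) : 0 < ∑ j, β j := by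
  induction h with
  | simple i => classical simp [sroot]
  | up i h hp ih => rw [sum_refl]; omega

theorem IsRoot.not_neg_sroot {β : V → ℤ} (h : IsRoot G β) (i : V) (hn : refl G i β = sroot i) :
    False := by
  have h1 := congrFun hn i
  have hp : pair G i β = -2 := by
    have := pair_refl_self (G := G) i β
    classical
    rw [hn, pair_sroot, if_pos rfl] at this
    omega
  rw [refl_apply_self, hp, sroot_self] at h1
  have := h.nonneg i
  omega

/-- A positive real root stays one under a height-decreasing simple reflection, unless it is the
corresponding simple root. -/
theorem IsRoot.down_aux (n : ℕ) : ∀ (i : V) (β : V → ℤ), ∑ j, β j ≤ n → IsRoot G β →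
    0 < pair G i β → β ≠ sroot i → IsRoot G (refl G i β) := by
  classical
  induction n with
  | zero => intro i β hn h; have := h.sum_pos; push_cast at hn; omega
  | succ n ih =>
    intro i β hn h hp hne
    cases h with
    | simple j =>
      exfalso
      rw [pair_sroot] at hp
      have : i ≠ j := fun h => hne (by rw [h])
      rw [if_neg this] at hp
      split_ifs at hp <;> omega
    | @up j β0 h0 hj =>
      by_cases hij : i = j
      · subst hij; rwa [refl_refl]
      rw [sum_refl] at hn
      by_cases ha : G.Adj i j
      · rw [pair_refl_adj ha] at hp
        by_cases h1 : β0 = sroot i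
        · subst h1
          have : refl G i (refl G j (sroot i)) = sroot j := by
            have e1 : pair G j (sroot i) = -1 := by
              rw [pair_sroot, if_neg (Ne.symm hij), if_pos ha.symm]
            have e2 : pair G i (refl G j (sroot i)) = 1 := by
              rw [pair_refl_adj ha, e1, pair_sroot, if_pos rfl]; norm_num
            rw [refl, e2, refl, e1]; module
          rw [this]; exact .simple j
        have r1 := ih i β0 (by omega) h0 (by omega) h1
        have p1 : pair G j (refl G i β0) = pair G j β0 + pair G i β0 := pair_refl_adj ha.symm _
        have h2 : refl G i β0 ≠ sroot j := by
          intro h2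
          have e : β0 = refl G i (sroot j) := by rw [← h2, refl_refl]
          have e1 : pair G j β0 = 1 := by
            rw [e, pair_refl_adj ha.symm, pair_sroot, pair_sroot, if_pos rfl, if_neg hij,
              if_pos ha]; norm_num
          omega
        have s1 := sum_refl (G := G) i β0
        have r2 := ih j (refl G i β0) (by push_cast at hn ⊢; omega) r1 (by omega) h2
        have p2 : pair G i (refl G j (refl G i β0)) = pair G j β0 := by
          rw [pair_refl_adj ha, pair_refl_self, p1]; ring
        have r3 := IsRoot.up i r2 (by omega)
        have p3 : pair G j (refl G i (refl G j (refl G i β0))) = - pair G i β0 := by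
          rw [pair_refl_adj ha.symm, pair_refl_self, p2, p1]; ring
        have r4 := IsRoot.up j r3 (by omega)
        rwa [refl_braid ha, refl_refl] at r4
      · rw [pair_refl_nadj hij ha] at hp
        have h1 : β0 ≠ sroot i := by
          intro h1
          subst h1
          rw [pair_sroot, if_neg (Ne.symm hij), if_neg (fun h => ha h.symm)] at hj
          omega
        have r1 := ih i β0 (by omega) h0 (by omega) h1
        rw [refl_comm hij ha]
        exact .up j r1 (by rwa [pair_refl_nadj (Ne.symm hij) (fun h => ha h.symm)])

theorem IsRoot.down {i : V} {β : V → ℤ} (h : IsRoot G β) (hp : 0 < pair G i β)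
    (hne : β ≠ sroot i) : IsRoot G (refl G i β) :=
  IsRoot.down_aux (∑ j, β j).toNat i β (by have := h.sum_pos; omega) h hp hne

theorem IsRoot.exists_pair_pos {β : V → ℤ} (h : IsRoot G β) : ∃ j, 0 < pair G j β := by
  classical
  cases h with
  | simple i => exact ⟨i, by rw [pair_sroot]; simp⟩
  | up i h hp => exact ⟨i, by rw [pair_refl_self]; omega⟩

end SmallType

end

section

namespace SmallType

variable {V : Type*} [Fintype V] (G : SimpleGraph V)

open Classical in
/-- The integer weights defining the rank one part of the representation; they are computed by
descending along an arbitrarily chosen height-decreasing reflection. -/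
noncomputable def wt (i : V) (β : V → ℤ) : ℤ :=
  if ∑ j, β j ≤ 1 then (if pair G i β < 0 then 1 else -1)
  else if h : pair G i β ≤ 0 ∧ ∃ j, 0 < pair G j β then
    if G.Adj i h.2.choose then
      if pair G i (refl G h.2.choose β) ≤ 0 then
        wt i (refl G h.2.choose β) + 2 * wt h.2.choose (refl G h.2.choose β)
      else 2 * wt h.2.choose (refl G i (refl G h.2.choose β))
    else wt i (refl G h.2.choose β)
  else 0
termination_by (∑ j, β j).toNat
decreasing_by
  all_goals
    have _ := h.2.choose_spec
    simp only [sum_refl]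
    omega

open Classical in
/-- One step of the recursion defining `wt`, along the reflection `j`. -/
noncomputable def wtStep (i j : V) (β : V → ℤ) : ℤ :=
  if G.Adj i j then
    if pair G i (refl G j β) ≤ 0 then wt G i (refl G j β) + 2 * wt G j (refl G j β)
    else 2 * wt G j (refl G i (refl G j β))
  else wt G i (refl G j β)

variable {G}

theorem IsRoot.eq_sroot_of_sum {β : V → ℤ} (h : IsRoot G β) (hs : ∑ j, β j ≤ 1) :
    ∃ k, β = sroot k := by
  cases h with
  | simple k => exact ⟨k, rfl⟩
  | up i h hp => rw [sum_refl] at hs; have := h.sum_pos; omega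

theorem sum_sroot (k : V) : ∑ j, (sroot k : V → ℤ) j = 1 := by
  classical simp [sroot]

theorem wt_sroot_adj {i k : V} (h : G.Adj i k) : wt G i (sroot k) = 1 := by
  classical
  rw [wt, if_pos (sum_sroot k).le, pair_sroot, if_neg h.ne, if_pos h]; simp

theorem wt_sroot_nadj {i k : V} (h : ¬ G.Adj i k) : wt G i (sroot k) = -1 := by
  classical
  rw [wt, if_pos (sum_sroot k).le, pair_sroot, if_neg h]; split_ifs <;> simp_all

theorem wt_eq_wtStep {i : V} {β : V → ℤ} (h : IsRoot G β) (hs : 1 < ∑ j, β j)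
    (hi : pair G i β ≤ 0) : ∃ j, 0 < pair G j β ∧ wt G i β = wtStep G i j β := by
  have hx : pair G i β ≤ 0 ∧ ∃ j, 0 < pair G j β := ⟨hi, h.exists_pair_pos⟩
  refine ⟨hx.2.choose, hx.2.choose_spec, ?_⟩
  rw [wt, if_neg (by omega), dif_pos hx]
  rfl

/-- For roots of height at most `n`, `wt` can be computed along any descent. -/
def Good (G : SimpleGraph V) (n : ℕ) : Prop :=
  ∀ γ : V → ℤ, IsRoot G γ → 1 < ∑ j, γ j → ∑ j, γ j ≤ n → ∀ i j, pair G i γ ≤ 0 →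
    0 < pair G j γ → wt G i γ = wtStep G i j γ

/-- A root which is known not to be simple. -/
structure Big (G : SimpleGraph V) (n : ℕ) (γ : V → ℤ) : Prop where
  root : IsRoot G γ
  lt : 1 < ∑ j, γ j
  le : ∑ j, γ j ≤ n

theorem pair_sroot_adj {i j : V} (h : G.Adj i j) : pair G i (sroot j) = -1 := by
  classical rw [pair_sroot, if_neg h.ne, if_pos h]

theorem pair_sroot_nadj {i j : V} (hne : i ≠ j) (h : ¬ G.Adj i j) : pair G i (sroot j) = 0 := by
  classical rw [pair_sroot, if_neg hne, if_neg h]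

theorem pair_sroot_self (i : V) : pair G i (sroot i) = 2 := by
  classical rw [pair_sroot, if_pos rfl]

theorem IsRoot.eq_sroot_of_pair {γ : V → ℤ} (h : IsRoot G γ) (hs : ∑ j, γ j ≤ 1) {k : V}
    (hk : 0 < pair G k γ) : γ = sroot k := by
  obtain ⟨l, rfl⟩ := h.eq_sroot_of_sum hs
  classical
  rw [pair_sroot] at hk
  split_ifs at hk with h1 h2
  · rw [h1]
  all_goals omega

theorem Big.root_down {n : ℕ} {γ : V → ℤ} (h : Big G n γ) {j : V} (hj : 0 < pair G j γ) :
    IsRoot G (refl G j γ) := h.root.down hj (by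
    rintro rfl; have := h.lt; rw [sum_sroot] at this; omega)

/-- Descending a nonsimple root keeps it nonsimple, when some other pairing excludes the only
simple root it could be. -/
theorem Big.desc {n : ℕ} {γ : V → ℤ} (h : Big G (n + 1) γ ) {j k : V} (hj : 0 < pair G j γ)
    (hk : 0 < pair G k (refl G j γ)) (hne : refl G j γ ≠ sroot k) :
    Big G n (refl G j γ) := by
  have hr := h.root_down hj
  refine ⟨hr, ?_, ?_⟩
  · by_contra hc
    exact hne (hr.eq_sroot_of_pair (by omega) hk)
  · rw [sum_refl]; have := h.le; push_cast at this; omega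

theorem Big.mono {n m : ℕ} {γ : V → ℤ} (h : Big G n γ) (hm : n ≤ m) : Big G m γ :=
  ⟨h.root, h.lt, h.le.trans (by exact_mod_cast hm)⟩

theorem Big.desc' {n : ℕ} {γ : V → ℤ} (h : Big G n γ ) {j k : V} (hj : 0 < pair G j γ)
    (hk : 0 < pair G k (refl G j γ)) (hne : refl G j γ ≠ sroot k) :
    Big G n (refl G j γ) :=
  ((h.mono (Nat.le_succ n)).desc hj hk hne)

theorem ne_sroot_of_adj {γ : V → ℤ} {k l : V} (h : G.Adj l k) (hp : pair G l γ ≠ -1) :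
    γ ≠ sroot k := by
  rintro rfl; exact hp (pair_sroot_adj h)

theorem ne_sroot_of_nadj {γ : V → ℤ} {k l : V} (hne : l ≠ k) (h : ¬ G.Adj l k)
    (hp : pair G l γ ≠ 0) : γ ≠ sroot k := by
  rintro rfl; exact hp (pair_sroot_nadj hne h)

section
variable {n : ℕ} {γ : V → ℤ} {i j : V}

theorem Good.nadj (hg : Good G n) (hb : Big G n γ)
    (hi : pair G i γ ≤ 0) (hj : 0 < pair G j γ) (h : ¬ G.Adj i j) :
    wt G i γ = wt G i (refl G j γ) := by
  rw [hg γ hb.root hb.lt hb.le i j hi hj, wtStep, if_neg h]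

theorem Good.adj_le (hg : Good G n) (hb : Big G n γ)
    (hi : pair G i γ ≤ 0) (hj : 0 < pair G j γ) (h : G.Adj i j)
    (hl : pair G i γ + pair G j γ ≤ 0) :
    wt G i γ = wt G i (refl G j γ) + 2 * wt G j (refl G j γ) := by
  rw [hg γ hb.root hb.lt hb.le i j hi hj, wtStep, if_pos h, if_pos (by rwa [pair_refl_adj h])]

theorem Good.adj_gt (hg : Good G n) (hb : Big G n γ)
    (hi : pair G i γ ≤ 0) (hj : 0 < pair G j γ) (h : G.Adj i j)
    (hl : 0 < pair G i γ + pair G j γ) :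
    wt G i γ = 2 * wt G j (refl G i (refl G j γ)) := by
  rw [hg γ hb.root hb.lt hb.le i j hi hj, wtStep, if_pos h,
    if_neg (by rw [pair_refl_adj h]; omega)]
end

section
variable {β : V → ℤ} {i j : V}

theorem wtStep_nadj (h : ¬ G.Adj i j) : wtStep G i j β = wt G i (refl G j β) := by
  rw [wtStep, if_neg h]

theorem wtStep_adj_le (h : G.Adj i j) (hl : pair G i β + pair G j β ≤ 0) :
    wtStep G i j β = wt G i (refl G j β) + 2 * wt G j (refl G j β) := by
  rw [wtStep, if_pos h, if_pos (by rwa [pair_refl_adj h])]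

theorem wtStep_adj_gt (h : G.Adj i j) (hl : 0 < pair G i β + pair G j β) :
    wtStep G i j β = 2 * wt G j (refl G i (refl G j β)) := by
  rw [wtStep, if_pos h, if_neg (by rw [pair_refl_adj h]; omega)]
end

theorem eq_refl_of_refl_eq {j : V} {β γ : V → ℤ} (h : refl G j β = γ) : β = refl G j γ := by
  rw [← h, refl_refl]

end SmallType

end

section

set_option linter.unusedSimpArgs false

namespace SmallType

variable {V : Type*} [Fintype V] {G : SimpleGraph V}

section
variable {n : ℕ} {β : V → ℤ} {i j k : V}

theorem wtStep_consistent_nadj (hg : Good G n) (hb : Big G (n + 1) β)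
    (hi : pair G i β ≤ 0) (hj : 0 < pair G j β) (hk : 0 < pair G k β)
    (hjk : j ≠ k) (ajk : ¬ G.Adj j k) (aij : ¬ G.Adj i j)
    (aik : ¬ G.Adj i k) : wtStep G i j β = wtStep G i k β := by
  have nij : i ≠ j := by rintro rfl; omega
  have nik : i ≠ k := by rintro rfl; omega
  have akj : ¬ G.Adj k j := fun h => ajk h.symm
  have pji := pair_refl_nadj nij aij
  have pki := pair_refl_nadj nik aik
  have pjk := pair_refl_nadj hjk ajk
  have pkj := pair_refl_nadj hjk.symm akj
  have b1 : Big G n (refl G j β) := hb.desc hj (k := k) (by rw [pkj]; exact hk)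
    (ne_sroot_of_nadj (l := j) hjk ajk (by rw [pair_refl_self]; omega))
  have b2 : Big G n (refl G k β) := hb.desc hk (k := j) (by rw [pjk]; exact hj)
    (ne_sroot_of_nadj (l := k) hjk.symm akj (by rw [pair_refl_self]; omega))
  rw [wtStep_nadj aij, wtStep_nadj aik, hg.nadj b1 (by rw [pji]; exact hi)
      (by rw [pkj]; exact hk) aik,
    hg.nadj b2 (by rw [pki]; exact hi) (by rw [pjk]; exact hj) aij, refl_comm hjk ajk]

theorem wtStep_consistent_adj_jk (hg : Good G n) (hb : Big G (n + 1) β)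
    (hi : pair G i β ≤ 0) (hj : 0 < pair G j β) (hk : 0 < pair G k β)
    (hjk : j ≠ k) (ajk : G.Adj j k) (aij : ¬ G.Adj i j)
    (aik : ¬ G.Adj i k) : wtStep G i j β = wtStep G i k β := by
  have nij : i ≠ j := by rintro rfl; omega
  have nik : i ≠ k := by rintro rfl; omega
  have aji : ¬ G.Adj j i := fun h => aij h.symm
  have pij := pair_refl_nadj nij aij
  have pji := pair_refl_nadj nij.symm aji
  have aki : ¬ G.Adj k i := fun h => aik h.symm
  have pik := pair_refl_nadj nik aik
  have pki := pair_refl_nadj nik.symm aki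
  have pjk := pair_refl_adj ajk
  have pkj := pair_refl_adj ajk.symm
  rw [wtStep_nadj aij, wtStep_nadj aik]
  by_cases h1 : refl G j β = sroot k
  · have h2 : pair G j β = 1 := by
      have := pair_sroot_adj ajk
      rw [← h1, pair_refl_self] at this; omega
    have h3 : pair G k β = 1 := by
      have := pair_sroot_self (G := G) k
      rw [← h1, pkj] at this; omega
    have h4 : refl G k β = sroot j := by
      have e : β = refl G j (sroot k) := eq_refl_of_refl_eq h1
      have : pair G j (sroot k) = -1 := pair_sroot_adj ajk
      rw [refl, h3, e, refl, this]
      module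
    rw [h1, h4, wt_sroot_nadj aik, wt_sroot_nadj aij]
  · have h2 : refl G k β ≠ sroot j := by
      intro h2
      have e1 : pair G k β = 1 := by
        have := pair_sroot_adj ajk.symm
        rw [← h2, pair_refl_self] at this; omega
      have e : β = refl G k (sroot j) := eq_refl_of_refl_eq h2
      have e2 : pair G k (sroot j) = -1 := pair_sroot_adj ajk.symm
      have e3 : pair G j β = 1 := by
        have := pair_sroot_self (G := G) j
        rw [← h2, pjk] at this; omega
      apply h1
      rw [refl, e3, e, refl, e2]
      module
    have b1 : Big G n (refl G j β) := hb.desc hj (k := k)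
        (by simp only [pij, pji, pik, pki, pjk, pkj, pair_refl_self]; omega) h1
    have b2 : Big G n (refl G k β) := hb.desc hk (k := j)
        (by simp only [pij, pji, pik, pki, pjk, pkj, pair_refl_self]; omega) h2
    have c1 : Big G n (refl G k (refl G j β)) := b1.desc'
        (by simp only [pij, pji, pik, pki, pjk, pkj, pair_refl_self]; omega) (k := j)
        (by simp only [pij, pji, pik, pki, pjk, pkj, pair_refl_self]; omega)
      (ne_sroot_of_adj ajk.symm
          (by simp only [pij, pji, pik, pki, pjk, pkj, pair_refl_self]; omega))
    have c2 : Big G n (refl G j (refl G k β)) := b2.desc'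
        (by simp only [pij, pji, pik, pki, pjk, pkj, pair_refl_self]; omega) (k := k)
        (by simp only [pij, pji, pik, pki, pjk, pkj, pair_refl_self]; omega)
      (ne_sroot_of_adj ajk (by simp only [pij, pji, pik, pki, pjk, pkj, pair_refl_self]; omega))
    rw [hg.nadj b1 (j := k) (by simp only [pij, pji, pik, pki, pjk, pkj, pair_refl_self]; omega)
        (by simp only [pij, pji, pik, pki, pjk, pkj, pair_refl_self]; omega) aik, hg.nadj c1
        (j := j) (by simp only [pij, pji, pik, pki, pjk, pkj, pair_refl_self]; omega)
        (by simp only [pij, pji, pik, pki, pjk, pkj, pair_refl_self]; omega) aij,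
      hg.nadj b2 (j := j) (by simp only [pij, pji, pik, pki, pjk, pkj, pair_refl_self]; omega)
          (by simp only [pij, pji, pik, pki, pjk, pkj, pair_refl_self]; omega) aij, hg.nadj c2
          (j := k) (by simp only [pij, pji, pik, pki, pjk, pkj, pair_refl_self]; omega)
          (by simp only [pij, pji, pik, pki, pjk, pkj, pair_refl_self]; omega) aik, refl_braid ajk]

theorem wtStep_consistent_adj_ik (hg : Good G n) (hb : Big G (n + 1) β)
    (hi : pair G i β ≤ 0) (hj : 0 < pair G j β) (hk : 0 < pair G k β)
    (hjk : j ≠ k) (ajk : ¬ G.Adj j k) (aij : ¬ G.Adj i j)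
    (aik : G.Adj i k) : wtStep G i j β = wtStep G i k β := by
  have nij : i ≠ j := by rintro rfl; omega
  have nik : i ≠ k := by rintro rfl; omega
  have aji : ¬ G.Adj j i := fun h => aij h.symm
  have pij := pair_refl_nadj nij aij
  have pji := pair_refl_nadj nij.symm aji
  have pik := pair_refl_adj aik
  have pki := pair_refl_adj aik.symm
  have akj : ¬ G.Adj k j := fun h => ajk h.symm
  have pjk := pair_refl_nadj hjk ajk
  have pkj := pair_refl_nadj hjk.symm akj
  have b1 : Big G n (refl G j β) := hb.desc hj (k := k)
      (by simp only [pij, pji, pik, pki, pjk, pkj, pair_refl_self]; omega)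
      (ne_sroot_of_nadj (l := j) hjk ajk
      (by simp only [pij, pji, pik, pki, pjk, pkj, pair_refl_self]; omega))
  have b2 : Big G n (refl G k β) := hb.desc hk (k := j)
      (by simp only [pij, pji, pik, pki, pjk, pkj, pair_refl_self]; omega)
      (ne_sroot_of_nadj (l := k) hjk.symm akj
      (by simp only [pij, pji, pik, pki, pjk, pkj, pair_refl_self]; omega))
  rw [wtStep_nadj aij]
  by_cases hc : pair G i β + pair G k β ≤ 0
  · rw [wtStep_adj_le aik hc, hg.adj_le b1 (j := k)
      (by simp only [pij, pji, pik, pki, pjk, pkj, pair_refl_self]; omega)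
      (by simp only [pij, pji, pik, pki, pjk, pkj, pair_refl_self]; omega) aik
      (by simp only [pij, pji, pik, pki, pjk, pkj, pair_refl_self]; omega), hg.nadj b2 (j := j)
      (by simp only [pij, pji, pik, pki, pjk, pkj, pair_refl_self]; omega)
      (by simp only [pij, pji, pik, pki, pjk, pkj, pair_refl_self]; omega) aij,
      hg.nadj b2 (j := j) (by simp only [pij, pji, pik, pki, pjk, pkj, pair_refl_self]; omega)
          (by simp only [pij, pji, pik, pki, pjk, pkj, pair_refl_self]; omega) akj,
          refl_comm hjk ajk]
  · have c2 : Big G n (refl G i (refl G k β)) := b2.desc'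
      (by simp only [pij, pji, pik, pki, pjk, pkj, pair_refl_self]; omega) (k := j)
      (by simp only [pij, pji, pik, pki, pjk, pkj, pair_refl_self]; omega)
      (ne_sroot_of_nadj (l := i) nij aij
          (by simp only [pij, pji, pik, pki, pjk, pkj, pair_refl_self]; omega))
    rw [wtStep_adj_gt aik (by omega), hg.adj_gt b1 (j := k)
        (by simp only [pij, pji, pik, pki, pjk, pkj, pair_refl_self]; omega)
        (by simp only [pij, pji, pik, pki, pjk, pkj, pair_refl_self]; omega) aik
        (by simp only [pij, pji, pik, pki, pjk, pkj, pair_refl_self]; omega),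
      hg.nadj c2 (j := j) (by simp only [pij, pji, pik, pki, pjk, pkj, pair_refl_self]; omega)
          (by simp only [pij, pji, pik, pki, pjk, pkj, pair_refl_self]; omega) akj,
          refl_comm nij.symm aji (refl G k β), refl_comm hjk ajk]

theorem wtStep_consistent_adj_ij_ik_le_le (hg : Good G n) (hb : Big G (n + 1) β)
    (hi : pair G i β ≤ 0) (hj : 0 < pair G j β) (hk : 0 < pair G k β)
    (hjk : j ≠ k) (ajk : ¬ G.Adj j k) (aij : G.Adj i j)
    (aik : G.Adj i k)
    (hja : pair G i β + pair G j β ≤ 0) (hka : pair G i β + pair G k β ≤ 0) :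
    wtStep G i j β = wtStep G i k β := by
  have nij : i ≠ j := by rintro rfl; omega
  have nik : i ≠ k := by rintro rfl; omega
  have pij := pair_refl_adj aij
  have pji := pair_refl_adj aij.symm
  have pik := pair_refl_adj aik
  have pki := pair_refl_adj aik.symm
  have akj : ¬ G.Adj k j := fun h => ajk h.symm
  have pjk := pair_refl_nadj hjk ajk
  have pkj := pair_refl_nadj hjk.symm akj
  have b1 : Big G n (refl G j β) := hb.desc hj (k := k)
      (by simp only [pij, pji, pik, pki, pjk, pkj, pair_refl_self]; omega)
      (ne_sroot_of_nadj (l := j) hjk ajk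
      (by simp only [pij, pji, pik, pki, pjk, pkj, pair_refl_self]; omega))
  have b2 : Big G n (refl G k β) := hb.desc hk (k := j)
      (by simp only [pij, pji, pik, pki, pjk, pkj, pair_refl_self]; omega)
      (ne_sroot_of_nadj (l := k) hjk.symm akj
      (by simp only [pij, pji, pik, pki, pjk, pkj, pair_refl_self]; omega))
  rw [wtStep_adj_le aij hja, wtStep_adj_le aik hka,
    hg.nadj b1 (i := j) (j := k)
        (by simp only [pij, pji, pik, pki, pjk, pkj, pair_refl_self]; omega)
        (by simp only [pij, pji, pik, pki, pjk, pkj, pair_refl_self]; omega) ajk, hg.nadj b2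
        (i := k) (j := j) (by simp only [pij, pji, pik, pki, pjk, pkj, pair_refl_self]; omega)
        (by simp only [pij, pji, pik, pki, pjk, pkj, pair_refl_self]; omega) akj]
  by_cases hc : pair G i β + pair G j β + pair G k β ≤ 0
  · rw [hg.adj_le b1 (j := k) (by simp only [pij, pji, pik, pki, pjk, pkj, pair_refl_self]; omega)
      (by simp only [pij, pji, pik, pki, pjk, pkj, pair_refl_self]; omega) aik
      (by simp only [pij, pji, pik, pki, pjk, pkj, pair_refl_self]; omega), hg.adj_le b2 (j := j)
      (by simp only [pij, pji, pik, pki, pjk, pkj, pair_refl_self]; omega)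
      (by simp only [pij, pji, pik, pki, pjk, pkj, pair_refl_self]; omega) aij
      (by simp only [pij, pji, pik, pki, pjk, pkj, pair_refl_self]; omega),
      refl_comm hjk ajk]
    ring
  · rw [hg.adj_gt b1 (j := k) (by simp only [pij, pji, pik, pki, pjk, pkj, pair_refl_self]; omega)
      (by simp only [pij, pji, pik, pki, pjk, pkj, pair_refl_self]; omega) aik
      (by simp only [pij, pji, pik, pki, pjk, pkj, pair_refl_self]; omega), hg.adj_gt b2 (j := j)
      (by simp only [pij, pji, pik, pki, pjk, pkj, pair_refl_self]; omega)
      (by simp only [pij, pji, pik, pki, pjk, pkj, pair_refl_self]; omega) aij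
      (by simp only [pij, pji, pik, pki, pjk, pkj, pair_refl_self]; omega),
      refl_comm hjk ajk]
    have c : Big G n (refl G j (refl G k β)) := b2.desc'
        (by simp only [pij, pji, pik, pki, pjk, pkj, pair_refl_self]; omega) (k := i)
        (by simp only [pij, pji, pik, pki, pjk, pkj, pair_refl_self]; omega)
      (fun h => by
        have e1 := congrArg (pair G j) h
        have e2 := congrArg (pair G k) h
        have e3 := congrArg (pair G i) h
        rw [pair_sroot_adj aij.symm] at e1
        rw [pair_sroot_adj aik.symm] at e2
        rw [pair_sroot_self] at e3
        simp only [pij, pji, pik, pki, pjk, pkj, pair_refl_self] at e1 e2 e3; omega)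
    rw [refl_comm hjk ajk] at c
    rw [hg.adj_le c (i := j) (j := i)
        (by simp only [pij, pji, pik, pki, pjk, pkj, pair_refl_self]; omega)
        (by simp only [pij, pji, pik, pki, pjk, pkj, pair_refl_self]; omega) aij.symm
        (by simp only [pij, pji, pik, pki, pjk, pkj, pair_refl_self]; omega),
      hg.adj_le c (i := k) (j := i)
          (by simp only [pij, pji, pik, pki, pjk, pkj, pair_refl_self]; omega)
          (by simp only [pij, pji, pik, pki, pjk, pkj, pair_refl_self]; omega) aik.symm
          (by simp only [pij, pji, pik, pki, pjk, pkj, pair_refl_self]; omega)]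
    ring

theorem wtStep_consistent_adj_ij_ik_le_gt (hg : Good G n) (hb : Big G (n + 1) β)
    (hi : pair G i β ≤ 0) (hj : 0 < pair G j β) (hk : 0 < pair G k β)
    (hjk : j ≠ k) (ajk : ¬ G.Adj j k) (aij : G.Adj i j)
    (aik : G.Adj i k)
    (hja : pair G i β + pair G j β ≤ 0) (hka : 0 < pair G i β + pair G k β) :
    wtStep G i j β = wtStep G i k β := by
  have nij : i ≠ j := by rintro rfl; omega
  have nik : i ≠ k := by rintro rfl; omega
  have pij := pair_refl_adj aij
  have pji := pair_refl_adj aij.symm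
  have pik := pair_refl_adj aik
  have pki := pair_refl_adj aik.symm
  have akj : ¬ G.Adj k j := fun h => ajk h.symm
  have pjk := pair_refl_nadj hjk ajk
  have pkj := pair_refl_nadj hjk.symm akj
  have b1 : Big G n (refl G j β) := hb.desc hj (k := k)
      (by simp only [pij, pji, pik, pki, pjk, pkj, pair_refl_self]; omega)
      (ne_sroot_of_nadj (l := j) hjk ajk
      (by simp only [pij, pji, pik, pki, pjk, pkj, pair_refl_self]; omega))
  have b2 : Big G n (refl G k β) := hb.desc hk (k := j)
      (by simp only [pij, pji, pik, pki, pjk, pkj, pair_refl_self]; omega)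
      (ne_sroot_of_nadj (l := k) hjk.symm akj
      (by simp only [pij, pji, pik, pki, pjk, pkj, pair_refl_self]; omega))
  have c : Big G n (refl G k (refl G j β)) := b1.desc'
      (by simp only [pij, pji, pik, pki, pjk, pkj, pair_refl_self]; omega) (k := i)
      (by simp only [pij, pji, pik, pki, pjk, pkj, pair_refl_self]; omega)
    (fun h => by
      have e1 := congrArg (pair G j) h
      have e2 := congrArg (pair G k) h
      rw [pair_sroot_adj aij.symm] at e1
      rw [pair_sroot_adj aik.symm] at e2
      simp only [pij, pji, pik, pki, pjk, pkj, pair_refl_self] at e1 e2; omega)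
  have d : Big G n (refl G i (refl G k (refl G j β))) := c.desc'
      (by simp only [pij, pji, pik, pki, pjk, pkj, pair_refl_self]; omega) (k := j)
      (by simp only [pij, pji, pik, pki, pjk, pkj, pair_refl_self]; omega)
    (fun h => by
      have e1 := congrArg (pair G j) h
      have e2 := congrArg (pair G k) h
      have e3 := congrArg (pair G i) h
      rw [pair_sroot_adj aij] at e3
      rw [pair_sroot_nadj hjk.symm akj] at e2
      rw [pair_sroot_self] at e1
      simp only [pij, pji, pik, pki, pjk, pkj, pair_refl_self] at e1 e2 e3; omega)
  have d' : Big G n (refl G i (refl G k β)) := b2.desc'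
      (by simp only [pij, pji, pik, pki, pjk, pkj, pair_refl_self]; omega) (k := j)
      (by simp only [pij, pji, pik, pki, pjk, pkj, pair_refl_self]; omega)
    (ne_sroot_of_nadj (l := k) hjk.symm akj
        (by simp only [pij, pji, pik, pki, pjk, pkj, pair_refl_self]; omega))
  have e' : Big G n (refl G j (refl G i (refl G k β))) := d'.desc'
      (by simp only [pij, pji, pik, pki, pjk, pkj, pair_refl_self]; omega) (k := i)
      (by simp only [pij, pji, pik, pki, pjk, pkj, pair_refl_self]; omega)
    (fun h => by
      have e1 := congrArg (pair G j) h
      have e2 := congrArg (pair G k) h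
      rw [pair_sroot_adj aij.symm] at e1
      rw [pair_sroot_adj aik.symm] at e2
      simp only [pij, pji, pik, pki, pjk, pkj, pair_refl_self] at e1 e2; omega)
  rw [wtStep_adj_le aij hja, wtStep_adj_gt aik hka, hg.adj_gt b1 (j := k)
      (by simp only [pij, pji, pik, pki, pjk, pkj, pair_refl_self]; omega)
      (by simp only [pij, pji, pik, pki, pjk, pkj, pair_refl_self]; omega) aik
      (by simp only [pij, pji, pik, pki, pjk, pkj, pair_refl_self]; omega),
    hg.nadj b1 (i := j) (j := k)
        (by simp only [pij, pji, pik, pki, pjk, pkj, pair_refl_self]; omega)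
        (by simp only [pij, pji, pik, pki, pjk, pkj, pair_refl_self]; omega) ajk, hg.adj_gt c
        (i := j) (j := i) (by simp only [pij, pji, pik, pki, pjk, pkj, pair_refl_self]; omega)
        (by simp only [pij, pji, pik, pki, pjk, pkj, pair_refl_self]; omega) aij.symm
        (by simp only [pij, pji, pik, pki, pjk, pkj, pair_refl_self]; omega),
    hg.nadj d (i := k) (j := j)
        (by simp only [pij, pji, pik, pki, pjk, pkj, pair_refl_self]; omega)
        (by simp only [pij, pji, pik, pki, pjk, pkj, pair_refl_self]; omega) akj, hg.nadj d'
        (i := k) (j := j) (by simp only [pij, pji, pik, pki, pjk, pkj, pair_refl_self]; omega)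
        (by simp only [pij, pji, pik, pki, pjk, pkj, pair_refl_self]; omega) akj,
    hg.adj_le e' (i := k) (j := i)
        (by simp only [pij, pji, pik, pki, pjk, pkj, pair_refl_self]; omega)
        (by simp only [pij, pji, pik, pki, pjk, pkj, pair_refl_self]; omega) aik.symm
        (by simp only [pij, pji, pik, pki, pjk, pkj, pair_refl_self]; omega),
        refl_comm hjk.symm akj,
    refl_braid aij]
  ring

theorem wtStep_consistent_adj_ij_ik_gt_gt (hg : Good G n) (hb : Big G (n + 1) β)
    (hi : pair G i β ≤ 0) (hj : 0 < pair G j β) (hk : 0 < pair G k β)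
    (hjk : j ≠ k) (ajk : ¬ G.Adj j k) (aij : G.Adj i j)
    (aik : G.Adj i k)
    (hja : 0 < pair G i β + pair G j β) (hka : 0 < pair G i β + pair G k β) :
    wtStep G i j β = wtStep G i k β := by
  have nij : i ≠ j := by rintro rfl; omega
  have nik : i ≠ k := by rintro rfl; omega
  have pij := pair_refl_adj aij
  have pji := pair_refl_adj aij.symm
  have pik := pair_refl_adj aik
  have pki := pair_refl_adj aik.symm
  have akj : ¬ G.Adj k j := fun h => ajk h.symm
  have pjk := pair_refl_nadj hjk ajk
  have pkj := pair_refl_nadj hjk.symm akj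
  have b1 : Big G n (refl G j β) := hb.desc hj (k := k)
      (by simp only [pij, pji, pik, pki, pjk, pkj, pair_refl_self]; omega)
      (ne_sroot_of_nadj (l := j) hjk ajk
      (by simp only [pij, pji, pik, pki, pjk, pkj, pair_refl_self]; omega))
  have b2 : Big G n (refl G k β) := hb.desc hk (k := j)
      (by simp only [pij, pji, pik, pki, pjk, pkj, pair_refl_self]; omega)
      (ne_sroot_of_nadj (l := k) hjk.symm akj
      (by simp only [pij, pji, pik, pki, pjk, pkj, pair_refl_self]; omega))
  rw [wtStep_adj_gt aij hja, wtStep_adj_gt aik hka]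
  by_cases hd : refl G i (refl G j β) = sroot k
  · have e1 := congrArg (pair G j) hd
    have e2 := congrArg (pair G k) hd
    have e3 := congrArg (pair G i) hd
    rw [pair_sroot_nadj hjk ajk] at e1
    rw [pair_sroot_self] at e2
    rw [pair_sroot_adj aik] at e3
    simp only [pij, pji, pik, pki, pjk, pkj, pair_refl_self] at e1 e2 e3
    have h1 : pair G i β = 0 := by omega
    have h2 : pair G j β = 1 := by omega
    have h3 : pair G k β = 1 := by omega
    have hd' : refl G i (refl G k β) = sroot j := by
      have e := eq_refl_of_refl_eq (eq_refl_of_refl_eq hd).symm.symm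
      have q1 : pair G i (sroot k) = -1 := pair_sroot_adj aik
      have q2 : pair G j (refl G i (sroot k)) = -1 := by
        rw [pji, pair_sroot_nadj hjk ajk, q1]; norm_num
      have e' : β = sroot k + sroot i + sroot j := by
        rw [e, refl, q2, refl, q1]; module
      rw [refl, pik, refl, h1, h3, e']; module
    rw [hd, hd', wt_sroot_nadj ajk, wt_sroot_nadj akj]
  · have hd' : refl G i (refl G k β) ≠ sroot j := by
      intro hd'
      apply hd
      have e1 := congrArg (pair G j) hd'
      have e2 := congrArg (pair G k) hd'
      have e3 := congrArg (pair G i) hd'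
      rw [pair_sroot_nadj hjk.symm akj] at e2
      rw [pair_sroot_self] at e1
      rw [pair_sroot_adj aij] at e3
      simp only [pij, pji, pik, pki, pjk, pkj, pair_refl_self] at e1 e2 e3
      have h1 : pair G i β = 0 := by omega
      have h2 : pair G j β = 1 := by omega
      have h3 : pair G k β = 1 := by omega
      have e := eq_refl_of_refl_eq (eq_refl_of_refl_eq hd').symm.symm
      have q1 : pair G i (sroot j) = -1 := pair_sroot_adj aij
      have q2 : pair G k (refl G i (sroot j)) = -1 := by
        rw [pki, pair_sroot_nadj hjk.symm akj, q1]; norm_num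
      have e' : β = sroot k + sroot i + sroot j := by
        rw [e, refl, q2, refl, q1]; module
      rw [refl, pij, refl, h1, h2, e']; module
    have d : Big G n (refl G i (refl G j β)) := b1.desc'
        (by simp only [pij, pji, pik, pki, pjk, pkj, pair_refl_self]; omega) (k := k)
        (by simp only [pij, pji, pik, pki, pjk, pkj, pair_refl_self]; omega) hd
    have d' : Big G n (refl G i (refl G k β)) := b2.desc'
        (by simp only [pij, pji, pik, pki, pjk, pkj, pair_refl_self]; omega) (k := j)
        (by simp only [pij, pji, pik, pki, pjk, pkj, pair_refl_self]; omega) hd'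
    have f : Big G n (refl G k (refl G i (refl G j β))) := d.desc'
        (by simp only [pij, pji, pik, pki, pjk, pkj, pair_refl_self]; omega) (k := i)
        (by simp only [pij, pji, pik, pki, pjk, pkj, pair_refl_self]; omega)
      (fun h => by
        have e1 := congrArg (pair G j) h
        have e2 := congrArg (pair G k) h
        have e3 := congrArg (pair G i) h
        rw [pair_sroot_adj aij.symm] at e1
        rw [pair_sroot_adj aik.symm] at e2
        rw [pair_sroot_self] at e3
        simp only [pij, pji, pik, pki, pjk, pkj, pair_refl_self] at e1 e2 e3; omega)
    have f' : Big G n (refl G j (refl G i (refl G k β))) := d'.desc'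
        (by simp only [pij, pji, pik, pki, pjk, pkj, pair_refl_self]; omega) (k := i)
        (by simp only [pij, pji, pik, pki, pjk, pkj, pair_refl_self]; omega)
      (fun h => by
        have e1 := congrArg (pair G j) h
        have e2 := congrArg (pair G k) h
        have e3 := congrArg (pair G i) h
        rw [pair_sroot_adj aij.symm] at e1
        rw [pair_sroot_adj aik.symm] at e2
        rw [pair_sroot_self] at e3
        simp only [pij, pji, pik, pki, pjk, pkj, pair_refl_self] at e1 e2 e3; omega)
    have key : refl G j (refl G i (refl G k (refl G i (refl G j β)))) =
        refl G k (refl G i (refl G j (refl G i (refl G k β)))) := by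
      rw [refl_braid aik, refl_comm hjk ajk, refl_comm hjk.symm akj (refl G i _),
        refl_comm hjk.symm akj β, refl_braid aij, refl_comm hjk ajk (refl G i _)]
    rw [hg.nadj d (i := j) (j := k)
        (by simp only [pij, pji, pik, pki, pjk, pkj, pair_refl_self]; omega)
        (by simp only [pij, pji, pik, pki, pjk, pkj, pair_refl_self]; omega) ajk, hg.nadj d'
        (i := k) (j := j) (by simp only [pij, pji, pik, pki, pjk, pkj, pair_refl_self]; omega)
        (by simp only [pij, pji, pik, pki, pjk, pkj, pair_refl_self]; omega) akj,
      hg.adj_gt f (i := j) (j := i)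
          (by simp only [pij, pji, pik, pki, pjk, pkj, pair_refl_self]; omega)
          (by simp only [pij, pji, pik, pki, pjk, pkj, pair_refl_self]; omega) aij.symm
          (by simp only [pij, pji, pik, pki, pjk, pkj, pair_refl_self]; omega),
      hg.adj_gt f' (i := k) (j := i)
          (by simp only [pij, pji, pik, pki, pjk, pkj, pair_refl_self]; omega)
          (by simp only [pij, pji, pik, pki, pjk, pkj, pair_refl_self]; omega) aik.symm
          (by simp only [pij, pji, pik, pki, pjk, pkj, pair_refl_self]; omega), key]

theorem wtStep_consistent_adj_ik_jk_gt (hg : Good G n) (hb : Big G (n + 1) β)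
    (hi : pair G i β ≤ 0) (hj : 0 < pair G j β) (hk : 0 < pair G k β)
    (hjk : j ≠ k) (ajk : G.Adj j k) (aij : ¬ G.Adj i j)
    (aik : G.Adj i k)
    (hka : 0 < pair G i β + pair G k β) : wtStep G i j β = wtStep G i k β := by
  have nij : i ≠ j := by rintro rfl; omega
  have nik : i ≠ k := by rintro rfl; omega
  have aji : ¬ G.Adj j i := fun h => aij h.symm
  have pij := pair_refl_nadj nij aij
  have pji := pair_refl_nadj nij.symm aji
  have pik := pair_refl_adj aik
  have pki := pair_refl_adj aik.symm
  have pjk := pair_refl_adj ajk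
  have pkj := pair_refl_adj ajk.symm
  have b1 : Big G n (refl G j β) := hb.desc hj (k := k)
      (by simp only [pij, pji, pik, pki, pjk, pkj, pair_refl_self]; omega) (fun h => by
      have e1 := congrArg (pair G j) h
      have e2 := congrArg (pair G k) h
      have e3 := congrArg (pair G i) h
      rw [pair_sroot_adj ajk] at e1
      rw [pair_sroot_adj aik] at e3
      rw [pair_sroot_self] at e2
      simp only [pij, pji, pik, pki, pjk, pkj, pair_refl_self] at e1 e2 e3; omega)
  have b2 : Big G n (refl G k β) := hb.desc hk (k := i)
      (by simp only [pij, pji, pik, pki, pjk, pkj, pair_refl_self]; omega)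
      (ne_sroot_of_nadj (l := j) nij.symm aji
      (by simp only [pij, pji, pik, pki, pjk, pkj, pair_refl_self]; omega))
  have c1 : Big G n (refl G k (refl G j β)) := b1.desc'
      (by simp only [pij, pji, pik, pki, pjk, pkj, pair_refl_self]; omega) (k := i)
      (by simp only [pij, pji, pik, pki, pjk, pkj, pair_refl_self]; omega)
    (ne_sroot_of_nadj (l := j) nij.symm aji
        (by simp only [pij, pji, pik, pki, pjk, pkj, pair_refl_self]; omega))
  have d1 : Big G n (refl G i (refl G k (refl G j β))) := c1.desc'
      (by simp only [pij, pji, pik, pki, pjk, pkj, pair_refl_self]; omega) (k := j)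
      (by simp only [pij, pji, pik, pki, pjk, pkj, pair_refl_self]; omega)
    (ne_sroot_of_nadj (l := i) nij aij
        (by simp only [pij, pji, pik, pki, pjk, pkj, pair_refl_self]; omega))
  have c2 : Big G n (refl G i (refl G k β)) := b2.desc'
      (by simp only [pij, pji, pik, pki, pjk, pkj, pair_refl_self]; omega) (k := j)
      (by simp only [pij, pji, pik, pki, pjk, pkj, pair_refl_self]; omega)
    (ne_sroot_of_nadj (l := i) nij aij
        (by simp only [pij, pji, pik, pki, pjk, pkj, pair_refl_self]; omega))
  have d2 : Big G n (refl G j (refl G i (refl G k β))) := c2.desc'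
      (by simp only [pij, pji, pik, pki, pjk, pkj, pair_refl_self]; omega) (k := k)
      (by simp only [pij, pji, pik, pki, pjk, pkj, pair_refl_self]; omega)
    (ne_sroot_of_adj ajk (by simp only [pij, pji, pik, pki, pjk, pkj, pair_refl_self]; omega))
  have f2 : Big G n (refl G k (refl G j (refl G i (refl G k β)))) := d2.desc'
      (by simp only [pij, pji, pik, pki, pjk, pkj, pair_refl_self]; omega) (k := i)
      (by simp only [pij, pji, pik, pki, pjk, pkj, pair_refl_self]; omega)
    (fun h => by
      have e1 := congrArg (pair G j) h
      have e2 := congrArg (pair G k) h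
      rw [pair_sroot_nadj nij.symm aji] at e1
      rw [pair_sroot_adj aik.symm] at e2
      simp only [pij, pji, pik, pki, pjk, pkj, pair_refl_self] at e1 e2; omega)
  have key : refl G i (refl G k (refl G j (refl G i (refl G k β)))) =
      refl G k (refl G j (refl G i (refl G k (refl G j β)))) := by
    rw [refl_comm nij.symm aji (refl G k (refl G j β)), refl_braid ajk, refl_comm nij.symm aji,
      refl_braid aik]
  rw [wtStep_nadj aij, wtStep_adj_gt aik hka, hg.adj_gt b1 (j := k)
      (by simp only [pij, pji, pik, pki, pjk, pkj, pair_refl_self]; omega)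
      (by simp only [pij, pji, pik, pki, pjk, pkj, pair_refl_self]; omega) aik
      (by simp only [pij, pji, pik, pki, pjk, pkj, pair_refl_self]; omega),
    hg.adj_gt d1 (i := k) (j := j)
        (by simp only [pij, pji, pik, pki, pjk, pkj, pair_refl_self]; omega)
        (by simp only [pij, pji, pik, pki, pjk, pkj, pair_refl_self]; omega) ajk.symm
        (by simp only [pij, pji, pik, pki, pjk, pkj, pair_refl_self]; omega),
    hg.adj_gt c2 (i := k) (j := j)
        (by simp only [pij, pji, pik, pki, pjk, pkj, pair_refl_self]; omega)
        (by simp only [pij, pji, pik, pki, pjk, pkj, pair_refl_self]; omega) ajk.symm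
        (by simp only [pij, pji, pik, pki, pjk, pkj, pair_refl_self]; omega),
    hg.nadj f2 (i := j) (j := i)
        (by simp only [pij, pji, pik, pki, pjk, pkj, pair_refl_self]; omega)
        (by simp only [pij, pji, pik, pki, pjk, pkj, pair_refl_self]; omega) aji, key]

theorem wtStep_consistent_adj_ik_jk_le (hg : Good G n) (hb : Big G (n + 1) β)
    (hi : pair G i β ≤ 0) (hj : 0 < pair G j β) (hk : 0 < pair G k β)
    (hjk : j ≠ k) (ajk : G.Adj j k) (aij : ¬ G.Adj i j)
    (aik : G.Adj i k)
    (hka : pair G i β + pair G k β ≤ 0) : wtStep G i j β = wtStep G i k β := by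
  have nij : i ≠ j := by rintro rfl; omega
  have nik : i ≠ k := by rintro rfl; omega
  have aji : ¬ G.Adj j i := fun h => aij h.symm
  have pij := pair_refl_nadj nij aij
  have pji := pair_refl_nadj nij.symm aji
  have pik := pair_refl_adj aik
  have pki := pair_refl_adj aik.symm
  have pjk := pair_refl_adj ajk
  have pkj := pair_refl_adj ajk.symm
  rw [wtStep_nadj aij, wtStep_adj_le aik hka]
  by_cases hd : refl G k β = sroot j
  · have e1 := congrArg (pair G j) hd
    have e2 := congrArg (pair G k) hd
    rw [pair_sroot_self] at e1
    rw [pair_sroot_adj ajk.symm] at e2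
    simp only [pij, pji, pik, pki, pjk, pkj, pair_refl_self] at e1 e2
    have h2 : pair G j β = 1 := by omega
    have e : β = refl G k (sroot j) := eq_refl_of_refl_eq hd
    have hd' : refl G j β = sroot k := by
      rw [refl, h2, e, refl, pair_sroot_adj ajk.symm]; module
    rw [hd, hd', wt_sroot_nadj aij, wt_sroot_adj aik, wt_sroot_adj ajk.symm]; norm_num
  have hd' : refl G j β ≠ sroot k := by
    intro hd'
    apply hd
    have e1 := congrArg (pair G j) hd'
    have e2 := congrArg (pair G k) hd'
    rw [pair_sroot_self] at e2
    rw [pair_sroot_adj ajk] at e1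
    simp only [pij, pji, pik, pki, pjk, pkj, pair_refl_self] at e1 e2
    have h2 : pair G k β = 1 := by omega
    have e : β = refl G j (sroot k) := eq_refl_of_refl_eq hd'
    rw [refl, h2, e, refl, pair_sroot_adj ajk]; module
  have b1 : Big G n (refl G j β) := hb.desc hj (k := k)
      (by simp only [pij, pji, pik, pki, pjk, pkj, pair_refl_self]; omega) hd'
  have b2 : Big G n (refl G k β) := hb.desc hk (k := j)
      (by simp only [pij, pji, pik, pki, pjk, pkj, pair_refl_self]; omega) hd
  have c1 : Big G n (refl G k (refl G j β)) := b1.desc'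
      (by simp only [pij, pji, pik, pki, pjk, pkj, pair_refl_self]; omega) (k := j)
      (by simp only [pij, pji, pik, pki, pjk, pkj, pair_refl_self]; omega)
    (ne_sroot_of_adj ajk.symm (by simp only [pij, pji, pik, pki, pjk, pkj, pair_refl_self]; omega))
  have c2 : Big G n (refl G j (refl G k β)) := b2.desc'
      (by simp only [pij, pji, pik, pki, pjk, pkj, pair_refl_self]; omega) (k := k)
      (by simp only [pij, pji, pik, pki, pjk, pkj, pair_refl_self]; omega)
    (ne_sroot_of_adj ajk (by simp only [pij, pji, pik, pki, pjk, pkj, pair_refl_self]; omega))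
  rw [hg.nadj b2 (j := j) (by simp only [pij, pji, pik, pki, pjk, pkj, pair_refl_self]; omega)
      (by simp only [pij, pji, pik, pki, pjk, pkj, pair_refl_self]; omega) aij, hg.adj_gt b2
      (i := k) (j := j) (by simp only [pij, pji, pik, pki, pjk, pkj, pair_refl_self]; omega)
      (by simp only [pij, pji, pik, pki, pjk, pkj, pair_refl_self]; omega) ajk.symm
      (by simp only [pij, pji, pik, pki, pjk, pkj, pair_refl_self]; omega)]
  by_cases hc : pair G i β + pair G j β + pair G k β ≤ 0
  · rw [hg.adj_le b1 (j := k) (by simp only [pij, pji, pik, pki, pjk, pkj, pair_refl_self]; omega)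
      (by simp only [pij, pji, pik, pki, pjk, pkj, pair_refl_self]; omega) aik
      (by simp only [pij, pji, pik, pki, pjk, pkj, pair_refl_self]; omega), hg.nadj c1 (j := j)
      (by simp only [pij, pji, pik, pki, pjk, pkj, pair_refl_self]; omega)
      (by simp only [pij, pji, pik, pki, pjk, pkj, pair_refl_self]; omega) aij,
      hg.adj_le c1 (i := k) (j := j)
          (by simp only [pij, pji, pik, pki, pjk, pkj, pair_refl_self]; omega)
          (by simp only [pij, pji, pik, pki, pjk, pkj, pair_refl_self]; omega) ajk.symm
          (by simp only [pij, pji, pik, pki, pjk, pkj, pair_refl_self]; omega),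
      hg.adj_le c2 (j := k) (by simp only [pij, pji, pik, pki, pjk, pkj, pair_refl_self]; omega)
          (by simp only [pij, pji, pik, pki, pjk, pkj, pair_refl_self]; omega) aik
          (by simp only [pij, pji, pik, pki, pjk, pkj, pair_refl_self]; omega), refl_braid ajk]
    ring
  · have d1 : Big G n (refl G i (refl G k (refl G j β))) := c1.desc'
      (by simp only [pij, pji, pik, pki, pjk, pkj, pair_refl_self]; omega) (k := j)
      (by simp only [pij, pji, pik, pki, pjk, pkj, pair_refl_self]; omega)
      (ne_sroot_of_nadj (l := i) nij aij
          (by simp only [pij, pji, pik, pki, pjk, pkj, pair_refl_self]; omega))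
    have w : Big G n (refl G k (refl G j (refl G k β))) := c2.desc'
        (by simp only [pij, pji, pik, pki, pjk, pkj, pair_refl_self]; omega) (k := i)
        (by simp only [pij, pji, pik, pki, pjk, pkj, pair_refl_self]; omega)
      (ne_sroot_of_nadj (l := j) nij.symm aji
          (by simp only [pij, pji, pik, pki, pjk, pkj, pair_refl_self]; omega))
    rw [hg.adj_gt b1 (j := k) (by simp only [pij, pji, pik, pki, pjk, pkj, pair_refl_self]; omega)
        (by simp only [pij, pji, pik, pki, pjk, pkj, pair_refl_self]; omega) aik
        (by simp only [pij, pji, pik, pki, pjk, pkj, pair_refl_self]; omega), hg.adj_le d1 (i := k)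
        (j := j) (by simp only [pij, pji, pik, pki, pjk, pkj, pair_refl_self]; omega)
        (by simp only [pij, pji, pik, pki, pjk, pkj, pair_refl_self]; omega) ajk.symm
        (by simp only [pij, pji, pik, pki, pjk, pkj, pair_refl_self]; omega),
      hg.adj_gt c2 (j := k) (by simp only [pij, pji, pik, pki, pjk, pkj, pair_refl_self]; omega)
          (by simp only [pij, pji, pik, pki, pjk, pkj, pair_refl_self]; omega) aik
          (by simp only [pij, pji, pik, pki, pjk, pkj, pair_refl_self]; omega), hg.nadj w (i := j)
          (j := i) (by simp only [pij, pji, pik, pki, pjk, pkj, pair_refl_self]; omega)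
          (by simp only [pij, pji, pik, pki, pjk, pkj, pair_refl_self]; omega) aji,
      refl_comm nij.symm aji, refl_braid ajk]
    ring

end

theorem wtStep_consistent (htf : ∀ i j k, G.Adj i j → G.Adj j k → ¬ G.Adj i k)
    {n : ℕ} (hg : Good G n) {β : V → ℤ} (hb : Big G (n + 1) β) {i j k : V}
    (hi : pair G i β ≤ 0) (hj : 0 < pair G j β) (hk : 0 < pair G k β) :
    wtStep G i j β = wtStep G i k β := by
  by_cases hjk : j = k
  · rw [hjk]
  by_cases ajk : G.Adj j k <;> by_cases aij : G.Adj i j <;> by_cases aik : G.Adj i k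
  · exact absurd ajk.symm (fun h => htf _ _ _ aij ajk aik)
  · by_cases hc : pair G i β + pair G j β ≤ 0
    · exact (wtStep_consistent_adj_ik_jk_le hg hb hi hk hj (Ne.symm hjk) ajk.symm aik aij hc).symm
    · exact (wtStep_consistent_adj_ik_jk_gt hg hb hi hk hj (Ne.symm hjk) ajk.symm aik aij
        (by omega)).symm
  · by_cases hc : pair G i β + pair G k β ≤ 0
    · exact wtStep_consistent_adj_ik_jk_le hg hb hi hj hk hjk ajk aij aik hc
    · exact wtStep_consistent_adj_ik_jk_gt hg hb hi hj hk hjk ajk aij aik (by omega)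
  · exact wtStep_consistent_adj_jk hg hb hi hj hk hjk ajk aij aik
  · have akj : ¬ G.Adj k j := fun h => ajk h.symm
    by_cases h1 : pair G i β + pair G j β ≤ 0 <;> by_cases h2 : pair G i β + pair G k β ≤ 0
    · exact wtStep_consistent_adj_ij_ik_le_le hg hb hi hj hk hjk ajk aij aik h1 h2
    · exact wtStep_consistent_adj_ij_ik_le_gt hg hb hi hj hk hjk ajk aij aik h1 (by omega)
    · exact (wtStep_consistent_adj_ij_ik_le_gt hg hb hi hk hj (Ne.symm hjk) akj aik aij h2
        (by omega)).symm
    · exact wtStep_consistent_adj_ij_ik_gt_gt hg hb hi hj hk hjk ajk aij aik (by omega) (by omega)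
  · exact (wtStep_consistent_adj_ik hg hb hi hk hj (Ne.symm hjk) (fun h => ajk h.symm) aik aij).symm
  · exact wtStep_consistent_adj_ik hg hb hi hj hk hjk ajk aij aik
  · exact wtStep_consistent_nadj hg hb hi hj hk hjk ajk aij aik

theorem good (htf : ∀ i j k, G.Adj i j → G.Adj j k → ¬ G.Adj i k) (n : ℕ) : Good G n := by
  induction n with
  | zero => intro γ h h1 h2; push_cast at h2; omega
  | succ n ih =>
    intro γ h h1 h2 i j hi hj
    obtain ⟨k, hk, e⟩ := wt_eq_wtStep h h1 hi
    rw [e]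
    exact wtStep_consistent htf ih ⟨h, h1, h2⟩ hi hk hj

end SmallType

end

section

namespace SmallType

variable {V : Type*} [Fintype V] {G : SimpleGraph V}

variable (G) in
/-- The graph has no triangles. -/
def TriangleFree : Prop := ∀ i j k, G.Adj i j → G.Adj j k → ¬ G.Adj i k

theorem IsRoot.one_lt_of_up {β : V → ℤ} {j : V} (h : IsRoot G β) (hj : pair G j β < 0) :
    1 < ∑ l, refl G j β l := by rw [sum_refl]; have := h.sum_pos; omega

theorem IsRoot.big {β : V → ℤ} (h : IsRoot G β) (hs : 1 < ∑ l, β l) :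
    Big G (∑ l, β l).toNat β := ⟨h, hs, by omega⟩

theorem IsRoot.big_up {β : V → ℤ} {j : V} (h : IsRoot G β) (hj : pair G j β < 0) :
    Big G (∑ l, refl G j β l).toNat (refl G j β) := (h.up j hj).big (h.one_lt_of_up hj)

section
variable {β : V → ℤ} {i j : V}

theorem wt_up_nadj (htf : TriangleFree G) (h : IsRoot G β)
    (ha : ¬ G.Adj i j) (hij : i ≠ j) (hi : pair G i β ≤ 0)
    (hj : pair G j β < 0) : wt G i (refl G j β) = wt G i β := by
  rw [(good htf _).nadj (h.big_up hj) (j := j) (by rwa [pair_refl_nadj hij ha])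
    (by rw [pair_refl_self]; omega) ha, refl_refl]

theorem wt_refl_nadj (htf : TriangleFree G) (h : IsRoot G β)
    (ha : ¬ G.Adj i j) (hij : i ≠ j) (hi : pair G i β ≤ 0)
    (hne : β ≠ sroot j) : wt G i (refl G j β) = wt G i β := by
  rcases lt_trichotomy (pair G j β) 0 with hj | hj | hj
  · exact wt_up_nadj htf h ha hij hi hj
  · rw [refl_of_pair_eq_zero hj]
  · have := wt_up_nadj htf (h.down hj hne) ha hij (by rwa [pair_refl_nadj hij ha])
      (by rw [pair_refl_self]; omega)
    rw [← this, refl_refl]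

theorem wt_up_adj (htf : TriangleFree G) (h : IsRoot G β)
    (ha : G.Adj i j) (hi : pair G i β ≤ 0)
    (hj : pair G j β < 0) : wt G i (refl G j β) = wt G i β + 2 * wt G j β := by
  rw [(good htf _).adj_le (h.big_up hj) (j := j) (by rw [pair_refl_adj ha]; omega)
    (by rw [pair_refl_self]; omega) ha (by rw [pair_refl_adj ha, pair_refl_self]; omega),
    refl_refl]

theorem wt_up_up_adj (htf : TriangleFree G) (h : IsRoot G β)
    (ha : G.Adj i j) (hi : pair G i β < 0) (hj : pair G j β ≤ 0) :
    wt G i (refl G j (refl G i β)) = 2 * wt G j β := by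
  have hi' := h.up i hi
  have hj' : pair G j (refl G i β) < 0 := by rw [pair_refl_adj ha.symm]; omega
  have p1 : pair G i (refl G j (refl G i β)) = pair G j β := by
    rw [pair_refl_adj ha, pair_refl_self, pair_refl_adj ha.symm]; omega
  have p2 : pair G j (refl G j (refl G i β)) = - pair G j β - pair G i β := by
    rw [pair_refl_self, pair_refl_adj ha.symm]; omega
  rw [(good htf _).adj_gt (hi'.big_up hj') (j := j) (by omega) (by omega) ha (by omega),
    refl_refl, refl_refl]

end

theorem wt_eq_of_pair_eq_zero_aux (htf : TriangleFree G) (n : ℕ) :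
    ∀ (i j : V) (β : V → ℤ), G.Adj i j → IsRoot G β → ∑ l,
        β l ≤ n → pair G i β = 0 → pair G j β = 0 →
    wt G i β = wt G j β := by
  induction n using Nat.strong_induction_on with
  | _ n ih =>
    intro i j β ha h hn hi hj
    by_cases hs : ∑ l, β l ≤ 1
    · obtain ⟨k, rfl⟩ := h.eq_sroot_of_sum hs
      rw [wt_sroot_nadj (fun h => by rw [pair_sroot_adj h] at hi; omega),
        wt_sroot_nadj (fun h => by rw [pair_sroot_adj h] at hj; omega)]
    push Not at hs
    have hb := h.big hs
    obtain ⟨k, hk⟩ := h.exists_pair_pos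
    have hr := hb.root_down hk
    have hsum := sum_refl (G := G) k β
    have hik : i ≠ k := by rintro rfl; omega
    have hjk : j ≠ k := by rintro rfl; omega
    have hg := good htf (∑ l, β l).toNat
    have key : ∀ i j : V, G.Adj i j → i ≠ k → j ≠ k → pair G i β = 0 → pair G j β = 0 →
        G.Adj i k → wt G i β = wt G j β := by
      intro i j hij hik hjk hi hj aik
      have ajk : ¬ G.Adj j k := htf _ _ _ hij.symm aik
      have e1 : pair G i (refl G k β) = pair G k β := by rw [pair_refl_adj aik, hi]; omega
      have e2 : pair G j (refl G k β) = 0 := by rw [pair_refl_nadj hjk ajk, hj]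
      have e3 : pair G k (refl G k β) = - pair G k β := pair_refl_self _ _
      have b1 := hb.desc' hk (k := i) (by omega)
        (ne_sroot_of_adj hij.symm (by omega))
      have d1 : pair G i (refl G i (refl G k β)) = - pair G k β := by rw [pair_refl_self, e1]
      have d2 : pair G j (refl G i (refl G k β)) = pair G k β := by
        rw [pair_refl_adj hij.symm, e1, e2]; omega
      have d3 : pair G k (refl G i (refl G k β)) = 0 := by
        rw [pair_refl_adj aik.symm, e1, e3]; omega
      have b2 := b1.desc' (j := i) (k := j) (by omega) (by omega) (fun h => by
        have q1 := congrArg (pair G i) h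
        have q2 := congrArg (pair G j) h
        rw [pair_sroot_adj hij] at q1
        rw [pair_sroot_self] at q2
        omega)
      have hkj : ¬ G.Adj k j := fun h => ajk h.symm
      rw [hg.adj_gt hb (j := k) hi.le hk aik (by omega), hg.nadj hb (i := j) hj.le hk ajk,
        hg.adj_gt b1 (i := j) (j := i) (by omega) (by omega) hij.symm (by omega),
        hg.nadj b2 (i := k) (j := j) (by omega) (by omega) hkj]
      have f1 : pair G i (refl G j (refl G i (refl G k β))) = 0 := by
        rw [pair_refl_adj hij]; omega
      have f2 : pair G k (refl G j (refl G i (refl G k β))) = 0 := by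
        rw [pair_refl_nadj hjk.symm hkj]; omega
      have s1 := sum_refl (G := G) i (refl G k β)
      have s2 := sum_refl (G := G) j (refl G i (refl G k β))
      have r3 := b2.root_down (j := j) (by omega)
      have := r3.sum_pos
      rw [ih (∑ l, refl G j (refl G i (refl G k β)) l).toNat (by omega) i k _ aik r3 (by omega)
        f1 f2]
    by_cases aik : G.Adj i k
    · exact key i j ha hik hjk hi hj aik
    by_cases ajk : G.Adj j k
    · exact (key j i ha.symm hjk hik hj hi ajk).symm
    rw [hg.nadj hb hi.le hk aik, hg.nadj hb hj.le hk ajk]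
    exact ih (∑ l, refl G k β l).toNat (by have := hr.sum_pos; omega) i j _ ha hr (by omega)
      (by rw [pair_refl_nadj hik aik, hi]) (by rw [pair_refl_nadj hjk ajk, hj])

theorem wt_eq_of_pair_eq_zero (htf : TriangleFree G) {i j : V} (ha : G.Adj i j) {β : V → ℤ}
    (h : IsRoot G β) (hi : pair G i β = 0) (hj : pair G j β = 0) : wt G i β = wt G j β :=
  wt_eq_of_pair_eq_zero_aux htf (∑ l, β l).toNat i j β ha h (by have := h.sum_pos; omega) hi hj

end SmallType

end

section

namespace SmallType

variable {V : Type*} [Fintype V] {G : SimpleGraph V} {R : Type*} [CommRing R]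

/-- The local coefficient of the Hecke-type operators. -/
def hecke (p : ℤ) (a b : R) : R := if p < 0 then a + b else if p = 0 then 2 * a else 2 * b

theorem hecke_neg {p : ℤ} (h : p < 0) (a b : R) : hecke p a b = a + b := by simp [hecke, h]

theorem hecke_zero {p : ℤ} (h : p = 0) (a b : R) : hecke p a b = 2 * a := by simp [hecke, h]

theorem hecke_pos {p : ℤ} (h : 0 < p) (a b : R) : hecke p a b = 2 * b := by
  simp [hecke, h.ne', h.le]

theorem hecke_comm (x y : ℤ) (a b c d : R) (hx : x = 0 → a = b ∧ c = d)
    (hy : y = 0 → a = c ∧ b = d) :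
    hecke x (hecke y a c) (hecke y b d) = hecke y (hecke x a b) (hecke x c d) := by
  grind [hecke]

theorem hecke_braid (x y : ℤ) (a0 a1 a2 a3 a4 a5 : R) (hx : x = 0 → a0 = a1 ∧ a3 = a5)
    (hy : y = 0 → a0 = a2 ∧ a4 = a5) (hxy : x + y = 0 → a2 = a3 ∧ a1 = a4) :
    hecke x (hecke y (hecke x a0 a1) (hecke (x + y) a2 a3))
      (hecke (x + y) (hecke (-x) a1 a0) (hecke y a4 a5)) =
    hecke y (hecke x (hecke y a0 a2) (hecke (x + y) a1 a4))
      (hecke (x + y) (hecke (-y) a2 a0) (hecke x a3 a5)) := by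
  rcases lt_trichotomy x 0 with h | h | h <;> rcases lt_trichotomy y 0 with h' | h' | h' <;>
  rcases lt_trichotomy (x + y) 0 with h'' | h'' | h'' <;> first | omega | grind [hecke]

open Classical in
/-- The transposed main part of the operator attached to `i`. -/
noncomputable def phi (G : SimpleGraph V) (i : V) (F : (V → ℤ) → R) (β : V → ℤ) : R :=
  if β = sroot i then 0 else hecke (pair G i β) (F β) (F (refl G i β))

theorem phi_sroot (i : V) (F : (V → ℤ) → R) : phi G i F (sroot i) = 0 := by simp [phi]

theorem phi_of_ne {i : V} {β : V → ℤ} (h : β ≠ sroot i) (F : (V → ℤ) → R) :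
    phi G i F β = hecke (pair G i β) (F β) (F (refl G i β)) := by simp [phi, h]

theorem hecke_congr {p : ℤ} {a b c d : R} (h1 : p ≤ 0 → a = c) (h2 : p ≠ 0 → b = d) :
    hecke p a b = hecke p c d := by
  grind [hecke]

theorem hecke_add (p : ℤ) (a b c d : R) :
    hecke p (a + b) (c + d) = hecke p a c + hecke p b d := by
  grind [hecke]

theorem hecke_mul (p : ℤ) (a b c : R) : hecke p (a * c) (b * c) = hecke p a b * c := by
  grind [hecke]

theorem phi_add (i : V) (F F' : (V → ℤ) → R) (β : V → ℤ) :
    phi G i (fun γ => F γ + F' γ) β = phi G i F β + phi G i F' β := by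
  unfold phi; split_ifs
  · simp
  · exact hecke_add _ _ _ _ _

theorem phi_mul (i : V) (F : (V → ℤ) → R) (c : R) (β : V → ℤ) :
    phi G i (fun γ => F γ * c) β = phi G i F β * c := by
  unfold phi; split_ifs
  · simp
  · exact hecke_mul _ _ _ _

theorem phi_congr {i : V} {β : V → ℤ} (h : IsRoot G β) {F F' : (V → ℤ) → R}
    (hF : ∀ γ, IsRoot G γ → F γ = F' γ) : phi G i F β = phi G i F' β := by
  unfold phi; split_ifs with h1
  · rfl
  · apply hecke_congr
    · intro; exact hF _ h
    · intro hp
      rcases lt_or_gt_of_ne hp with hp | hp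
      · exact hF _ (h.up i hp)
      · exact hF _ (h.down hp h1)

theorem refl_ne_sroot_nadj {i j : V} {β : V → ℤ} (hij : i ≠ j) (ha : ¬ G.Adj i j)
    (h : β ≠ sroot i) : refl G j β ≠ sroot i := by
  intro h'
  have := eq_refl_of_refl_eq h'
  rw [refl_of_pair_eq_zero (pair_sroot_nadj hij.symm (fun h => ha h.symm))] at this
  exact h this

theorem phi_comm {i j : V} (hij : i ≠ j) (ha : ¬ G.Adj i j) (F : (V → ℤ) → R) (β : V → ℤ) :
    phi G i (phi G j F) β = phi G j (phi G i F) β := by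
  have ha' : ¬ G.Adj j i := fun h => ha h.symm
  by_cases h1 : β = sroot i
  · subst h1
    have hne : (sroot i : V → ℤ) ≠ sroot j := fun h => hij (sroot_injective h)
    rw [phi_sroot, phi_of_ne hne, pair_sroot_nadj hij.symm ha', hecke_zero rfl, phi_sroot, mul_zero]
  by_cases h2 : β = sroot j
  · subst h2
    rw [phi_sroot, phi_of_ne h1, pair_sroot_nadj hij ha, hecke_zero rfl, phi_sroot, mul_zero]
  rw [phi_of_ne h1, phi_of_ne h2, phi_of_ne h2 (phi G i F), phi_of_ne h1,
    phi_of_ne (refl_ne_sroot_nadj hij ha h1), phi_of_ne (refl_ne_sroot_nadj hij.symm ha' h2),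
    pair_refl_nadj hij ha, pair_refl_nadj hij.symm ha', refl_comm hij ha]
  refine hecke_comm _ _ _ _ _ _ (fun h => ?_) (fun h => ?_)
  · rw [refl_of_pair_eq_zero h]
    exact ⟨rfl, rfl⟩
  · rw [← refl_comm hij ha, refl_of_pair_eq_zero h]
    exact ⟨rfl, rfl⟩

/-- The six translates of `β` under two adjacent reflections are not simple. -/
structure Generic (G : SimpleGraph V) (i j : V) (β : V → ℤ) : Prop where
  root : IsRoot G β
  left : β ≠ sroot i
  right : β ≠ sroot j
  sum : β ≠ sroot i + sroot j

theorem refl_sroot_adj {i j : V} (ha : G.Adj i j) :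
    refl G i (sroot j) = sroot i + sroot j := by
  rw [refl, pair_sroot_adj ha]; module

theorem Generic.symm {i j : V} {β : V → ℤ} (h : Generic G i j β) : Generic G j i β :=
  ⟨h.root, h.right, h.left, by rw [add_comm]; exact h.sum⟩

theorem Generic.refl_left {i j : V} (ha : G.Adj i j) {β : V → ℤ} (h : Generic G i j β) :
    Generic G i j (refl G i β) := by
  by_cases hp : pair G i β = 0
  · rwa [refl_of_pair_eq_zero hp]
  refine ⟨?_, fun e => h.root.not_neg_sroot i e, fun e => h.sum ?_, fun e => h.right ?_⟩
  · rcases lt_or_gt_of_ne hp with hp | hp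
    · exact h.root.up i hp
    · exact h.root.down hp h.left
  · rw [eq_refl_of_refl_eq e, refl_sroot_adj ha]
  · rw [eq_refl_of_refl_eq e, ← refl_sroot_adj ha, refl_refl]

theorem Generic.refl_right {i j : V} (ha : G.Adj i j) {β : V → ℤ} (h : Generic G i j β) :
    Generic G i j (refl G j β) := (h.symm.refl_left ha.symm).symm

theorem Generic.braid {i j : V} (ha : G.Adj i j) {β : V → ℤ} (h : Generic G i j β)
    (F : (V → ℤ) → R) :
    phi G i (phi G j (phi G i F)) β = phi G j (phi G i (phi G j F)) β := by
  have p1 := pair_refl_adj ha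
  have p2 := pair_refl_adj ha.symm
  have q (l) := pair_refl_self (G := G) l
  have h1 := h.refl_left ha
  have h2 := h.refl_right ha
  have h3 := h2.refl_left ha
  have h4 := h1.refl_right ha
  rw [phi_of_ne h.left, phi_of_ne h.right, phi_of_ne h.right, phi_of_ne h.left,
    phi_of_ne h1.right, phi_of_ne h2.left, phi_of_ne h.left, phi_of_ne h.right, phi_of_ne h2.left,
    phi_of_ne h2.right, phi_of_ne h1.left, phi_of_ne h1.right, phi_of_ne h4.left,
    phi_of_ne h3.right, refl_refl, refl_refl, ← refl_braid ha]
  have e1 : pair G i (refl G j (refl G i β)) = pair G j β := by rw [p1, q, p2]; ring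
  have e2 : pair G j (refl G i (refl G j β)) = pair G i β := by rw [p2, q, p1]; ring
  rw [e1, e2, p1, p2, q, q, add_comm (pair G j β)]
  refine hecke_braid _ _ _ _ _ _ _ _ (fun hx => ?_) (fun hy => ?_) (fun hxy => ?_)
  · rw [refl_braid ha, refl_of_pair_eq_zero hx, refl_of_pair_eq_zero (e2.trans hx)]
    exact ⟨rfl, rfl⟩
  · rw [refl_of_pair_eq_zero hy, refl_of_pair_eq_zero (e1.trans hy)]
    exact ⟨rfl, rfl⟩
  · rw [refl_of_pair_eq_zero (i := i) (β := refl G j β) (by rw [p1]; exact hxy),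
      refl_of_pair_eq_zero (i := j) (β := refl G i β) (by rw [p2]; omega)]
    exact ⟨rfl, rfl⟩

theorem sroot_add_ne_left {i j : V} : (sroot i + sroot j : V → ℤ) ≠ sroot i := by
  intro h
  have := congrFun (add_eq_left.1 h) j
  rw [sroot_self] at this; simp at this

theorem pair_sroot_add {i j : V} (ha : G.Adj i j) : pair G i (sroot i + sroot j) = 1 := by
  rw [add_comm, ← refl_sroot_adj ha.symm, pair_refl_adj ha, pair_sroot_self, pair_sroot_adj ha.symm]
  norm_num

theorem refl_sroot_add {i j : V} (ha : G.Adj i j) : refl G i (sroot i + sroot j) = sroot j := by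
  rw [refl, pair_sroot_add ha]; module

theorem phi_sroot_add {i j : V} (ha : G.Adj i j) (F : (V → ℤ) → R) :
    phi G i F (sroot i + sroot j) = 2 * F (sroot j) := by
  rw [phi_of_ne sroot_add_ne_left, pair_sroot_add ha, hecke_pos (by norm_num),
    refl_sroot_add ha]

theorem phi_sroot_adj {i j : V} (ha : G.Adj i j) (F : (V → ℤ) → R) :
    phi G i F (sroot j) = F (sroot j) + F (sroot i + sroot j) := by
  rw [phi_of_ne (fun h => ha.ne (sroot_injective h).symm), pair_sroot_adj ha,
    hecke_neg (by norm_num), refl_sroot_adj ha]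

theorem phi_sroot_nadj {i j : V} (hij : i ≠ j) (ha : ¬ G.Adj i j) (F : (V → ℤ) → R) :
    phi G i F (sroot j) = 2 * F (sroot j) := by
  rw [phi_of_ne (fun h => hij (sroot_injective h).symm), pair_sroot_nadj hij ha, hecke_zero rfl]

theorem phi_braid_left {i j : V} (ha : G.Adj i j) (F : (V → ℤ) → R) :
    phi G i (phi G j (phi G i F)) (sroot i) = phi G j (phi G i (phi G j F)) (sroot i) := by
  rw [phi_sroot, phi_sroot_adj ha.symm, phi_sroot, add_comm (sroot j), phi_sroot_add ha, phi_sroot]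
  ring

theorem phi_braid {i j : V} (ha : G.Adj i j) {β : V → ℤ} (h : IsRoot G β)
    (F : (V → ℤ) → R) :
    phi G i (phi G j (phi G i F)) β = phi G j (phi G i (phi G j F)) β := by
  by_cases h1 : β = sroot i
  · subst h1; exact phi_braid_left ha F
  by_cases h2 : β = sroot j
  · subst h2; exact (phi_braid_left ha.symm F).symm
  by_cases h3 : β = sroot i + sroot j
  · subst h3
    rw [phi_sroot_add ha, phi_sroot, add_comm (sroot i), phi_sroot_add ha.symm, phi_sroot]
  exact Generic.braid ha ⟨h, h1, h2, h3⟩ F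

theorem phi_phi {i : V} {β : V → ℤ} (h : IsRoot G β) (F : (V → ℤ) → R) (hF : F (sroot i) = 0) :
    phi G i (phi G i F) β = phi G i F β + 2 * F β := by
  by_cases h1 : β = sroot i
  · subst h1; rw [phi_sroot, phi_sroot, hF]; ring
  · rw [phi_of_ne h1, phi_of_ne h1, phi_of_ne (fun e => h.not_neg_sroot i e), refl_refl,
      pair_refl_self]
    have := fun h : pair G i β = 0 => refl_of_pair_eq_zero h
    grind [hecke]

open Classical in
/-- The normalised weights. -/
noncomputable def wt' (G : SimpleGraph V) (i : V) (β : V → ℤ) : ℤ :=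
  if β = sroot i then 1 else
    (if pair G i β < 0 then wt G i β else if pair G i β = 0 then -wt G i β else 0) - 1

theorem wt'_sroot_self (i : V) : wt' G i (sroot i) = 1 := by simp [wt']

theorem wt'_sroot_ne {i j : V} (h : i ≠ j) : wt' G i (sroot j) = 0 := by
  have h' : (sroot j : V → ℤ) ≠ sroot i := fun e => h (sroot_injective e).symm
  by_cases ha : G.Adj i j
  · simp [wt', h', pair_sroot_adj ha, wt_sroot_adj ha]
  · simp [wt', h', pair_sroot_nadj h ha, wt_sroot_nadj ha]

theorem wt'_pos {i : V} {β : V → ℤ} (h : β ≠ sroot i) (hp : 0 < pair G i β) :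
    wt' G i β = -1 := by simp [wt', h, hp.le, hp.ne']

theorem wt'_neg {i : V} {β : V → ℤ} (h : β ≠ sroot i) (hp : pair G i β < 0) :
    wt' G i β = wt G i β - 1 := by simp [wt', h, hp]

theorem wt'_zero {i : V} {β : V → ℤ} (h : β ≠ sroot i) (hp : pair G i β = 0) :
    wt' G i β = - wt G i β - 1 := by simp [wt', h, hp]

theorem phi_wt'_nadj (htf : TriangleFree G) {i j : V} (hij : i ≠ j) (ha : ¬ G.Adj i j)
    {β : V → ℤ} (h : IsRoot G β) : phi G i (wt' G j) β = 2 * wt' G j β := by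
  have ha' : ¬ G.Adj j i := fun h => ha h.symm
  by_cases h1 : β = sroot i
  · subst h1; rw [phi_sroot, wt'_sroot_ne hij.symm]; ring
  by_cases h2 : β = sroot j
  · subst h2; rw [phi_sroot_nadj hij ha]
  have key : wt' G j (refl G i β) = wt' G j β := by
    simp only [wt', h2, refl_ne_sroot_nadj hij.symm ha' h2, if_false,
      pair_refl_nadj hij.symm ha']
    split_ifs with h3 h4
    · rw [wt_refl_nadj htf h ha' hij.symm h3.le h1]
    · rw [wt_refl_nadj htf h ha' hij.symm h4.le h1]
    · rfl
  rw [phi_of_ne h1, key]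
  grind [hecke]

theorem phi_wt'_adj_aux (htf : TriangleFree G) {i j : V} (ha : G.Adj i j)
    {β : V → ℤ} (h : Generic G i j β) (hij : pair G i β ≤ pair G j β) :
    phi G i (wt' G j) β = phi G j (wt' G i) β := by
  have p1 := pair_refl_adj ha β
  have p2 := pair_refl_adj ha.symm β
  have h1 := h.refl_left ha
  have h2 := h.refl_right ha
  rw [phi_of_ne h.left, phi_of_ne h.right]
  rcases lt_trichotomy (pair G j β) 0 with hj | hj | hj
  · have hi : pair G i β < 0 := by omega
    rw [hecke_neg hi, hecke_neg hj, wt'_neg h.left hi, wt'_neg h.right hj,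
      wt'_neg h1.right (by omega), wt'_neg h2.left (by omega), wt_up_adj htf h.root ha hi.le hj,
      wt_up_adj htf h.root ha.symm hj.le hi]
    ring
  · rcases hij.lt_or_eq with hi | hi
    · rw [hj] at hi
      rw [hecke_neg hi, hecke_zero hj, wt'_neg h.left hi, wt'_zero h.right hj,
        wt'_neg h1.right (by omega), wt_up_adj htf h.root ha.symm hj.le hi]
      ring
    · rw [hj] at hi
      rw [hecke_zero hi, hecke_zero hj, wt'_zero h.left hi, wt'_zero h.right hj,
        wt_eq_of_pair_eq_zero htf ha h.root hi hj]
  · rw [hecke_pos hj, wt'_pos h.right hj]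
    rcases lt_trichotomy (pair G i β) 0 with hi | hi | hi
    · rw [hecke_neg hi]
      have hr := h2.root
      have e : ∀ hp : pair G i β + pair G j β ≤ 0,
          wt G j (refl G i β) = 2 * wt G i (refl G j β) := by
        intro hp
        have := wt_up_up_adj htf (i := j) (j := i) hr ha.symm (by rw [pair_refl_self]; omega)
          (by omega)
        rwa [refl_refl] at this
      rcases lt_trichotomy (pair G i β + pair G j β) 0 with hs | hs | hs
      · rw [wt'_neg h1.right (by omega), wt'_neg h2.left (by omega), e hs.le]; ring
      · rw [wt'_zero h1.right (by omega), wt'_zero h2.left (by omega), e hs.le]; ring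
      · rw [wt'_pos h1.right (by omega), wt'_pos h2.left (by omega)]; ring
    · rw [hecke_zero hi, wt'_pos h2.left (by omega)]
    · rw [hecke_pos hi, wt'_pos h1.right (by omega), wt'_pos h2.left (by omega)]

theorem phi_wt'_adj (htf : TriangleFree G) {i j : V} (ha : G.Adj i j)
    {β : V → ℤ} (h : IsRoot G β) :
    phi G i (wt' G j) β = phi G j (wt' G i) β := by
  have base : ∀ {i j : V}, G.Adj i j →
      phi G i (wt' G j) (sroot i) = phi G j (wt' G i) (sroot i) := by
    intro i j ha
    rw [phi_sroot, phi_sroot_adj ha.symm, wt'_sroot_self, add_comm (sroot j),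
      wt'_pos sroot_add_ne_left (by rw [pair_sroot_add ha]; norm_num)]
    norm_num
  by_cases h1 : β = sroot i
  · subst h1; exact base ha
  by_cases h2 : β = sroot j
  · subst h2; exact (base ha.symm).symm
  by_cases h3 : β = sroot i + sroot j
  · subst h3
    rw [phi_sroot_add ha, add_comm (sroot i), phi_sroot_add ha.symm, wt'_sroot_self,
      wt'_sroot_self]
  rcases le_total (pair G i β) (pair G j β) with hij | hij
  · exact phi_wt'_adj_aux htf ha ⟨h, h1, h2, h3⟩ hij
  · exact (phi_wt'_adj_aux htf ha.symm (Generic.symm ⟨h, h1, h2, h3⟩) hij).symm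

theorem map_hecke {R' : Type*} [CommRing R'] (f : R →+* R') (p : ℤ) (a b : R) :
    f (hecke p a b) = hecke p (f a) (f b) := by
  unfold hecke; split_ifs <;> simp [map_ofNat f 2]

theorem map_phi {R' : Type*} [CommRing R'] (f : R →+* R') (i : V) (F : (V → ℤ) → R)
    (β : V → ℤ) : f (phi G i F β) = phi G i (fun γ => f (F γ)) β := by
  unfold phi; split_ifs
  · simp
  · exact map_hecke _ _ _ _

open Classical in
/-- The operator attached to `i`, acting on functions on roots (extended by a scalar off roots). -/
noncomputable def op (G : SimpleGraph V) (z : R) (i : V) (F : (V → ℤ) → R) (β : V → ℤ) : R :=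
  if IsRoot G β then phi G i F β + z * (wt' G i β : R) * F (sroot i) else z * F β

theorem op_root (z : R) (i : V) (F : (V → ℤ) → R) {β : V → ℤ} (h : IsRoot G β) :
    op G z i F β = phi G i F β + z * (wt' G i β : R) * F (sroot i) := if_pos h

theorem op_not_root (z : R) (i : V) (F : (V → ℤ) → R) {β : V → ℤ} (h : ¬ IsRoot G β) :
    op G z i F β = z * F β := if_neg h

theorem map_op {R' : Type*} [CommRing R'] (f : R →+* R') (z : R) (i : V) (F : (V → ℤ) → R)
    (β : V → ℤ) : f (op G z i F β) = op G (f z) i (fun γ => f (F γ)) β := by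
  unfold op; split_ifs
  · simp [map_phi]
  · simp

theorem phi_op (z : R) (i j : V) (F : (V → ℤ) → R) {β : V → ℤ} (h : IsRoot G β) :
    phi G i (op G z j F) β =
      phi G i (phi G j F) β + z * ((phi G i (wt' G j) β : ℤ) : R) * F (sroot j) := by
  rw [phi_congr h (F' := fun γ => phi G j F γ + (wt' G j γ : R) * (z * F (sroot j)))
    (fun γ hγ => by rw [op_root z j F hγ]; ring)]
  have := map_phi (G := G) (Int.castRingHom R) i (wt' G j) β
  simp only [eq_intCast] at this
  rw [phi_add, phi_mul, this]
  ring

theorem op_comm (htf : TriangleFree G) (z : R) {i j : V} (hij : i ≠ j) (ha : ¬ G.Adj i j)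
    (F : (V → ℤ) → R) : op G z i (op G z j F) = op G z j (op G z i F) := by
  funext β
  by_cases h : IsRoot G β
  · have ha' : ¬ G.Adj j i := fun h => ha h.symm
    rw [op_root z i _ h, op_root z j _ h, phi_op z i j F h, phi_op z j i F h, phi_comm hij ha,
      phi_wt'_nadj htf hij ha h, phi_wt'_nadj htf hij.symm ha' h, op_root z _ _ (.simple _),
      op_root z _ _ (.simple _), wt'_sroot_ne hij, wt'_sroot_ne hij.symm, phi_sroot_nadj hij ha,
      phi_sroot_nadj hij.symm ha']
    push_cast
    ring
  · simp only [op_not_root _ _ _ h]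

theorem op_op_op (htf : TriangleFree G) (z : R) {i j : V} (ha : G.Adj i j)
    (F : (V → ℤ) → R) {β : V → ℤ} (h : IsRoot G β) :
    op G z i (op G z j (op G z i F)) β = phi G i (phi G j (phi G i F)) β +
      z * ((phi G i (wt' G j) β : ℤ) : R) *
        (F (sroot i) + F (sroot j) + F (sroot i + sroot j)) +
      2 * z * (wt' G i β * F (sroot j) + wt' G j β * F (sroot i)) := by
  have hγ : IsRoot G (sroot i + sroot j) := by
    rw [← refl_sroot_adj ha]; exact .up i (.simple j) (by rw [pair_sroot_adj ha]; norm_num)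
  have e1 : phi G i (phi G j (op G z i F)) β = phi G i (phi G j (phi G i F)) β +
      z * ((phi G i (phi G j (wt' G i)) β : ℤ) : R) * F (sroot i) := by
    rw [phi_congr h (F' := fun γ => phi G j (phi G i F) γ +
      ((phi G j (wt' G i) γ : ℤ) : R) * (z * F (sroot i))) (fun γ hγ => by
        rw [phi_op z j i F hγ]; ring)]
    have := map_phi (G := G) (Int.castRingHom R) i (phi G j (wt' G i)) β
    simp only [eq_intCast] at this
    rw [phi_add, phi_mul, this]
    ring
  have e2 : phi G i (phi G j (wt' G i)) β = phi G i (wt' G j) β + 2 * wt' G j β := by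
    rw [phi_congr h (F' := phi G i (wt' G j)) (fun γ hγ => phi_wt'_adj htf ha.symm hγ),
      phi_phi h _ (wt'_sroot_ne ha.ne.symm)]
  have hγ' : wt' G i (sroot i + sroot j) = -1 :=
    wt'_pos sroot_add_ne_left (by rw [pair_sroot_add ha]; norm_num)
  rw [op_root z i _ h, phi_op z i j _ h, e1, e2, op_root z i F (.simple j),
    op_root z j _ (.simple i), phi_sroot_adj ha, phi_sroot_adj ha.symm, wt'_sroot_ne ha.ne,
    wt'_sroot_ne ha.ne.symm, op_root z i F (.simple i), phi_sroot, wt'_sroot_self,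
    add_comm (sroot j) (sroot i), op_root z i F hγ, hγ', phi_sroot_add ha]
  push_cast
  ring

theorem op_braid (htf : TriangleFree G) (z : R) {i j : V} (ha : G.Adj i j)
    (F : (V → ℤ) → R) :
    op G z i (op G z j (op G z i F)) = op G z j (op G z i (op G z j F)) := by
  funext β
  by_cases h : IsRoot G β
  · rw [op_op_op htf z ha F h, op_op_op htf z ha.symm F h, phi_braid ha h, phi_wt'_adj htf ha h,
      add_comm (sroot i) (sroot j)]
    ring
  · simp only [op_not_root _ _ _ h]

end SmallType

end

section

namespace SmallType

variable {V : Type*} [Fintype V] {G : SimpleGraph V} {R : Type*} [CommRing R]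

theorem op_add (z : R) (i : V) (F F' : (V → ℤ) → R) :
    op G z i (F + F') = op G z i F + op G z i F' := by
  funext β
  by_cases h : IsRoot G β
  · have := phi_add (G := G) i F F' β
    simp only [Pi.add_apply, op_root z i _ h]
    rw [show F + F' = fun γ => F γ + F' γ from rfl, this]
    ring
  · simp only [Pi.add_apply, op_not_root z i _ h]
    ring

theorem op_smul (z : R) (i : V) (c : R) (F : (V → ℤ) → R) :
    op G z i (c • F) = c • op G z i F := by
  funext β
  by_cases h : IsRoot G β
  · have := phi_mul (G := G) i F c β
    simp only [Pi.smul_apply, smul_eq_mul, op_root z i _ h]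
    rw [show c • F = fun γ => F γ * c from funext fun γ => mul_comm _ _, this]
    ring
  · simp only [Pi.smul_apply, smul_eq_mul, op_not_root z i _ h]
    ring

theorem op_sroot (z : R) (i : V) (F : (V → ℤ) → R) :
    op G z i F (sroot i) = z * F (sroot i) := by
  rw [op_root z i F (.simple i), phi_sroot, wt'_sroot_self]; simp

open Classical in
theorem phi_phi_eq {i : V} {β : V → ℤ} (h : IsRoot G β) (F : (V → ℤ) → R) :
    phi G i (phi G i F) β = phi G i F β + 2 * F β - if β = sroot i then 2 * F (sroot i) else 0 := by
  by_cases h1 : β = sroot i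
  · subst h1; rw [phi_sroot, phi_sroot]; simp
  · rw [phi_of_ne h1, phi_of_ne h1, phi_of_ne (fun e => h.not_neg_sroot i e), refl_refl,
      pair_refl_self]
    have := fun h : pair G i β = 0 => refl_of_pair_eq_zero h
    simp only [h1, if_false]
    grind [hecke]

theorem op_quadratic (z : R) (i : V) {β : V → ℤ} (h : IsRoot G β) : ∃ c : R,
    ∀ F : (V → ℤ) → R, op G z i (op G z i F) β - op G z i F β - 2 * F β = F (sroot i) * c := by
  classical
  refine ⟨z * ((phi G i (wt' G i) β : ℤ) : R) + z ^ 2 * wt' G i β - z * wt' G i β -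
    if β = sroot i then 2 else 0, fun F => ?_⟩
  rw [op_root z i _ h, phi_op z i i F h, op_sroot, op_root z i F h, phi_phi_eq h]
  split_ifs <;> ring

theorem op_cubic (z : R) (i : V) (F : (V → ℤ) → R) (β : V → ℤ) :
    op G z i (op G z i (op G z i F)) β =
      (1 + z) * op G z i (op G z i F) β + (2 - z) * op G z i F β - 2 * z * F β := by
  by_cases h : IsRoot G β
  · obtain ⟨c, hc⟩ := op_quadratic z i h
    have h1 := hc (op G z i F)
    have h2 := hc F
    rw [op_sroot] at h1
    linear_combination h1 - z * h2
  · simp only [op_not_root z i _ h]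
    ring

/-- The operators as linear endomorphisms. -/
noncomputable def opEnd (G : SimpleGraph V) (z : R) (i : V) : Module.End R ((V → ℤ) → R) where
  toFun := op G z i
  map_add' := op_add z i
  map_smul' := op_smul z i

theorem isUnit_opEnd {K : Type*} [Field K] [CharZero K] {z : K} (hz : z ≠ 0) (i : V) :
    IsUnit (opEnd G z i) := by
  set T := opEnd G z i with hT
  have key : T * (T * T - (1 + z) • T - (2 - z) • 1) = (-2 * z) • 1 := by
    refine LinearMap.ext fun F => funext fun β => ?_
    have := op_cubic (G := G) z i F β
    simp only [Module.End.mul_apply, LinearMap.sub_apply, LinearMap.smul_apply,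
      Module.End.one_apply, map_sub, map_smul, Pi.sub_apply, Pi.smul_apply, smul_eq_mul] at this ⊢
    change op G z i (op G z i (op G z i F)) β - (1 + z) * op G z i (op G z i F) β -
      (2 - z) * op G z i F β = _
    rw [this]; ring
  have hc : (-2 * z) ≠ 0 := by simp [hz]
  have hcomm : Commute T ((-2 * z)⁻¹ • (T * T - (1 + z) • T - (2 - z) • 1)) := by
    refine Commute.smul_right ?_ _
    exact (((Commute.refl T).mul_right (.refl T)).sub_right
        ((Commute.refl T).smul_right _)).sub_right
      ((Commute.one_right T).smul_right _)
  have h1 : T * ((-2 * z)⁻¹ • (T * T - (1 + z) • T - (2 - z) • 1)) = 1 := by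
    rw [mul_smul_comm, key, smul_smul, inv_mul_cancel₀ hc, one_smul]
  exact ⟨⟨T, _, h1, hcomm.eq ▸ h1⟩, rfl⟩

/-- The coefficient field of the representation. -/
abbrev Coef : Type := FractionRing (Polynomial ℤ)

/-- The image of the indeterminate in the coefficient field. -/
noncomputable def param : Coef := algebraMap (Polynomial ℤ) Coef Polynomial.X

theorem param_ne_zero : param ≠ 0 := by
  unfold param
  rw [Ne, FaithfulSMul.algebraMap_eq_zero_iff]
  exact Polynomial.X_ne_zero

instance : CharZero Coef :=
  charZero_of_injective_algebraMap (IsFractionRing.injective (Polynomial ℤ) Coef)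

/-- The invertible operators. -/
noncomputable def opUnit (G : SimpleGraph V) (i : V) : (Module.End Coef ((V → ℤ) → Coef))ˣ :=
  (isUnit_opEnd (G := G) param_ne_zero i).unit

theorem opUnit_commute (htf : TriangleFree G) {i j : V} (ha : ¬ G.Adj i j) :
    Commute (opUnit G i) (opUnit G j) := by
  by_cases hij : i = j
  · subst hij; exact .refl _
  · exact Units.ext (LinearMap.ext fun F => op_comm htf param hij ha F)

theorem opUnit_braid (htf : TriangleFree G) {i j : V} (ha : G.Adj i j) :
    opUnit G i * opUnit G j * opUnit G i = opUnit G j * opUnit G i * opUnit G j :=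
  Units.ext (LinearMap.ext fun F => op_braid htf param ha F)

/-- One step of the path relation on roots. -/
def Step (G : SimpleGraph V) (i : V) (β γ : V → ℤ) : Prop :=
  β ≠ sroot i ∧ (γ = refl G i β ∨ (γ = β ∧ pair G i β ≤ 0))

theorem Step.root {i : V} {β γ : V → ℤ} (h : Step G i β γ) (hβ : IsRoot G β) : IsRoot G γ := by
  obtain ⟨hne, rfl | ⟨rfl, -⟩⟩ := h
  · rcases lt_trichotomy (pair G i β) 0 with hp | hp | hp
    · exact hβ.up i hp
    · rwa [refl_of_pair_eq_zero hp]
    · exact hβ.down hp hne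
  · exact hβ

theorem Step.symm {i : V} {β γ : V → ℤ} (h : Step G i β γ) (hβ : IsRoot G β) : Step G i γ β := by
  obtain ⟨hne, rfl | ⟨rfl, hp⟩⟩ := h
  · exact ⟨fun e => hβ.not_neg_sroot i e, .inl (refl_refl _ _).symm⟩
  · exact ⟨hne, .inr ⟨rfl, hp⟩⟩

/-- The path relation of a word. -/
def Walk (G : SimpleGraph V) : List V → (V → ℤ) → (V → ℤ) → Prop
  | [], β, γ => β = γ
  | i :: l, β, γ => ∃ δ, Step G i β δ ∧ Walk G l δ γ

theorem Walk.append_iff {l l' : List V} {β γ : V → ℤ} :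
    Walk G (l ++ l') β γ ↔ ∃ δ, Walk G l β δ ∧ Walk G l' δ γ := by
  induction l generalizing β with
  | nil => simp [Walk]
  | cons i l ih =>
    simp only [List.cons_append, Walk, ih]
    exact ⟨fun ⟨δ, h, ε, h1, h2⟩ => ⟨ε, ⟨δ, h, h1⟩, h2⟩,
      fun ⟨ε, ⟨δ, h, h1⟩, h2⟩ => ⟨δ, h, ε, h1, h2⟩⟩

theorem Walk.root {l : List V} {β γ : V → ℤ} (h : Walk G l β γ) (hβ : IsRoot G β) :
    IsRoot G γ := by
  induction l generalizing β with
  | nil => exact h ▸ hβ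
  | cons i l ih => obtain ⟨δ, h1, h2⟩ := h; exact ih h2 (h1.root hβ)

theorem Walk.reverse {l : List V} {β γ : V → ℤ} (h : Walk G l β γ) (hβ : IsRoot G β) :
    Walk G l.reverse γ β := by
  induction l generalizing β with
  | nil => exact h.symm
  | cons i l ih =>
    obtain ⟨δ, h1, h2⟩ := h
    rw [List.reverse_cons, Walk.append_iff]
    exact ⟨δ, ih h2 (h1.root hβ), β, h1.symm hβ, rfl⟩

/-- Iterated operators. -/
noncomputable def opList (G : SimpleGraph V) (z : R) (l : List V) (F : (V → ℤ) → R) :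
    (V → ℤ) → R := l.foldr (op G z) F

theorem map_opList {R' : Type*} [CommRing R'] (f : R →+* R') (z : R) (l : List V)
    (F : (V → ℤ) → R) (β : V → ℤ) :
    f (opList G z l F β) = opList G (f z) l (fun γ => f (F γ)) β := by
  induction l generalizing β with
  | nil => rfl
  | cons i l ih =>
    change f (op G z i (opList G z l F) β) = op G (f z) i (opList G (f z) l _) β
    rw [map_op]
    congr 1
    funext γ
    exact ih γ

theorem coe_opUnit_prod (l : List V) (F : (V → ℤ) → Coef) :
    (((l.map (opUnit G)).prod : (Module.End Coef ((V → ℤ) → Coef))ˣ) :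
      Module.End Coef ((V → ℤ) → Coef)) F = opList G param l F := by
  induction l with
  | nil => simp [opList]
  | cons i l ih =>
    rw [List.map_cons, List.prod_cons, Units.val_mul, Module.End.mul_apply, ih]
    rfl

theorem op_zero_nonneg (i : V) {F : (V → ℤ) → ℤ} (hF : ∀ γ, 0 ≤ F γ) (β : V → ℤ) :
    0 ≤ op G 0 i F β := by
  have h1 := hF β
  have h2 := hF (refl G i β)
  unfold op phi hecke
  split_ifs <;> simp <;> omega

theorem op_zero_pos_iff {i : V} {F : (V → ℤ) → ℤ} (hF : ∀ γ, 0 ≤ F γ) {β : V → ℤ}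
    (h : IsRoot G β) : 0 < op G 0 i F β ↔ ∃ γ, Step G i β γ ∧ 0 < F γ := by
  have h1 := hF β
  have h2 := hF (refl G i β)
  rw [op_root _ _ _ h, zero_mul, zero_mul, add_zero]
  by_cases hb : β = sroot i
  · subst hb; simp [phi_sroot, Step]
  rw [phi_of_ne hb]
  simp only [Step, ne_eq, hb, not_false_eq_true, true_and]
  have e : (∃ γ, (γ = refl G i β ∨ γ = β ∧ pair G i β ≤ 0) ∧ 0 < F γ) ↔
      0 < F (refl G i β) ∨ (pair G i β ≤ 0 ∧ 0 < F β) := by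
    constructor
    · rintro ⟨γ, rfl | ⟨rfl, hp⟩, h'⟩
      · exact .inl h'
      · exact .inr ⟨hp, h'⟩
    · rintro (h | ⟨hp, h⟩)
      · exact ⟨_, .inl rfl, h⟩
      · exact ⟨_, .inr ⟨rfl, hp⟩, h⟩
  rw [e]
  rcases lt_trichotomy (pair G i β) 0 with hp | hp | hp
  · rw [hecke_neg hp]; omega
  · rw [hecke_zero hp, refl_of_pair_eq_zero hp]; omega
  · rw [hecke_pos hp]; omega

theorem opList_zero_nonneg (l : List V) {F : (V → ℤ) → ℤ} (hF : ∀ γ, 0 ≤ F γ) (β : V → ℤ) :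
    0 ≤ opList G 0 l F β := by
  induction l generalizing β with
  | nil => exact hF β
  | cons i l ih => exact op_zero_nonneg i ih β

theorem opList_zero_pos_iff (l : List V) {F : (V → ℤ) → ℤ} (hF : ∀ γ, 0 ≤ F γ) {β : V → ℤ}
    (h : IsRoot G β) : 0 < opList G 0 l F β ↔ ∃ γ, Walk G l β γ ∧ 0 < F γ := by
  induction l generalizing β with
  | nil => simp [opList, Walk]
  | cons i l ih =>
    change 0 < op G 0 i (opList G 0 l F) β ↔ _
    rw [op_zero_pos_iff (opList_zero_nonneg l hF) h]
    constructor
    · rintro ⟨δ, h1, h2⟩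
      obtain ⟨γ, h3, h4⟩ := (ih (h1.root h)).1 h2
      exact ⟨γ, ⟨δ, h1, h3⟩, h4⟩
    · rintro ⟨γ, ⟨δ, h1, h3⟩, h4⟩
      exact ⟨δ, h1, (ih (h1.root h)).2 ⟨γ, h3, h4⟩⟩

theorem Walk.congr {l l' : List V} (hl : (l.map (opUnit G)).prod = (l'.map (opUnit G)).prod)
    {β γ : V → ℤ} (hβ : IsRoot G β) (h : Walk G l β γ) : Walk G l' β γ := by
  classical
  set F : (V → ℤ) → ℤ := fun δ => if δ = γ then 1 else 0 with hF
  have hF0 : ∀ δ, 0 ≤ F δ := fun δ => by simp only [hF]; split_ifs <;> norm_num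
  have key : opList G (0 : ℤ) l F β = opList G (0 : ℤ) l' F β := by
    set F' : (V → ℤ) → Polynomial ℤ := fun δ => Polynomial.C (F δ)
    have h1 : opList G (Polynomial.X : Polynomial ℤ) l F' β = opList G Polynomial.X l' F' β := by
      apply IsFractionRing.injective (Polynomial ℤ) Coef
      rw [map_opList, map_opList]
      change opList G param l _ β = opList G param l' _ β
      rw [← coe_opUnit_prod, ← coe_opUnit_prod, hl]
    have h2 := congrArg (Polynomial.evalRingHom 0) h1
    rw [map_opList, map_opList] at h2
    simpa [F'] using h2
  have : 0 < opList G (0 : ℤ) l F β :=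
    (opList_zero_pos_iff l hF0 hβ).2 ⟨γ, h, by simp [hF]⟩
  rw [key, opList_zero_pos_iff l' hF0 hβ] at this
  obtain ⟨δ, h1, h2⟩ := this
  have : δ = γ := by by_contra hne; simp [hF, hne] at h2
  exact this ▸ h1

theorem Step.loop {i : V} {β γ : V → ℤ} (h : Step G i β γ) (hβ : IsRoot G β) :
    Walk G [i, i] β γ := by
  by_cases hp : pair G i β ≤ 0
  · exact ⟨β, ⟨h.1, .inr ⟨rfl, hp⟩⟩, γ, h, rfl⟩
  · have e : γ = refl G i β := h.2.resolve_right fun h => hp h.2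
    subst e
    exact ⟨_, h, _, ⟨(h.symm hβ).1, .inr ⟨rfl, by rw [pair_refl_self]; omega⟩⟩, rfl⟩

end SmallType

end

section

namespace Brick

variable {N : Type*} [Monoid N]

/-- The alternating product `x * y * x * ⋯` with `k` factors. -/
def alt (x y : N) : ℕ → N
  | 0 => 1
  | k + 1 => x * alt y x k

/-- The product `f a * f (a + 1) * ⋯` with `n` factors. -/
def seg (f : ℕ → N) (a n : ℕ) : N := ((List.range' a n).map f).prod

theorem seg_zero (f : ℕ → N) (a : ℕ) : seg f a 0 = 1 := by simp [seg]

theorem seg_one (f : ℕ → N) (a : ℕ) : seg f a 1 = f a := by simp [seg]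

theorem seg_succ (f : ℕ → N) (a n : ℕ) : seg f a (n + 1) = f a * seg f (a + 1) n := by
  simp [seg, List.range'_succ]

theorem seg_add (f : ℕ → N) (a m n : ℕ) : seg f a (m + n) = seg f a m * seg f (a + m) n := by
  induction m generalizing a with
  | zero => simp [seg_zero]
  | succ m ih =>
    rw [show m + 1 + n = m + n + 1 by omega, seg_succ, ih, seg_succ, mul_assoc,
      show a + 1 + m = a + (m + 1) by omega]

theorem seg_succ' (f : ℕ → N) (a n : ℕ) : seg f a (n + 1) = seg f a n * f (a + n) := by
  rw [seg_add, seg_one]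

theorem seg_congr {f g : ℕ → N} {a b n : ℕ} (h : ∀ k < n, f (a + k) = g (b + k)) :
    seg f a n = seg g b n := by
  induction n with
  | zero => simp [seg_zero]
  | succ n ih =>
    rw [seg_succ', seg_succ', ih fun k hk => h k (by omega), h n (by omega)]

theorem seg_commute {f : ℕ → N} {x : N} {a n : ℕ} (h : ∀ k < n, Commute x (f (a + k))) :
    Commute x (seg f a n) := by
  induction n with
  | zero => simp [seg_zero]
  | succ n ih =>
    rw [seg_succ']
    exact (ih fun k hk => h k (by omega)).mul_right (h n (by omega))

theorem seg_eq_alt {f : ℕ → N} (hf : ∀ a, f (a + 2) = f a) (a n : ℕ) :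
    seg f a n = alt (f a) (f (a + 1)) n := by
  induction n generalizing a with
  | zero => simp [seg_zero, alt]
  | succ n ih => rw [seg_succ, ih, alt, hf]

/-- The braid relations along a path with `n` vertices. -/
structure IsPath (ρ : ℕ → N) (n : ℕ) : Prop where
  comm : ∀ a b, a + 2 ≤ b → b < n → Commute (ρ a) (ρ b)
  braid : ∀ a, a + 1 < n → ρ a * ρ (a + 1) * ρ a = ρ (a + 1) * ρ a * ρ (a + 1)

/-- The indicator of a parity class. -/
def par (ρ : ℕ → N) (p b : ℕ) : N := if (b + p) % 2 = 0 then ρ b else 1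

theorem par_period (ρ : ℕ → N) (p b : ℕ) : par ρ (p + 2) b = par ρ p b := by
  simp only [par]; congr 2; omega

theorem IsPath.commute_seg {ρ : ℕ → N} {n k b : ℕ} (h : IsPath ρ n) (hk : k < b) (hb : b < n) :
    Commute (ρ b) (seg ρ 0 k) :=
  seg_commute fun l hl => (h.comm _ _ (by omega) hb).symm

theorem IsPath.shift {ρ : ℕ → N} {n : ℕ} (h : IsPath ρ n) {k b : ℕ} (hb : b + 2 ≤ k)
    (hk : k ≤ n) : seg ρ 0 k * ρ b = ρ (b + 1) * seg ρ 0 k := by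
  induction k with
  | zero => omega
  | succ k ih =>
    rw [seg_succ', zero_add]
    rcases hb.eq_or_lt with hb | hb
    · obtain rfl : k = b + 1 := by omega
      rw [seg_succ', zero_add, mul_assoc, mul_assoc, ← mul_assoc (ρ b), h.braid b (by omega),
        mul_assoc (ρ (b + 1)), ← mul_assoc, ← (h.commute_seg (by omega) (by omega)).eq, mul_assoc,
        mul_assoc]
    · rw [mul_assoc, ← (h.comm b k (by omega) (by omega)).eq, ← mul_assoc, ih (by omega) (by omega),
        mul_assoc]

theorem IsPath.shift_seg {ρ : ℕ → N} {n : ℕ} (h : IsPath ρ n) {j : ℕ} (p : ℕ) (hj : j + 1 ≤ n) :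
    ∀ i ≤ j, seg ρ 0 (j + 1) * seg (par ρ (p + 1)) 0 i = seg (par ρ p) 1 i * seg ρ 0 (j + 1) := by
  intro i hi
  induction i with
  | zero => simp [seg_zero]
  | succ i ih =>
    have key : seg ρ 0 (j + 1) * par ρ (p + 1) i = par ρ p (1 + i) * seg ρ 0 (j + 1) := by
      have e : (i + (p + 1)) % 2 = (1 + i + p) % 2 := by omega
      simp only [par, e]
      split_ifs
      · rw [h.shift (by omega) hj, add_comm]
      · simp
    rw [seg_succ' _ 0 i, seg_succ' _ 1 i, zero_add, ← mul_assoc, ih (by omega), mul_assoc, key,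
        mul_assoc]

/-- The row of parity `p`. -/
def row (ρ : ℕ → N) (n p : ℕ) : N := seg (par ρ p) 0 n

theorem IsPath.par_commute {ρ : ℕ → N} {n : ℕ} (h : IsPath ρ n) {p a b : ℕ} (ha : a < n)
    (hb : b < n) : Commute (par ρ p a) (par ρ p b) := by
  unfold par
  split_ifs with h1 h2
  · rcases lt_trichotomy a b with h | rfl | h
    · exact IsPath.comm ‹_› _ _ (by omega) hb
    · exact .refl _
    · exact (IsPath.comm ‹_› _ _ (by omega) ha).symm
  all_goals simp

theorem IsPath.seg_row {ρ : ℕ → N} {n : ℕ} (h : IsPath ρ n) {j r : ℕ} (hn : n = j + 1 + r) :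
    seg (row ρ n) 0 (j + 1) =
      seg (fun i => seg (par ρ i) 1 (n - 1)) 0 j * seg (par ρ j) (j + 1) r * seg ρ 0 (j + 1) := by
  induction j generalizing r with
  | zero =>
    have e : n = r + 1 := by omega
    rw [zero_add, seg_one, seg_one, seg_zero, one_mul, row, e, seg_succ, zero_add]
    have e' : par ρ 0 0 = ρ 0 := by simp [par]
    rw [e']
    refine (seg_commute fun k hk => ?_).eq
    unfold par; split_ifs
    · exact h.comm _ _ (by omega) (by omega)
    · simp
  | succ j ih =>
    rw [seg_succ', ih (r := r + 1) (by omega), zero_add]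
    have e1 : row ρ n (j + 1) = seg (par ρ (j + 1)) 0 j * (ρ (j + 1) *
        seg (par ρ (j + 1)) (j + 2) r) := by
      rw [row, hn, show j + 1 + 1 + r = j + (1 + (1 + r)) by omega, seg_add, seg_add, seg_one,
        seg_add, seg_one]
      have e2 : par ρ (j + 1) (0 + j) = 1 := by rw [par, if_neg]; omega
      have e3 : par ρ (j + 1) (0 + j + 1) = ρ (j + 1) := by
        rw [par, if_pos] <;> [skip; omega]
        rw [zero_add]
      rw [e2, e3, one_mul, zero_add]
    have e4 : Commute (seg ρ 0 (j + 2)) (seg (par ρ (j + 1)) (j + 2) r) := by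
      refine seg_commute fun k hk => ?_
      unfold par; split_ifs
      · exact (h.commute_seg (by omega) (by omega)).symm
      · simp
    have e5 : Commute (seg (par ρ j) (j + 1) (r + 1)) (seg (par ρ j) 1 j) :=
      seg_commute fun k hk => (seg_commute fun l hl =>
        h.par_commute (by omega) (by omega) : Commute (par ρ j (1 + k)) _).symm
    have e6 : seg (par ρ j) 1 (n - 1) = seg (par ρ j) 1 j * seg (par ρ j) (j + 1) (r + 1) := by
      rw [show n - 1 = j + (r + 1) by omega, seg_add, add_comm 1 j]
    have e7 := h.shift_seg (j := j) j (by omega) j le_rfl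
    have e8 := seg_succ' ρ 0 (j + 1)
    rw [zero_add] at e8
    have e9 := seg_succ' (fun i => seg (par ρ i) 1 (n - 1)) 0 j
    simp only [zero_add] at e9
    rw [e9, e6, e1, ← e5.eq, mul_assoc _ _ (seg ρ 0 (j + 1 + 1)), ← e4.eq, e8]
    simp only [mul_assoc]
    rw [← mul_assoc (seg ρ 0 (j + 1)) (seg _ _ _), e7]
    simp only [mul_assoc]

theorem IsPath.alt_row {ρ : ℕ → N} {n : ℕ} (h : IsPath ρ n) :
    alt (row ρ n 0) (row ρ n 1) (n + 1) = alt (row ρ n 1) (row ρ n 0) (n + 1) := by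
  induction n generalizing ρ with
  | zero => simp [alt, row, seg_zero]
  | succ n ih =>
    have hper : ∀ a, row ρ (n + 1) (a + 2) = row ρ (n + 1) a := fun a =>
      seg_congr fun k _ => par_period _ _ _
    set q : ℕ → N := fun i => seg (par ρ i) 1 n with hq
    have hqper : ∀ a, q (a + 2) = q a := fun a => seg_congr fun k _ => par_period _ _ _
    have h1 : seg (row ρ (n + 1)) 0 (n + 1) = seg q 0 n * seg ρ 0 (n + 1) := by
      rw [h.seg_row (j := n) (r := 0) (by omega), seg_zero, mul_one]; rfl
    have h2 : seg (row ρ (n + 1)) 0 (n + 2) = seg q 0 (n + 1) * seg ρ 0 (n + 1) := by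
      rw [seg_succ' _ 0 (n + 1), h1, zero_add, row, seg_succ' (par ρ (n + 1)) 0 n]
      have e2 : par ρ (n + 1) (0 + n) = 1 := by rw [par, if_neg]; omega
      rw [e2, mul_one, mul_assoc, h.shift_seg n (by omega) n le_rfl, ← mul_assoc, seg_succ' q 0 n,
        zero_add]
    have h3 : row ρ (n + 1) 1 = q 1 := by
      rw [row, seg_succ]
      have e2 : par ρ 1 0 = 1 := by rw [par, if_neg]; omega
      rw [e2, one_mul]
    have h4 : alt (q 0) (q 1) (n + 1) = alt (q 1) (q 0) (n + 1) := by
      have hsh : IsPath (fun a => ρ (a + 1)) n :=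
        ⟨fun a b hab hb => h.comm _ _ (by omega) (by omega), fun a ha => h.braid _ (by omega)⟩
      have hr : ∀ p, row (fun a => ρ (a + 1)) n p = q (p + 1) := by
        intro p
        refine seg_congr fun k _ => ?_
        simp only [par]
        rw [show 0 + k + 1 = 1 + k by omega, show 0 + k + p = (k + p) by omega]
        congr 2; omega
      have := ih hsh
      rw [hr, hr, show 1 + 1 = 0 + 2 from rfl, hqper] at this
      exact this.symm
    rw [← seg_eq_alt hper 0, h2, seg_eq_alt hqper, h4, alt, alt, ← seg_eq_alt hper 0, h1, h3,
        seg_eq_alt hqper,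
      mul_assoc]

end Brick

end

section

namespace Brick

variable {N : Type*} [Monoid N]

theorem alt_commute {x y z : N} (hx : Commute z x) (hy : Commute z y) (m : ℕ) :
    Commute z (alt x y m) := by
  induction m generalizing x y with
  | zero => exact .one_right z
  | succ m ih => exact hx.mul_right (ih hy hx)

theorem alt_mul {x y x' y' : N} (h1 : Commute x' x) (h2 : Commute x' y) (h3 : Commute y' x)
    (h4 : Commute y' y) (m : ℕ) : alt (x * x') (y * y') m = alt x y m * alt x' y' m := by
  induction m generalizing x y x' y' with
  | zero => simp [alt]
  | succ m ih =>
    rw [alt, alt, alt, ih h4 h3 h2 h1, mul_assoc, ← mul_assoc x', (alt_commute h2 h1 m).eq,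
      mul_assoc, mul_assoc]

theorem alt_list_prod {ι : Type*} (l : List ι) (X Y : ι → N) (m : ℕ)
    (h : l.Pairwise fun p q => Commute (X p) (X q) ∧ Commute (X p) (Y q) ∧ Commute (Y p) (X q) ∧
      Commute (Y p) (Y q)) :
    alt (l.map X).prod (l.map Y).prod m = (l.map fun p => alt (X p) (Y p) m).prod := by
  induction l with
  | nil =>
    simp only [List.map_nil, List.prod_nil]
    induction m with
    | zero => rfl
    | succ m ih => rw [alt, ih, one_mul]
  | cons p l ih =>
    rw [List.pairwise_cons] at h
    simp only [List.map_cons, List.prod_cons]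
    rw [alt_mul, ih h.2] <;> refine (Commute.list_prod_right _ _ ?_).symm <;>
    simp only [List.mem_map, forall_exists_index, and_imp, forall_apply_eq_imp_iff₂]
    exacts [fun q hq => (h.1 q hq).1, fun q hq => (h.1 q hq).2.2.1, fun q hq => (h.1 q hq).2.1,
      fun q hq => (h.1 q hq).2.2.2]

theorem seg_mul {f g : ℕ → N} {a n : ℕ} (h : ∀ k < n, ∀ l < n, Commute (g (a + k)) (f (a + l))) :
    seg (fun b => f b * g b) a n = seg f a n * seg g a n := by
  induction n with
  | zero => simp [seg_zero]
  | succ n ih =>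
    rw [seg_succ', seg_succ', seg_succ', ih fun k hk l hl => h k (by omega) l (by omega)]
    have : Commute (f (a + n)) (seg g a n) :=
      seg_commute fun k hk => (h k (by omega) n (by omega)).symm
    simp only [mul_assoc]
    rw [← mul_assoc (seg g a n), ← this.eq, mul_assoc]

/-- The alternating relation for two complementary colourings of a path with `n` vertices. -/
theorem alt_seg {x z : ℕ → N} {n : ℕ} (hxx : ∀ a < n, ∀ b < n, Commute (x a) (x b))
    (hzz : ∀ a < n, ∀ b < n, Commute (z a) (z b))
    (hxz : ∀ a < n, ∀ b < n, a ≠ b + 1 → b ≠ a + 1 → Commute (x a) (z b))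
    (hb : ∀ a, a + 1 < n → x a * z (a + 1) * x a = z (a + 1) * x a * z (a + 1))
    (hb' : ∀ a, a + 1 < n → z a * x (a + 1) * z a = x (a + 1) * z a * x (a + 1)) :
    alt (seg x 0 n) (seg z 0 n) (n + 1) = alt (seg z 0 n) (seg x 0 n) (n + 1) := by
  set A : ℕ → N := fun a => if a % 2 = 0 then x a else z a with hA
  set C : ℕ → N := fun a => if a % 2 = 0 then z a else x a with hC
  have pA : IsPath A n := by
    refine ⟨fun a b hab hb => ?_, fun a ha => ?_⟩
    · simp only [hA]; split_ifs
      · exact hxx _ (by omega) _ hb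
      · exact hxz _ (by omega) _ hb (by omega) (by omega)
      · exact (hxz _ hb _ (by omega) (by omega) (by omega)).symm
      · exact hzz _ (by omega) _ hb
    · simp only [hA]
      by_cases h : a % 2 = 0
      · rw [if_pos h, if_neg (by omega)]; exact hb a ha
      · rw [if_neg h, if_pos (by omega)]; exact hb' a ha
  have pC : IsPath C n := by
    refine ⟨fun a b hab hb => ?_, fun a ha => ?_⟩
    · simp only [hC]; split_ifs
      · exact hzz _ (by omega) _ hb
      · exact (hxz _ hb _ (by omega) (by omega) (by omega)).symm
      · exact hxz _ (by omega) _ hb (by omega) (by omega)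
      · exact hxx _ (by omega) _ hb
    · simp only [hC]
      by_cases h : a % 2 = 0
      · rw [if_pos h, if_neg (by omega)]; exact hb' a ha
      · rw [if_neg h, if_pos (by omega)]; exact hb a ha
  have hAC : ∀ a < n, ∀ b < n, Commute (A a) (C b) := by
    intro a ha b hb
    simp only [hA, hC]; split_ifs
    · exact hxz _ ha _ hb (by omega) (by omega)
    · exact hxx _ ha _ hb
    · exact hzz _ ha _ hb
    · exact (hxz _ hb _ ha (by omega) (by omega)).symm
  have hpar : ∀ p q, ∀ a < n, ∀ b < n, Commute (par C p a) (par A q b) := by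
    intro p q a ha b hb
    unfold par; split_ifs
    · exact (hAC b hb a ha).symm
    all_goals simp
  have hx : seg x 0 n = row A n 0 * row C n 1 := by
    rw [row, row, ← seg_mul fun k hk l hl => hpar _ _ _ (by omega) _ (by omega)]
    refine seg_congr fun k _ => ?_
    by_cases h : k % 2 = 0
    · have h' : (k + 1) % 2 ≠ 0 := by omega
      simp [par, hA, h, h']
    · have h' : (k + 1) % 2 = 0 := by omega
      simp [par, hC, h, h']
  have hz : seg z 0 n = row A n 1 * row C n 0 := by
    rw [row, row, ← seg_mul fun k hk l hl => hpar _ _ _ (by omega) _ (by omega)]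
    refine seg_congr fun k _ => ?_
    by_cases h : k % 2 = 0
    · have h' : (k + 1) % 2 ≠ 0 := by omega
      simp [par, hC, h, h']
    · have h' : (k + 1) % 2 = 0 := by omega
      simp [par, hA, h, h']
  have hrow : ∀ p q, Commute (row C n p) (row A n q) := fun p q =>
    seg_commute fun k hk => (seg_commute fun l hl =>
      (hpar p q (0 + l) (by omega) (0 + k) (by omega)).symm : Commute (par A q (0 + k)) _).symm
  rw [hx, hz, alt_mul (hrow _ _) (hrow _ _) (hrow _ _) (hrow _ _),
    alt_mul (hrow _ _) (hrow _ _) (hrow _ _) (hrow _ _), pA.alt_row, pC.alt_row]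

end Brick

theorem altList_prod {N : Type*} [Monoid N] (f : B → N) (s t : B) (m : ℕ) :
    ((altList s t m).map f).prod = Brick.alt (f s) (f t) m := by
  induction m generalizing s t with
  | zero => rfl
  | succ m ih => rw [altList, List.map_cons, List.prod_cons, ih, Brick.alt]

namespace Unfold

variable [Fintype B] [DecidableEq B] (M : CoxeterMatrix B) (N : ℕ)

/-- The truncated Coxeter matrix entries. -/
def entry (i j : B) : ℕ := if M i j = 0 then N else M i j

/-- The number of vertices on the path unfolding an edge. -/
def width : Sym2 B → ℕ :=
  Sym2.lift ⟨fun i j => max 1 (entry M N i j - 1), fun i j => by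
    have h : M i j = M j i := M.symmetric i j
    simp only [entry, h]⟩

theorem width_pos (e : Sym2 B) : 0 < width M N e := by
  induction e with
  | h i j => simp [width]

theorem width_mk (i j : B) : width M N s(i, j) = max 1 (entry M N i j - 1) := rfl

/-- The sheets of the unfolding. -/
abbrev Sheet : Type _ := ∀ e : Sym2 B, Fin (width M N e)

variable {M N}

theorem sym2_ne {i j k : B} (hij : i ≠ j) (hik : i ≠ k) (hjk : j ≠ k) : s(i, j) ≠ s(j, k) := by
  simp [hij, hik, hjk]

variable (M N) in
/-- The simply laced unfolding of a Coxeter diagram. -/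
def graph : SimpleGraph (B × Sheet M N) where
  Adj v w := v.1 ≠ w.1 ∧
    ((v.2 s(v.1, w.1)).val + 1 = w.2 s(v.1, w.1) ∨ (w.2 s(v.1, w.1)).val + 1 = v.2 s(v.1, w.1)) ∧
    ∀ e, e ≠ s(v.1, w.1) → v.2 e = w.2 e
  symm := ⟨fun v w h => by
    rw [Sym2.eq_swap] at h
    exact ⟨h.1.symm, h.2.1.symm, fun e he => (h.2.2 e he).symm⟩⟩
  loopless := ⟨fun v h => h.1 rfl⟩

theorem triangleFree : SmallType.TriangleFree (graph M N) := by
  rintro ⟨i, p⟩ ⟨j, q⟩ ⟨k, r⟩ ⟨hij, h1, -⟩ ⟨hjk, -, h2⟩ ⟨hik, -, h3⟩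
  simp only at *
  have e2 := h2 s(i, j) (sym2_ne hij hik hjk)
  have e3 := h3 s(i, j) (by simp [hjk, hij.symm])
  rw [e2, e3] at h1
  omega

variable (M N) in
/-- The fiber over a vertex. -/
noncomputable def fib (i : B) : List (B × Sheet M N) :=
  (Finset.univ : Finset (Sheet M N)).toList.map (Prod.mk i)

theorem mem_fib {i : B} {v : B × Sheet M N} : v ∈ fib M N i ↔ v.1 = i := by
  simp only [fib, List.mem_map, Finset.mem_toList, Finset.mem_univ, true_and]
  exact ⟨fun ⟨p, hp⟩ => hp ▸ rfl, fun h => ⟨v.2, h ▸ rfl⟩⟩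

theorem nodup_fib (i : B) : (fib M N i).Nodup :=
  (Finset.nodup_toList _).map fun _ _ h => (Prod.ext_iff.1 h).2

/-- Move a sheet to position `a` along the edge `e`. -/
def put (e : Sym2 B) (a : ℕ) (p : Sheet M N) : Sheet M N :=
  Function.update p e ⟨a % width M N e, Nat.mod_lt _ (width_pos M N e)⟩

theorem put_self {e : Sym2 B} {a : ℕ} (ha : a < width M N e) (p : Sheet M N) :
    (put e a p e).val = a := by
  simp [put, Nat.mod_eq_of_lt ha]

theorem put_ne {e e' : Sym2 B} (h : e' ≠ e) (a : ℕ) (p : Sheet M N) : put e a p e' = p e' := by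
  simp [put, h]

theorem put_put (e : Sym2 B) (a b : ℕ) (p : Sheet M N) : put e a (put e b p) = put e a p := by
  simp [put]

theorem put_eq (e : Sym2 B) (p : Sheet M N) : put e (p e) p = p := by
  have : (⟨(p e).val % width M N e, Nat.mod_lt _ (width_pos M N e)⟩ : Fin (width M N e)) = p e :=
    Fin.ext (Nat.mod_eq_of_lt (p e).isLt)
  rw [put, this, Function.update_eq_self]

theorem adj_put {i j : B} (hij : i ≠ j) {p q : Sheet M N} {a b : ℕ}
    (ha : a < width M N s(i, j)) (hb : b < width M N s(i, j)) :
    (graph M N).Adj (i, put s(i, j) a p) (j, put s(i, j) b q) ↔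
      (a + 1 = b ∨ b + 1 = a) ∧ put s(i, j) 0 p = put s(i, j) 0 q := by
  simp only [graph, ne_eq, hij, not_false_eq_true, true_and, put_self ha, put_self hb]
  refine and_congr_right fun _ => ⟨fun h => ?_, fun h e he => ?_⟩
  · funext e
    by_cases he : e = s(i, j)
    · subst he; simp [put]
    · have := h e he
      rwa [put_ne he, put_ne he] at this ⊢
  · have := congrFun h e
    rwa [put_ne he, put_ne he] at this ⊢

theorem not_adj_same {i : B} {p q : Sheet M N} : ¬ (graph M N).Adj (i, p) (i, q) :=
  fun h => h.1 rfl

/-- The sheets at position `0` along `e`. -/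
noncomputable def reps (e : Sym2 B) : List (Sheet M N) :=
  (Finset.univ.filter fun p : Sheet M N => (p e).val = 0).toList

theorem fib_perm (i : B) (e : Sym2 B) : List.Perm (fib M N i)
    ((reps e).flatMap fun p => (List.range' 0 (width M N e)).map fun a => (i, put e a p)) := by
  have key : ∀ p : Sheet M N, (p e).val = 0 → ∀ a, put e 0 (put e a p) = p := by
    intro p hp a
    rw [put_put, ← hp, put_eq]
  refine (List.perm_ext_iff_of_nodup (nodup_fib i) ?_).2 ?_
  · rw [List.nodup_flatMap]
    refine ⟨fun p _ => ?_, ?_⟩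
    · refine List.Nodup.map_on ?_ (List.nodup_range')
      intro a ha b hb h
      simp only [List.mem_range'_1, zero_add] at ha hb
      have h := congrArg Fin.val (congrFun (Prod.ext_iff.1 h).2 e)
      rwa [put_self ha.2, put_self hb.2] at h
    · refine List.Pairwise.imp_of_mem ?_ (Finset.nodup_toList _)
      intro p q hp hq hne v h1 h2
      simp only [reps, Finset.mem_toList, Finset.mem_filter, Finset.mem_univ, true_and] at hp hq
      simp only [List.mem_map] at h1 h2
      obtain ⟨a, -, rfl⟩ := h1
      obtain ⟨b, -, h⟩ := h2
      exact hne ((key p hp a).symm.trans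
        ((congrArg (put e 0) (Prod.ext_iff.1 h).2.symm).trans (key q hq b)))
  · rintro ⟨k, p⟩
    simp only [mem_fib, List.mem_flatMap, List.mem_map, reps, Finset.mem_toList, Finset.mem_filter,
      Finset.mem_univ, true_and, List.mem_range'_1, zero_add, Prod.mk.injEq]
    constructor
    · rintro rfl
      exact ⟨put e 0 p, put_self (width_pos M N e) p, p e, ⟨Nat.zero_le _, (p e).isLt⟩, rfl,
        by rw [put_put, put_eq]⟩
    · rintro ⟨_, _, _, _, rfl, _⟩; rfl

variable {Q : Type*} [Monoid Q] {T : B × Sheet M N → Q}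

theorem prod_map_flatMap {ι κ : Type*} (l : List ι) (f : ι → List κ) (T : κ → Q) :
    ((l.flatMap f).map T).prod = (l.map fun x => ((f x).map T).prod).prod := by
  induction l with
  | nil => rfl
  | cons x l ih => simp [List.flatMap_cons, ih]

theorem fib_prod (hc : ∀ v w, ¬ (graph M N).Adj v w → Commute (T v) (T w)) (i : B) (e : Sym2 B) :
    ((fib M N i).map T).prod =
      ((reps e).map fun p => Brick.seg (fun a => T (i, put e a p)) 0 (width M N e)).prod := by
  rw [((fib_perm i e).map T).prod_eq']
  · rw [prod_map_flatMap]
    simp only [List.map_map]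
    rfl
  · rw [List.pairwise_map]
    refine List.pairwise_of_forall_mem_list fun v hv w hw => hc v w fun h => h.1 ?_
    rw [mem_fib.1 hv, mem_fib.1 hw]

theorem fib_braid (hc : ∀ v w, ¬ (graph M N).Adj v w → Commute (T v) (T w))
    (hb : ∀ v w, (graph M N).Adj v w → T v * T w * T v = T w * T v * T w)
    {i j : B} (hij : i ≠ j) (hm : M i j ≠ 0) :
    Brick.alt ((fib M N i).map T).prod ((fib M N j).map T).prod (M i j) =
      Brick.alt ((fib M N j).map T).prod ((fib M N i).map T).prod (M i j) := by
  set e := s(i, j) with he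
  have hm1 : M i j ≠ 1 := M.off_diagonal i j hij
  have hw : M i j = width M N e + 1 := by
    rw [he, width_mk, entry, if_neg hm]; omega
  have comm : ∀ k ∈ [i, j], ∀ l ∈ [i, j], ∀ p ∈ reps (M := M) (N := N) e, ∀ q ∈ reps e, p ≠ q →
      Commute (Brick.seg (fun a => T (k, put e a p)) 0 (width M N e))
        (Brick.seg (fun a => T (l, put e a q)) 0 (width M N e)) := by
    intro k hk l hl p hp q hq hpq
    refine Brick.seg_commute fun a ha => (Brick.seg_commute fun b hb => ?_).symm
    refine hc _ _ ?_
    simp only [reps, Finset.mem_toList, Finset.mem_filter, Finset.mem_univ, true_and] at hp hq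
    have hpq' : put e 0 p ≠ put e 0 q := by
      rwa [← hp, put_eq, hp, ← hq, put_eq]
    simp only [zero_add]
    simp only [List.mem_cons, List.not_mem_nil, or_false] at hk hl
    rcases hk with rfl | rfl <;> rcases hl with rfl | rfl
    · exact not_adj_same
    · intro h; exact hpq' ((adj_put hij hb ha).1 h.symm).2
    · intro h; exact hpq' ((adj_put hij ha hb).1 h).2.symm
    · exact not_adj_same
  have step : ∀ p : Sheet M N,
      Brick.alt (Brick.seg (fun a => T (i, put e a p)) 0 (width M N e))
        (Brick.seg (fun a => T (j, put e a p)) 0 (width M N e)) (width M N e + 1) =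
      Brick.alt (Brick.seg (fun a => T (j, put e a p)) 0 (width M N e))
        (Brick.seg (fun a => T (i, put e a p)) 0 (width M N e)) (width M N e + 1) := by
    intro p
    refine Brick.alt_seg ?_ ?_ ?_ ?_ ?_
    · exact fun a _ b _ => hc _ _ not_adj_same
    · exact fun a _ b _ => hc _ _ not_adj_same
    · exact fun a ha b hb h1 h2 => hc _ _ fun h => by
        have := ((adj_put hij ha hb).1 h).1; omega
    · exact fun a ha => hb _ _ ((adj_put hij (by rw [← he]; omega) ha).2 ⟨.inl rfl, rfl⟩)
    · exact fun a ha => hb _ _ ((adj_put hij ha (by rw [← he]; omega)).2 ⟨.inr rfl, rfl⟩).symm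
  have pw : ∀ k ∈ [i, j], ∀ l ∈ [i, j], (reps (M := M) (N := N) e).Pairwise fun p q =>
      Commute (Brick.seg (fun a => T (k, put e a p)) 0 (width M N e))
        (Brick.seg (fun a => T (l, put e a q)) 0 (width M N e)) := fun k hk l hl =>
    List.Pairwise.imp_of_mem (fun hp hq hne => comm k hk l hl _ hp _ hq hne)
      (Finset.nodup_toList _)
  rw [hw, fib_prod hc i e, fib_prod hc j e, Brick.alt_list_prod, Brick.alt_list_prod]
  · simp only [step]
  · exact (pw j (by simp) j (by simp)).and ((pw j (by simp) i (by simp)).and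
      ((pw i (by simp) j (by simp)).and (pw i (by simp) i (by simp))))
  · exact (pw i (by simp) i (by simp)).and ((pw i (by simp) j (by simp)).and
      ((pw j (by simp) i (by simp)).and (pw j (by simp) j (by simp))))

end Unfold

end

section

namespace SmallType

variable {V : Type*} [Fintype V] {G : SimpleGraph V}

theorem Walk.perm (htf : TriangleFree G) {L L' : List V} (h : List.Perm L L')
    (hL : ∀ v ∈ L, ∀ w ∈ L, ¬ G.Adj v w) {β γ : V → ℤ} (hβ : IsRoot G β) (hw : Walk G L β γ) :
    Walk G L' β γ := by
  refine Walk.congr ?_ hβ hw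
  refine (h.map _).prod_eq' ?_
  rw [List.pairwise_map]
  exact List.pairwise_of_forall_mem_list fun v hv w hw => opUnit_commute htf (hL v hv w hw)

theorem Walk.loop (htf : TriangleFree G) {L : List V} (hL : ∀ v ∈ L, ∀ w ∈ L, ¬ G.Adj v w)
    {β γ : V → ℤ} (hβ : IsRoot G β) (hw : Walk G L β γ) : Walk G (L ++ L) β γ := by
  have key : ∀ {L : List V} {β : V → ℤ}, IsRoot G β → Walk G L β γ →
      Walk G (L.flatMap fun v => [v, v]) β γ := by
    intro L
    induction L with
    | nil => exact fun _ h => h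
    | cons v L ih =>
      rintro β hβ ⟨δ, h1, h2⟩
      rw [List.flatMap_cons, Walk.append_iff]
      exact ⟨δ, h1.loop hβ, ih (h1.root hβ) h2⟩
  have hp : ∀ L : List V, List.Perm (L.flatMap fun v => [v, v]) (L ++ L) := by
    intro L
    induction L with
    | nil => rfl
    | cons v L ih =>
      rw [List.flatMap_cons]
      exact ((ih.cons v).trans List.perm_middle.symm).cons v
  refine Walk.perm htf (hp L) ?_ hβ (key hβ hw)
  intro v hv w hw
  simp only [List.mem_flatMap, List.mem_cons, List.not_mem_nil, or_false, or_self] at hv hw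
  obtain ⟨_, h1, rfl⟩ := hv
  obtain ⟨_, h2, rfl⟩ := hw
  exact hL _ h1 _ h2

theorem Step.eq_of_pair {v : V} {β γ : V → ℤ} (h : Step G v β γ) (hp : pair G v β = 0) :
    γ = β := by
  obtain ⟨-, rfl | ⟨h, -⟩⟩ := h
  · exact refl_of_pair_eq_zero hp
  · exact h

theorem Walk.not_sroot {L : List V} {v : V} (hv : v ∈ L) (hL : ∀ w ∈ L, ¬ G.Adj w v)
    (γ : V → ℤ) : ¬ Walk G L (sroot v) γ := by
  induction L with
  | nil => simp at hv
  | cons w L ih =>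
    rintro ⟨δ, h1, h2⟩
    by_cases hwv : w = v
    · subst hwv; exact h1.1 rfl
    · have := h1.eq_of_pair (pair_sroot_nadj hwv (hL w (by simp)))
      subst this
      exact ih (by simpa [Ne.symm hwv] using hv) (fun w hw => hL w (by simp [hw])) h2

theorem Walk.descend (htf : TriangleFree G) {L : List V} (hL : ∀ v ∈ L, ∀ w ∈ L, ¬ G.Adj v w)
    {v : V} (hv : v ∈ L) {β γ : V → ℤ} (hβ : IsRoot G β) (hp : 0 < pair G v β)
    (hw : Walk G L β γ) : IsRoot G (refl G v β) ∧ Walk G L (refl G v β) γ := by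
  classical
  have hperm := List.perm_cons_erase hv
  have hL' : ∀ x ∈ v :: L.erase v, ∀ y ∈ v :: L.erase v, ¬ G.Adj x y := fun x hx y hy =>
    hL x (hperm.mem_iff.2 hx) y (hperm.mem_iff.2 hy)
  obtain ⟨δ, h1, h2⟩ := hw.perm htf hperm hL hβ
  have e : δ = refl G v β := h1.2.resolve_right fun h => by omega
  subst e
  have hr := h1.root hβ
  refine ⟨hr, Walk.perm htf hperm.symm hL' hr
    ⟨_, ⟨(h1.symm hβ).1, .inr ⟨rfl, ?_⟩⟩, h2⟩⟩
  rw [pair_refl_self]; omega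

theorem Step.apply_ne {v w : V} (hvw : w ≠ v) {β γ : V → ℤ} (h : Step G v β γ) : γ w = β w := by
  obtain ⟨-, rfl | ⟨rfl, -⟩⟩ := h
  · exact refl_apply_ne hvw β
  · rfl

theorem Walk.apply_ne {L : List V} {w : V} (hw : w ∉ L) {β γ : V → ℤ} (h : Walk G L β γ) :
    γ w = β w := by
  induction L generalizing β with
  | nil => rw [h]
  | cons v L ih =>
    obtain ⟨δ, h1, h2⟩ := h
    rw [List.mem_cons, not_or] at hw
    rw [ih hw.2 h2, h1.apply_ne hw.1]

/-- A walk through a set of commuting letters can be built from its moving letters. -/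
theorem Walk.of_moves (htf : TriangleFree G) {L l : List V} (hL : ∀ v ∈ L, ∀ w ∈ L, ¬ G.Adj v w)
    (hLn : L.Nodup) (hln : l.Nodup) (hl : ∀ v ∈ l, v ∈ L) {β γ : V → ℤ} (hβ : IsRoot G β)
    (h : Walk G l β γ) (hs : ∀ v ∈ L, v ∉ l → pair G v γ ≤ 0) : Walk G L β γ := by
  classical
  have hp : List.Perm (l ++ L.filter (· ∉ l)) L := by
    refine (List.perm_ext_iff_of_nodup ?_ hLn).2 ?_
    · refine List.nodup_append'.2 ⟨hln, hLn.filter _, ?_⟩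
      intro v h1 h2
      simp at h2
      exact h2.2 h1
    · intro v
      simp only [List.mem_append, List.mem_filter, decide_not, Bool.not_eq_eq_eq_not,
        Bool.not_true, decide_eq_false_iff_not]
      exact ⟨fun h => h.elim (hl v) And.left, fun h => by tauto⟩
  refine Walk.perm htf hp (fun v hv w hw => hL v (hp.mem_iff.1 hv) w (hp.mem_iff.1 hw)) hβ ?_
  rw [Walk.append_iff]
  refine ⟨γ, h, ?_⟩
  have : ∀ r : List V, (∀ v ∈ r, pair G v γ ≤ 0) → Walk G r γ γ := by
    intro r hr
    induction r with
    | nil => rfl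
    | cons v r ih =>
      have hv := hr v (by simp)
      refine ⟨γ, ⟨?_, .inr ⟨rfl, hv⟩⟩, ih fun w hw => hr w (by simp [hw])⟩
      rintro rfl
      rw [pair_sroot_self] at hv
      omega
  exact this _ fun v hv => by
    simp at hv
    exact hs v hv.1 hv.2

end SmallType

namespace Unfold

open SmallType

variable [Fintype B] [DecidableEq B] {M : CoxeterMatrix B} {N : ℕ}

theorem not_adj_fib {i : B} : ∀ v ∈ fib M N i, ∀ w ∈ fib M N i, ¬ (graph M N).Adj v w :=
  fun v hv w hw h => h.1 (by rw [mem_fib.1 hv, mem_fib.1 hw])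

theorem fib_rels : ∀ r ∈ braidRels M,
    FreeGroup.lift (fun i => ((fib M N i).map (opUnit (graph M N))).prod) r = 1 := by
  rintro r ⟨s, t, hst, hm, rfl⟩
  have key : ∀ l : List B, FreeGroup.lift (fun i => ((fib M N i).map (opUnit (graph M N))).prod)
      ((l.map FreeGroup.of).prod) =
      (l.map fun i => ((fib M N i).map (opUnit (graph M N))).prod).prod := by
    intro l
    rw [map_list_prod, List.map_map]
    congr 1
  rw [map_mul, map_inv, key, key, mul_inv_eq_one, altList_prod, altList_prod]
  exact fib_braid (fun v w h => opUnit_commute triangleFree h)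
    (fun v w h => opUnit_braid triangleFree h) hst hm

variable (M N) in
/-- The path relation of a word in the original generators. -/
def Rel (l : List B) : (B × Sheet M N → ℤ) → (B × Sheet M N → ℤ) → Prop :=
  Walk (graph M N) (l.flatMap (fib M N))

theorem Rel.congr {l l' : List B} (h : (l.map (gen M)).prod = (l'.map (gen M)).prod)
    {β γ : B × Sheet M N → ℤ} (hβ : IsRoot (graph M N) β) (hr : Rel M N l β γ) :
    Rel M N l' β γ := by
  refine Walk.congr ?_ hβ hr
  have key : ∀ l : List B, ((l.flatMap (fib M N)).map (opUnit (graph M N))).prod =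
      PresentedGroup.toGroup (fib_rels (M := M) (N := N)) (l.map (gen M)).prod := by
    intro l
    rw [prod_map_flatMap]
    induction l with
    | nil => exact (map_one (PresentedGroup.toGroup (fib_rels (M := M) (N := N)))).symm
    | cons i l ih =>
      rw [List.map_cons, List.prod_cons, ih, List.map_cons, List.prod_cons]
      refine Eq.trans ?_ (map_mul (PresentedGroup.toGroup (fib_rels (M := M) (N := N))) _ _).symm
      congr 1
  rw [key, key, h]

theorem Rel.append_iff {l l' : List B} {β γ : B × Sheet M N → ℤ} :
    Rel M N (l ++ l') β γ ↔ ∃ δ, Rel M N l β δ ∧ Rel M N l' δ γ := by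
  rw [Rel, List.flatMap_append, Walk.append_iff]; rfl

theorem rel_singleton {i : B} {β γ : B × Sheet M N → ℤ} :
    Rel M N [i] β γ ↔ Walk (graph M N) (fib M N i) β γ := by
  simp [Rel]

theorem Rel.cons_iff {i : B} {l : List B} {β γ : B × Sheet M N → ℤ} :
    Rel M N (i :: l) β γ ↔ ∃ δ, Rel M N [i] β δ ∧ Rel M N l δ γ := by
  rw [← List.singleton_append, Rel.append_iff]

theorem Rel.root {l : List B} {β γ : B × Sheet M N → ℤ} (h : Rel M N l β γ)
    (hβ : IsRoot (graph M N) β) : IsRoot (graph M N) γ := Walk.root h hβ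

theorem Rel.reverse {l : List B} {β γ : B × Sheet M N → ℤ} (h : Rel M N l β γ)
    (hβ : IsRoot (graph M N) β) : Rel M N l.reverse γ β := by
  induction l generalizing β with
  | nil => exact h.symm
  | cons i l ih =>
    obtain ⟨δ, h1, h2⟩ := Rel.cons_iff.1 h
    have hδ := h1.root hβ
    rw [List.reverse_cons, Rel.append_iff]
    refine ⟨δ, ih h2 hδ, ?_⟩
    rw [rel_singleton] at h1 ⊢
    refine Walk.perm triangleFree (List.reverse_perm _) ?_ hδ (Walk.reverse h1 hβ)
    intro v hv w hw
    exact not_adj_fib v (List.mem_reverse.1 hv) w (List.mem_reverse.1 hw)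

theorem Rel.loop {i : B} {l : List B} {β γ : B × Sheet M N → ℤ} (h : Rel M N (i :: l) β γ)
    (hβ : IsRoot (graph M N) β) : Rel M N (i :: i :: l) β γ := by
  obtain ⟨δ, h1, h2⟩ := Rel.cons_iff.1 h
  have := Walk.loop triangleFree not_adj_fib hβ (rel_singleton.1 h1)
  rw [Walk.append_iff] at this
  obtain ⟨ε, h3, h4⟩ := this
  exact Rel.cons_iff.2 ⟨ε, rel_singleton.2 h3, Rel.cons_iff.2 ⟨δ, rel_singleton.2 h4, h2⟩⟩

theorem Rel.not_sroot {i : B} {l : List B} (p : Sheet M N) (γ : B × Sheet M N → ℤ) :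
    ¬ Rel M N (i :: l) (sroot (i, p)) γ := by
  intro h
  obtain ⟨δ, h1, -⟩ := Rel.cons_iff.1 h
  have h2 := rel_singleton.1 h1
  have hm : (i, p) ∈ fib M N i := mem_fib.2 rfl
  exact Walk.not_sroot (v := (i, p)) (L := fib M N i) hm
    (fun w hw => not_adj_fib w hw _ hm) δ h2

theorem Rel.apply_eq {l : List B} {v : B × Sheet M N} (hv : v.1 ∉ l) {β γ : B × Sheet M N → ℤ}
    (h : Rel M N l β γ) : γ v = β v := by
  refine Walk.apply_ne ?_ h
  rw [List.mem_flatMap]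
  rintro ⟨i, hi, hv'⟩
  exact hv (mem_fib.1 hv' ▸ hi)

theorem Rel.descend {v : B × Sheet M N} {l : List B} {β γ : B × Sheet M N → ℤ}
    (hβ : IsRoot (graph M N) β) (hp : 0 < pair (graph M N) v β) (h : Rel M N (v.1 :: l) β γ) :
    IsRoot (graph M N) (refl (graph M N) v β) ∧
      Rel M N (v.1 :: l) (refl (graph M N) v β) γ := by
  obtain ⟨δ, h1, h2⟩ := Rel.cons_iff.1 h
  have := Walk.descend triangleFree not_adj_fib (mem_fib.2 rfl) hβ hp (rel_singleton.1 h1)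
  exact ⟨this.1, Rel.cons_iff.2 ⟨δ, rel_singleton.2 this.2, h2⟩⟩

end Unfold

end

section

namespace SmallType

variable {V : Type*} [Fintype V] {G : SimpleGraph V}

theorem pair_add (i : V) (β γ : V → ℤ) : pair G i (β + γ) = pair G i β + pair G i γ := by
  have := pair_sub_smul (G := G) i β γ (-1)
  simpa using this

/-- The sum of the simple roots in an interval of a path. -/
noncomputable def ivRoot (w : ℕ → V) (a b : ℕ) : V → ℤ := ∑ c ∈ Finset.Icc a b, sroot (w c)

theorem ivRoot_self (w : ℕ → V) (a : ℕ) : ivRoot w a a = sroot (w a) := by simp [ivRoot]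

theorem ivRoot_succ_right (w : ℕ → V) {a b : ℕ} (h : a ≤ b + 1) :
    ivRoot w a (b + 1) = ivRoot w a b + sroot (w (b + 1)) :=
  Finset.sum_Icc_succ_top h _

theorem ivRoot_left (w : ℕ → V) {a b : ℕ} (h : a ≤ b) :
    ivRoot w a b = sroot (w a) + ivRoot w (a + 1) b := by
  have : Finset.Icc (a + 1) b = Finset.Ioc a b := by ext; simp
  rw [ivRoot, ivRoot, ← Finset.add_sum_Ioc_eq_sum_Icc h, this]

theorem pair_ivRoot_off {w : ℕ → V} {v : V} {n : ℕ} (hv : ∀ c < n, v ≠ w c ∧ ¬ G.Adj v (w c))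
    {a b : ℕ} (hb : b < n) : pair G v (ivRoot w a b) = 0 := by
  classical
  have : ∀ s : Finset ℕ, (∀ c ∈ s, c < n) → pair G v (∑ c ∈ s, sroot (w c)) = 0 := by
    intro s
    induction s using Finset.induction_on with
    | empty => intro _; simp [pair]
    | insert c s hc ih =>
      intro h
      rw [Finset.sum_insert hc, pair_add, ih fun d hd => h d (Finset.mem_insert_of_mem hd)]
      have := hv c (h c (Finset.mem_insert_self _ _))
      rw [pair_sroot_nadj this.1 this.2]; rfl
  refine this _ fun c hc => ?_
  have := (Finset.mem_Icc.1 hc).2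
  omega

/-- `w 0, …, w (n - 1)` is an induced path of `G`. -/
structure IsInduced (G : SimpleGraph V) (w : ℕ → V) (n : ℕ) : Prop where
  inj : ∀ a < n, ∀ b < n, w a = w b → a = b
  adj : ∀ a < n, ∀ b < n, G.Adj (w a) (w b) ↔ a + 1 = b ∨ b + 1 = a

variable {w : ℕ → V} {n : ℕ}

theorem IsInduced.pair_ivRoot (hw : IsInduced G w n) {a b c : ℕ} (hab : a ≤ b) (hb : b < n)
    (hc : c < n) : pair G (w c) (ivRoot w a b) =
      2 * (if a ≤ c ∧ c ≤ b then 1 else 0) - (if a + 1 ≤ c ∧ c ≤ b + 1 then 1 else 0) -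
        (if a ≤ c + 1 ∧ c + 1 ≤ b then 1 else 0) := by
  classical
  have hs : ∀ d < n, pair G (w c) (sroot (w d)) =
      if c = d then 2 else if c + 1 = d ∨ d + 1 = c then -1 else 0 := by
    intro d hd
    rw [pair_sroot]
    have h1 : w c = w d ↔ c = d := ⟨hw.inj c hc d hd, fun h => h ▸ rfl⟩
    simp only [h1, hw.adj c hc d hd]
  induction b, hab using Nat.le_induction with
  | base => rw [ivRoot_self, hs a hb]; grind
  | succ b hab ih =>
    rw [ivRoot_succ_right w (by omega), pair_add, ih (by omega), hs _ hb]
    grind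

theorem IsInduced.left_move (hw : IsInduced G w n) {a b a' : ℕ} {I : ℕ → Prop} (hab : a ≤ b)
    (hb : b < n) (h1 : I a → a' = a + 1 ∧ a < b) (h2 : ¬ I a → a' = a ∨ (a' + 1 = a ∧ I a')) :
    ∃ l : List V, l.Nodup ∧ (∀ v ∈ l, ∃ c < n, v = w c ∧ c ≤ a ∧ I c ∧ (c = a → a < b)) ∧
      Walk G l (ivRoot w a b) (ivRoot w a' b) ∧ (a' + 1 = a → w a' ∈ l) := by
  by_cases ha : I a
  · obtain ⟨rfl, hlt⟩ := h1 ha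
    have hp : pair G (w a) (ivRoot w a b) = 1 := by
      rw [hw.pair_ivRoot hab hb (by omega)]; grind
    refine ⟨[w a], by simp, ?_, ⟨_, ⟨?_, .inl rfl⟩, ?_⟩, by omega⟩
    · intro v hv
      rw [List.mem_singleton] at hv
      exact ⟨a, by omega, hv, le_rfl, ha, fun _ => hlt⟩
    · intro h
      rw [h, pair_sroot_self] at hp
      omega
    · rw [Walk, refl, hp, one_smul, ivRoot_left w hab, add_sub_cancel_left]
  · rcases h2 ha with rfl | ⟨rfl, hI⟩
    · exact ⟨[], by simp, by simp, rfl, by omega⟩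
    · have hp : pair G (w a') (ivRoot w (a' + 1) b) = -1 := by
        rw [hw.pair_ivRoot hab hb (by omega)]; grind
      refine ⟨[w a'], by simp, ?_, ⟨_, ⟨?_, .inl rfl⟩, ?_⟩, by simp⟩
      · intro v hv
        rw [List.mem_singleton] at hv
        exact ⟨a', by omega, hv, by omega, hI, by omega⟩
      · intro h
        rw [h, pair_sroot_self] at hp
        omega
      · rw [Walk, refl, hp, ivRoot_left w (show a' ≤ b by omega)]
        simp [add_comm]

theorem IsInduced.right_move (hw : IsInduced G w n) {a b b' : ℕ} {I : ℕ → Prop} (hab : a ≤ b)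
    (hb : b < n) (hb' : b' < n) (h1 : I b → b = b' + 1 ∧ a < b)
    (h2 : ¬ I b → b' = b ∨ (b' = b + 1 ∧ I b')) :
    ∃ l : List V, l.Nodup ∧ (∀ v ∈ l, ∃ c < n, v = w c ∧ b ≤ c ∧ I c) ∧
      Walk G l (ivRoot w a b) (ivRoot w a b') ∧ (b' = b + 1 → w b' ∈ l) := by
  by_cases ha : I b
  · obtain ⟨rfl, hlt⟩ := h1 ha
    have hp : pair G (w (b' + 1)) (ivRoot w a (b' + 1)) = 1 := by
      rw [hw.pair_ivRoot hab hb (by omega)]; grind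
    refine ⟨[w (b' + 1)], by simp, ?_, ⟨_, ⟨?_, .inl rfl⟩, ?_⟩, by omega⟩
    · intro v hv
      rw [List.mem_singleton] at hv
      exact ⟨b' + 1, by omega, hv, le_rfl, ha⟩
    · intro h
      rw [h, pair_sroot_self] at hp
      omega
    · rw [Walk, refl, hp, one_smul, ivRoot_succ_right w hab, add_sub_cancel_right]
  · rcases h2 ha with rfl | ⟨rfl, hI⟩
    · exact ⟨[], by simp, by simp, rfl, by omega⟩
    · have hp : pair G (w (b + 1)) (ivRoot w a b) = -1 := by
        rw [hw.pair_ivRoot hab hb (by omega)]; grind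
      refine ⟨[w (b + 1)], by simp, ?_, ⟨_, ⟨?_, .inl rfl⟩, ?_⟩, by simp⟩
      · intro v hv
        rw [List.mem_singleton] at hv
        exact ⟨b + 1, by omega, hv, by omega, hI⟩
      · intro h
        rw [h, pair_sroot_self] at hp
        omega
      · rw [Walk, refl, hp, ivRoot_succ_right w (show a ≤ b + 1 by omega)]
        simp

/-- A walk between interval roots through the vertices in alternate positions. -/
theorem IsInduced.walk_ivRoot (htf : TriangleFree G) (hw : IsInduced G w n) {L : List V}
    (hL : ∀ v ∈ L, ∀ w ∈ L, ¬ G.Adj v w) (hLn : L.Nodup) {I : ℕ → Prop}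
    (hI : ∀ c < n, w c ∈ L ↔ I c) (hoff : ∀ v ∈ L, (∃ c < n, v = w c) ∨ ∀ c < n, ¬ G.Adj v (w c))
    {a b a' b' : ℕ} (hab : a ≤ b) (hb : b < n) (hab' : a' ≤ b') (hb' : b' < n)
    (hr : IsRoot G (ivRoot w a b)) (hne : I a → a < b)
    (ha1 : I a → a' = a + 1 ∧ ¬ I a') (ha2 : ¬ I a → a' = a ∨ (a' + 1 = a ∧ I a'))
    (hb1 : I b → b = b' + 1 ∧ ¬ I b') (hb2 : ¬ I b → b' = b ∨ (b' = b + 1 ∧ I b')) :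
    Walk G L (ivRoot w a b) (ivRoot w a' b') := by
  have hIb : I b → a' < b := fun h => by
    have := hb1 h; omega
  obtain ⟨l, hl1, hl2, hl3, hl4⟩ :=
    hw.left_move hab hb (fun h => ⟨(ha1 h).1, hne h⟩) ha2
  have ha'b : a' ≤ b := by
    by_cases h : I b
    · exact (hIb h).le
    · by_cases h' : I a
      · have := ha1 h'; have := hne h'; omega
      · have := ha2 h'; omega
  obtain ⟨r, hr1, hr2, hr3, hr4⟩ :=
    hw.right_move ha'b hb hb' (fun h => ⟨(hb1 h).1, hIb h⟩) hb2
  refine Walk.of_moves htf (l := l ++ r) hL hLn ?_ ?_ hr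
    (Walk.append_iff.2 ⟨_, hl3, hr3⟩) ?_
  · refine List.nodup_append'.2 ⟨hl1, hr1, ?_⟩
    intro v h1 h2
    obtain ⟨c, hc, rfl, h3, h4, h5⟩ := hl2 v h1
    obtain ⟨d, hd, h6, h7, h8⟩ := hr2 _ h2
    have := hw.inj c hc d hd h6
    omega
  · intro v hv
    rcases List.mem_append.1 hv with hv | hv
    · obtain ⟨c, hc, rfl, h⟩ := hl2 v hv
      exact (hI c hc).2 h.2.1
    · obtain ⟨c, hc, rfl, h⟩ := hr2 v hv
      exact (hI c hc).2 h.2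
  · intro v hv hvl
    by_cases hvc : ∃ c < n, v = w c
    · obtain ⟨c, hc, rfl⟩ := hvc
      rw [List.mem_append, not_or] at hvl
      have hc' := (hI c hc).1 hv
      have h1 : c ≠ a' := by
        rintro rfl
        by_cases h : I a
        · exact (ha1 h).2 hc'
        · rcases ha2 h with rfl | h'
          · exact h hc'
          · exact hvl.1 (hl4 h'.1)
      have h2 : c ≠ b' := by
        rintro rfl
        by_cases h : I b
        · exact (hb1 h).2 hc'
        · rcases hb2 h with rfl | h'
          · exact h hc'
          · exact hvl.2 (hr4 h'.1)
      rw [hw.pair_ivRoot hab' hb' hc]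
      grind
    · refine (pair_ivRoot_off (n := n) (fun c hc => ⟨fun h => hvc ⟨c, hc, h⟩, ?_⟩) hb').le
      exact (hoff v hv).resolve_left hvc c hc

end SmallType

theorem altList_succ_right (s t : B) (k : ℕ) :
    altList s t (k + 1) = altList s t k ++ [if Even k then s else t] := by
  induction k generalizing s t with
  | zero => simp [altList]
  | succ k ih =>
    rw [altList, ih, altList, List.cons_append]
    simp only [Nat.even_add_one]
    split_ifs <;> rfl

namespace Unfold

open SmallType

variable [Fintype B] [DecidableEq B] {M : CoxeterMatrix B} {N : ℕ}

/-- The simple root of the end of a proper alternating word is moved along the unfolded edge. -/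
theorem exists_rel_altList {i j : B} (hij : i ≠ j) {k : ℕ} (hk : k < entry M N i j)
    (hk1 : 1 ≤ k) (p : Sheet M N) :
    ∃ q, Rel M N (altList j i k) (sroot (i, p)) (sroot (if Even k then j else i, q)) := by
  set e := s(i, j) with he
  set n := width M N e with hn
  have hkn : k ≤ n := by rw [hn, he, width_mk]; omega
  set x := (p e).val with hx
  have hxn : x < n := (p e).isLt
  let w : ℕ → B × Sheet M N := fun c => (if Even (c + x) then i else j, put e c p)
  have hwe : ∀ c, Even (c + x) → w c = (i, put e c p) := fun c h => by simp [w, h]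
  have hwo : ∀ c, ¬ Even (c + x) → w c = (j, put e c p) := fun c h => by simp only [w, if_neg h]
  have hwx : w x = (i, p) := by rw [hwe x ⟨x, rfl⟩, hx, put_eq]
  have hin : IsInduced (graph M N) w n := by
    refine ⟨fun a ha b hb h => ?_, fun a ha b hb => ?_⟩
    · have := congrArg Fin.val (congrFun (Prod.ext_iff.1 h).2 e)
      simpa only [w, put_self (hn ▸ ha), put_self (hn ▸ hb)] using this
    · by_cases h1 : Even (a + x) <;> by_cases h2 : Even (b + x)
      · rw [hwe a h1, hwe b h2]
        simp only [not_adj_same, false_iff]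
        rw [Nat.even_iff] at h1 h2; omega
      · rw [hwe a h1, hwo b h2, he, adj_put hij (he ▸ ha) (he ▸ hb)]; simp
      · rw [hwo a h1, hwe b h2, SimpleGraph.adj_comm, he, adj_put hij (he ▸ hb) (he ▸ ha)]
        simp [or_comm]
      · rw [hwo a h1, hwo b h2]
        simp only [not_adj_same, false_iff]
        rw [Nat.even_iff] at h1 h2; omega
  have hmem : ∀ r c : ℕ, w c ∈ fib M N (if Even r then j else i) ↔ (c + x + r + 1) % 2 = 0 := by
    intro r c
    rw [mem_fib]
    by_cases h1 : Even r <;> by_cases h2 : Even (c + x) <;>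
      simp only [w, h1, h2, if_true, if_false, hij, hij.symm, true_iff, false_iff] <;>
      rw [Nat.even_iff] at h1 h2 <;> omega
  have hoff : ∀ r : ℕ, ∀ v ∈ fib M N (if Even r then j else i),
      (∃ c < n, v = w c) ∨ ∀ c < n, ¬ (graph M N).Adj v (w c) := by
    intro r v hv
    by_contra hcon
    push Not at hcon
    obtain ⟨h1, c, hc, h2⟩ := hcon
    have hv1 : v.1 = i ∨ v.1 = j := by
      rw [mem_fib] at hv; rw [hv]; split_ifs <;> simp
    have hd : (v.2 e).val < n := (v.2 e).isLt
    have hv2 : v = (v.1, put e (v.2 e).val v.2) := by rw [put_eq]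
    have h3 : put e 0 v.2 = put e 0 p ∧ ((v.2 e).val + 1 = c ∨ c + 1 = (v.2 e).val) ∧
        (v.1 = i ↔ ¬ Even (c + x)) := by
      rw [hv2] at h2
      rcases hv1 with hv1 | hv1 <;> rw [hv1] at h2 ⊢
      · by_cases h : Even (c + x)
        · rw [hwe c h] at h2; exact absurd h2 not_adj_same
        · rw [hwo c h, he, adj_put hij (he ▸ hd) (he ▸ hc)] at h2
          exact ⟨h2.2, h2.1, by simp [h]⟩
      · by_cases h : Even (c + x)
        · rw [hwe c h, SimpleGraph.adj_comm, he, adj_put hij (he ▸ hc) (he ▸ hd)] at h2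
          exact ⟨h2.2.symm, h2.1.symm, by simp [h, hij.symm]⟩
        · rw [hwo c h] at h2; exact absurd h2 not_adj_same
    obtain ⟨h3, h4, h5⟩ := h3
    refine h1 _ hd ?_
    have h6 : put e (v.2 e).val p = v.2 := by
      rw [← put_put e _ 0 p, ← h3, put_put, put_eq]
    by_cases h : Even ((v.2 e).val + x)
    · rw [hwe _ h, h6]
      refine Prod.ext (h5.2 ?_) rfl
      rw [Nat.even_iff] at h ⊢; omega
    · rw [hwo _ h, h6]
      refine Prod.ext (hv1.resolve_left fun h' => ?_) rfl
      have := h5.1 h'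
      rw [Nat.even_iff] at h this; omega
  obtain ⟨u, v, hu, hv, huv⟩ : ∃ u v, u ≤ x ∧ x + v < n ∧ u + v + 1 = k :=
    ⟨min x (k - 1), k - 1 - min x (k - 1), by omega, by omega, by omega⟩
  let a : ℕ → ℕ := fun r => if r ≤ u then x - r else x + r - 2 * u - 1
  let b : ℕ → ℕ := fun r => if r ≤ v then x + r else x + 2 * v + 1 - r
  have main : ∀ r ≤ k, Rel M N (altList j i r) (sroot (i, p)) (ivRoot w (a r) (b r)) := by
    intro r
    induction r with
    | zero => intro _; simp only [a, b, zero_le, if_true]; rw [Nat.sub_zero, Nat.add_zero,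
        ivRoot_self]
              exact hwx ▸ rfl
    | succ r ih =>
      intro hr
      have ih := ih (by omega)
      rw [altList_succ_right, Rel.append_iff]
      refine ⟨_, ih, rel_singleton.2 ?_⟩
      have hroot := ih.root (IsRoot.simple _)
      refine hin.walk_ivRoot (I := fun c => (c + x + r + 1) % 2 = 0) triangleFree not_adj_fib
          (nodup_fib _)
        (fun c _ => hmem r c) (hoff r) ?_ ?_ ?_ ?_ hroot ?_ ?_ ?_ ?_ ?_
      all_goals simp only [a, b]; split_ifs <;> omega
  have := main k le_rfl
  have e1 : a k = x + v - u := by simp only [a]; split_ifs <;> omega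
  have e2 : b k = x + v - u := by simp only [b]; split_ifs <;> omega
  rw [e1, e2, ivRoot_self] at this
  refine ⟨put e (x + v - u) p, ?_⟩
  convert this using 2
  simp only [w]
  refine Prod.ext ?_ rfl
  by_cases h : Even k <;> by_cases h' : Even
      (x + v - u + x) <;> simp only [h, h', if_true, if_false] <;>
    rw [Nat.even_iff] at h h' <;> omega

end Unfold

end

section

variable {B : Type*} {M : CoxeterMatrix B}

variable (M) in
/-- The positive element spelled by a word. -/
def word (l : List B) : Artin M := (l.map (gen M)).prod

theorem word_nil : word M [] = 1 := rfl

theorem word_cons (i : B) (l : List B) : word M (i :: l) = gen M i * word M l := by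
  simp [word]

theorem word_append (l l' : List B) : word M (l ++ l') = word M l * word M l' := by
  simp [word]

theorem word_singleton (i : B) : word M [i] = gen M i := by simp [word]

theorem word_altList {s t : B} (hst : s ≠ t) (hm : M s t ≠ 0) :
    word M (altList s t (M s t)) = word M (altList t s (M s t)) := by
  have key : ∀ l : List B, word M l =
      (PresentedGroup.mk (braidRels M) (l.map FreeGroup.of).prod : PresentedGroup _) := by
    intro l
    rw [word, map_list_prod, List.map_map]
    rfl
  have h := PresentedGroup.one_of_mem (rels := braidRels M) ⟨s, t, hst, hm, rfl⟩
  rw [map_mul, map_inv, mul_inv_eq_one] at h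
  rw [key, key, h]

theorem mem_posMonOn {Z : Set B} {b : Artin M} :
    b ∈ posMonOn M Z ↔ ∃ l : List B, (∀ s ∈ l, s ∈ Z) ∧ word M l = b := by
  constructor
  · intro h
    induction h using Submonoid.closure_induction with
    | mem x hx =>
      obtain ⟨s, hs, rfl⟩ := hx
      exact ⟨[s], by simpa using hs, word_singleton s⟩
    | one => exact ⟨[], by simp, rfl⟩
    | mul x y _ _ hx hy =>
      obtain ⟨l, hl, rfl⟩ := hx
      obtain ⟨l', hl', rfl⟩ := hy
      refine ⟨l ++ l', fun s hs => ?_, word_append l l'⟩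
      rcases List.mem_append.1 hs with h | h
      · exact hl s h
      · exact hl' s h
  · rintro ⟨l, hl, rfl⟩
    refine Submonoid.list_prod_mem _ fun x hx => ?_
    obtain ⟨s, hs, rfl⟩ := List.mem_map.1 hx
    exact Submonoid.subset_closure ⟨s, hl s hs, rfl⟩

theorem posMonOn_univ : posMonOn M Set.univ = posMon M := by
  rw [posMonOn, posMon, Set.image_univ]

theorem mem_posMon {b : Artin M} : b ∈ posMon M ↔ ∃ l, word M l = b := by
  rw [← posMonOn_univ, mem_posMonOn]; simp

theorem word_mem (l : List B) : word M l ∈ posMon M := mem_posMon.2 ⟨l, rfl⟩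

theorem gen_mem (i : B) : gen M i ∈ posMon M := Submonoid.subset_closure ⟨i, rfl⟩

theorem gen_mem_on {Z : Set B} {i : B} (h : i ∈ Z) : gen M i ∈ posMonOn M Z :=
  Submonoid.subset_closure ⟨i, h, rfl⟩

theorem posMonOn_mono {Z Z' : Set B} (h : Z ⊆ Z') : posMonOn M Z ≤ posMonOn M Z' :=
  Submonoid.closure_mono (Set.image_mono h)

theorem posMonOn_le (Z : Set B) : posMonOn M Z ≤ posMon M :=
  posMonOn_univ (M := M) ▸ posMonOn_mono (Set.subset_univ Z)

theorem length_altList (s t : B) (n : ℕ) : (altList s t n).length = n := by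
  induction n generalizing s t with
  | zero => rfl
  | succ n ih => rw [altList, List.length_cons, ih]

theorem mem_altList {s t x : B} {n : ℕ} (h : x ∈ altList s t n) : x = s ∨ x = t := by
  induction n generalizing s t with
  | zero => simp [altList] at h
  | succ n ih =>
    rcases List.mem_cons.1 h with h | h
    · exact .inl h
    · exact (ih h).symm

theorem altList_add (s t : B) (m n : ℕ) : ∃ l, altList s t (m + n) = altList s t m ++ l := by
  induction m generalizing s t with
  | zero => exact ⟨_, by rw [zero_add, altList, List.nil_append]⟩
  | succ m ih =>
    obtain ⟨l, hl⟩ := ih t s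
    exact ⟨l, by rw [Nat.succ_add, altList, hl, altList, List.cons_append]⟩

section Degree

variable (M) in
/-- The length homomorphism on the Artin-Tits group. -/
def degHom : Artin M →* Multiplicative ℤ :=
  PresentedGroup.toGroup (rels := braidRels M) (f := fun _ => Multiplicative.ofAdd (1 : ℤ)) (by
    rintro r ⟨s, t, -, -, rfl⟩
    have key : ∀ l : List B, FreeGroup.lift (fun _ => Multiplicative.ofAdd (1 : ℤ))
        ((l.map FreeGroup.of).prod) = Multiplicative.ofAdd (1 : ℤ) ^ l.length := by
      intro l
      rw [map_list_prod, List.map_map]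
      simp [Function.comp_def]
    rw [map_mul, map_inv, key, key, length_altList, length_altList, mul_inv_cancel])

/-- The degree of an element of the Artin-Tits group. -/
def deg (g : Artin M) : ℤ := (degHom M g).toAdd

theorem deg_mul (g h : Artin M) : deg (g * h) = deg g + deg h := by
  rw [deg, map_mul]; rfl

theorem deg_one : deg (1 : Artin M) = 0 := by rw [deg, map_one]; rfl

theorem deg_gen (i : B) : deg (gen M i) = 1 := by
  have : degHom M (gen M i) = Multiplicative.ofAdd (1 : ℤ) := PresentedGroup.toGroup.of _
  rw [deg, this]; rfl

theorem deg_word (l : List B) : deg (word M l) = l.length := by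
  induction l with
  | nil => rw [word_nil, deg_one]; rfl
  | cons i l ih => rw [word_cons, deg_mul, deg_gen, ih, List.length_cons]; push_cast; ring

theorem deg_nonneg {g : Artin M} (h : g ∈ posMon M) : 0 ≤ deg g := by
  obtain ⟨l, rfl⟩ := mem_posMon.1 h
  rw [deg_word]; omega

theorem eq_one_of_deg {g : Artin M} (h : g ∈ posMon M) (hd : deg g ≤ 0) : g = 1 := by
  obtain ⟨l, rfl⟩ := mem_posMon.1 h
  rw [deg_word] at hd
  have : l = [] := List.length_eq_zero_iff.1 (by omega)
  rw [this, word_nil]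

theorem exists_gen_mul {g : Artin M} (h : g ∈ posMon M) (hd : g ≠ 1) :
    ∃ s, ∃ c ∈ posMon M, g = gen M s * c := by
  obtain ⟨l, rfl⟩ := mem_posMon.1 h
  cases l with
  | nil => exact absurd rfl hd
  | cons s l => exact ⟨s, _, word_mem l, word_cons s l⟩

end Degree

section Reverse

theorem altList_reverse (s t : B) (n : ℕ) :
    (altList s t n).reverse = if Even n then altList t s n else altList s t n := by
  induction n generalizing s t with
  | zero => simp [altList]
  | succ n ih =>
    conv_lhs => rw [altList_succ_right, List.reverse_append, ih]
    by_cases h : Even n <;> simp only [Nat.even_add_one, h, if_true, if_false, not_true,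
      not_false_iff, List.reverse_singleton, List.singleton_append, altList]

variable (M) in
/-- The reversal homomorphism into the opposite group. -/
def revHom : Artin M →* (Artin M)ᵐᵒᵖ :=
  PresentedGroup.toGroup (rels := braidRels M) (f := fun i => MulOpposite.op (gen M i)) (by
    rintro r ⟨s, t, hst, hm, rfl⟩
    have key : ∀ l : List B, FreeGroup.lift (fun i => MulOpposite.op (gen M i))
        ((l.map FreeGroup.of).prod) = MulOpposite.op (word M l.reverse) := by
      intro l
      induction l with
      | nil => simp [word_nil]
      | cons i l ih =>
        rw [List.map_cons, List.prod_cons, map_mul, ih, List.reverse_cons, word_append,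
          word_singleton]
        simp
    rw [map_mul, map_inv, key, key, mul_inv_eq_one, altList_reverse, altList_reverse]
    split_ifs
    · rw [word_altList hst hm]
    · rw [word_altList hst hm])

/-- The anti-automorphism fixing the generators. -/
def rev (g : Artin M) : Artin M := (revHom M g).unop

theorem rev_mul (g h : Artin M) : rev (g * h) = rev h * rev g := by
  rw [rev, map_mul]; rfl

theorem rev_one : rev (1 : Artin M) = 1 := by rw [rev, map_one]; rfl

theorem rev_gen (i : B) : rev (gen M i) = gen M i := by
  have : revHom M (gen M i) = MulOpposite.op (gen M i) := PresentedGroup.toGroup.of _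
  rw [rev, this]; rfl

theorem rev_word (l : List B) : rev (word M l) = word M l.reverse := by
  induction l with
  | nil => exact rev_one
  | cons i l ih =>
    rw [word_cons, rev_mul, ih, rev_gen, List.reverse_cons, word_append, word_singleton]

theorem rev_rev_of_mem {g : Artin M} (h : g ∈ posMon M) : rev (rev g) = g := by
  obtain ⟨l, rfl⟩ := mem_posMon.1 h
  rw [rev_word, rev_word, List.reverse_reverse]

theorem rev_mem_on {Z : Set B} {g : Artin M} (h : g ∈ posMonOn M Z) : rev g ∈ posMonOn M Z := by
  obtain ⟨l, hl, rfl⟩ := mem_posMonOn.1 h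
  rw [rev_word]
  exact mem_posMonOn.2 ⟨_, fun s hs => hl s (List.mem_reverse.1 hs), rfl⟩

theorem rev_mem {g : Artin M} (h : g ∈ posMon M) : rev g ∈ posMon M := by
  rw [← posMonOn_univ] at h ⊢
  exact rev_mem_on h

theorem deg_rev {g : Artin M} (h : g ∈ posMon M) : deg (rev g) = deg g := by
  obtain ⟨l, rfl⟩ := mem_posMon.1 h
  rw [rev_word, deg_word, deg_word, List.length_reverse]

end Reverse

section Divisibility

theorem ldvd.trans {a b c : Artin M} (h : ldvd M a b) (h' : ldvd M b c) : ldvd M a c := by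
  obtain ⟨x, hx, rfl⟩ := h
  obtain ⟨y, hy, rfl⟩ := h'
  exact ⟨x * y, mul_mem hx hy, (mul_assoc _ _ _).symm⟩

theorem ldvd_refl (a : Artin M) : ldvd M a a := ⟨1, one_mem _, mul_one a⟩

theorem ldvd_mul_right (a : Artin M) {b : Artin M} (hb : b ∈ posMon M) : ldvd M a (a * b) :=
  ⟨b, hb, rfl⟩

theorem ldvd.mul_left {a b : Artin M} (h : ldvd M a b) (c : Artin M) :
    ldvd M (c * a) (c * b) := by
  obtain ⟨x, hx, rfl⟩ := h
  exact ⟨x, hx, mul_assoc _ _ _⟩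

theorem ldvd_mul_left_iff {a b c : Artin M} : ldvd M (c * a) (c * b) ↔ ldvd M a b := by
  refine ⟨fun ⟨x, hx, h⟩ => ⟨x, hx, ?_⟩, fun h => h.mul_left c⟩
  rwa [mul_assoc, mul_right_inj] at h

theorem one_ldvd {a : Artin M} (h : a ∈ posMon M) : ldvd M 1 a := ⟨a, h, one_mul a⟩

theorem ldvd.deg_le {a b : Artin M} (h : ldvd M a b) : deg a ≤ deg b := by
  obtain ⟨x, hx, rfl⟩ := h
  have := deg_nonneg hx
  rw [deg_mul]; omega

theorem ldvd.eq_of_deg {a b : Artin M} (h : ldvd M a b) (hd : deg b ≤ deg a) : a = b := by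
  obtain ⟨x, hx, rfl⟩ := h
  rw [deg_mul] at hd
  rw [eq_one_of_deg hx (by omega), mul_one]

theorem ldvd.mem {a b : Artin M} (h : ldvd M a b) (ha : a ∈ posMon M) : b ∈ posMon M := by
  obtain ⟨x, hx, rfl⟩ := h
  exact mul_mem ha hx

theorem gen_ldvd_word_cons (i : B) (l : List B) : ldvd M (gen M i) (word M (i :: l)) :=
  ⟨_, word_mem l, (word_cons i l).symm⟩

theorem exists_word_of_ldvd {i : B} {g : Artin M} (h : ldvd M (gen M i) g) :
    ∃ l, g = word M (i :: l) := by
  obtain ⟨c, hc, rfl⟩ := h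
  obtain ⟨l, rfl⟩ := mem_posMon.1 hc
  exact ⟨l, (word_cons i l).symm⟩

end Divisibility

end

section

variable {B : Type*} {M : CoxeterMatrix B}

theorem exists_alt_prefix [Fintype B] [DecidableEq B] {N : ℕ} {i j : B} {l : List B}
    (hl : l.length < N) (hj : ldvd M (gen M j) (word M l)) :
    (M i j ≠ 0 ∧ ldvd M (word M (altList j i (M i j))) (word M l)) ∨
    ∃ k l', 1 ≤ k ∧ k < Unfold.entry M N i j ∧ l'.length < l.length ∧
      word M l = word M (altList j i k ++ l') ∧
      ¬ ldvd M (gen M (if Even k then j else i)) (word M l') := by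
  classical
  set Q : ℕ → Prop := fun k => ∃ l', word M l = word M (altList j i k ++ l') with hQ
  have hlen : ∀ k l', word M l = word M (altList j i k ++ l') → l.length = k + l'.length := by
    intro k l' h
    have := congrArg deg h
    rw [deg_word, deg_word, List.length_append, length_altList] at this
    omega
  have h1 : Q 1 := exists_word_of_ldvd hj
  have hl1 : 1 ≤ l.length := by
    obtain ⟨l', h⟩ := h1
    have := hlen 1 l' h
    omega
  set k := Nat.findGreatest Q l.length with hk
  have hQk : Q k := Nat.findGreatest_spec hl1 h1
  have hk1 : 1 ≤ k := Nat.le_findGreatest hl1 h1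
  have hmax : ∀ m, k < m → ¬ Q m := by
    intro m hm h
    obtain ⟨l', h'⟩ := h
    have := hlen m l' h'
    exact Nat.findGreatest_is_greatest hm (by omega) ⟨l', h'⟩
  obtain ⟨l', hl'⟩ := hQk
  have hkl := hlen k l' hl'
  by_cases hm : M i j ≠ 0 ∧ M i j ≤ k
  · refine .inl ⟨hm.1, ?_⟩
    obtain ⟨r, hr⟩ := altList_add j i (M i j) (k - M i j)
    rw [Nat.add_sub_cancel' hm.2] at hr
    rw [hl', hr, List.append_assoc, word_append]
    exact ldvd_mul_right _ (word_mem _)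
  · refine .inr ⟨k, l', hk1, ?_, by omega, hl', fun h => ?_⟩
    · rw [Unfold.entry]
      split_ifs with h0
      · omega
      · by_contra hcon
        exact hm ⟨h0, by omega⟩
    · obtain ⟨l'', hl''⟩ := exists_word_of_ldvd h
      refine hmax (k + 1) (by omega) ⟨l'', ?_⟩
      rw [hl', altList_succ_right, List.append_assoc, word_append, hl'', ← word_append]
      rfl

namespace Unfold

open SmallType

variable [Fintype B] [DecidableEq B] {N : ℕ}

theorem Rel.not_of_ldvd {i : B} {l : List B} (h : ldvd M (gen M i) (word M l)) (p : Sheet M N)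
    (γ : B × Sheet M N → ℤ) : ¬ Rel M N l (sroot (i, p)) γ := by
  obtain ⟨l', hl'⟩ := exists_word_of_ldvd h
  exact fun hr => Rel.not_sroot p γ (Rel.congr hl' (IsRoot.simple _) hr)

theorem exists_rel {i : B} {l : List B} (hl : l.length < N)
    (h : ¬ ldvd M (gen M i) (word M l)) (p : Sheet M N) :
    ∃ γ, Rel M N l (sroot (i, p)) γ := by
  induction hn : l.length using Nat.strong_induction_on generalizing l i p with
  | _ n ih =>
    subst hn
    cases l with
    | nil => exact ⟨_, rfl⟩
    | cons j l =>
      have hij : i ≠ j := by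
        rintro rfl
        exact h (gen_ldvd_word_cons i l)
      rcases exists_alt_prefix (i := i) hl (gen_ldvd_word_cons j l) with
        ⟨hm, hd⟩ | ⟨k, l', hk1, hk, hl', he, hd⟩
      · rw [← word_altList hij hm] at hd
        refine absurd (ldvd.trans ?_ hd) h
        obtain ⟨m, hm'⟩ := Nat.exists_eq_succ_of_ne_zero hm
        rw [hm', altList]
        exact gen_ldvd_word_cons _ _
      · obtain ⟨q, hq⟩ := exists_rel_altList hij hk hk1 p
        obtain ⟨γ, hγ⟩ := ih _ hl' (by omega) hd q rfl
        exact ⟨γ, Rel.congr he.symm (IsRoot.simple _) (Rel.append_iff.2 ⟨_, hq, hγ⟩)⟩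

variable (M N) in
theorem exists_sheet : Nonempty (Sheet M N) := ⟨fun e => ⟨0, width_pos M N e⟩⟩

end Unfold

section Lcm

variable [Finite B]

theorem ldvd_altList {i j : B} (hij : i ≠ j) {b : Artin M} (hb : b ∈ posMon M)
    (hi : ldvd M (gen M i) b) (hj : ldvd M (gen M j) b) :
    M i j ≠ 0 ∧ ldvd M (word M (altList i j (M i j))) b := by
  cases nonempty_fintype B
  classical
  obtain ⟨l, rfl⟩ := mem_posMon.1 hb
  rcases exists_alt_prefix (i := i) (Nat.lt_succ_self l.length) hj with
    ⟨hm, hd⟩ | ⟨k, l', hk1, hk, hl', he, hd⟩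
  · exact ⟨hm, by rwa [word_altList hij hm]⟩
  · exfalso
    obtain ⟨p⟩ := Unfold.exists_sheet M l.length.succ
    obtain ⟨q, hq⟩ := Unfold.exists_rel_altList hij hk hk1 p
    obtain ⟨γ, hγ⟩ := Unfold.exists_rel (by omega) hd q
    exact Unfold.Rel.not_of_ldvd hi p γ (Unfold.Rel.congr he.symm (SmallType.IsRoot.simple _)
      (Unfold.Rel.append_iff.2 ⟨_, hq, hγ⟩))

theorem two_le_of_ne {i j : B} (hij : i ≠ j) (hm : M i j ≠ 0) : 2 ≤ M i j := by
  have := M.off_diagonal i j hij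
  omega

theorem gen_injective : Function.Injective (gen M) := by
  intro i j h
  by_contra hij
  have hj : ldvd M (gen M j) (gen M i) := by rw [h]; exact ldvd_refl _
  obtain ⟨hm, hd⟩ := ldvd_altList hij (gen_mem i) (ldvd_refl _) hj
  have := hd.deg_le
  rw [deg_word, length_altList, deg_gen] at this
  have := two_le_of_ne hij hm
  omega

/-- Factoring the first letter out of a common multiple of two generators. -/
theorem ldvd_altList_tail {i j : B} (hij : i ≠ j) {b : Artin M} (hb : b ∈ posMon M)
    (hj : ldvd M (gen M j) (gen M i * b)) :
    M i j ≠ 0 ∧ ldvd M (word M (altList j i (M i j - 1))) b := by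
  obtain ⟨hm, hd⟩ := ldvd_altList hij (mul_mem (gen_mem i) hb) (ldvd_mul_right _ hb) hj
  refine ⟨hm, ?_⟩
  obtain ⟨m, hm'⟩ := Nat.exists_eq_succ_of_ne_zero hm
  rw [hm', altList, word_cons, ldvd_mul_left_iff] at hd
  rwa [hm', Nat.succ_eq_add_one, Nat.add_sub_cancel]

theorem mem_of_gen_ldvd_word {Z : Set B} {s : B} {l : List B} (hl : ∀ x ∈ l, x ∈ Z)
    {c : Artin M} (hc : c ∈ posMon M) (h : gen M s * c = word M l) :
    s ∈ Z ∧ c ∈ posMonOn M Z := by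
  induction hn : l.length using Nat.strong_induction_on generalizing l s c with
  | _ n ih =>
    subst hn
    cases l with
    | nil =>
      have := congrArg deg h
      rw [deg_mul, deg_gen, deg_word] at this
      have := deg_nonneg hc
      simp at *
      omega
    | cons j l =>
      by_cases hsj : j = s
      · subst hsj
        rw [word_cons, mul_right_inj] at h
        subst h
        exact ⟨hl j (by simp), mem_posMonOn.2 ⟨l, fun x hx => hl x (by simp [hx]), rfl⟩⟩
      · have hsl : ldvd M (gen M s) (gen M j * word M l) := ⟨c, hc, by rw [h, word_cons]⟩
        obtain ⟨hm, d, hd, he⟩ := ldvd_altList_tail hsj (word_mem l) hsl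
        have hm2 := two_le_of_ne hsj hm
        have key : ∀ u : List B, ∀ l1 : List B, (∀ x ∈ l1, x ∈ Z) → l1.length < (j :: l).length →
            word M u * d = word M l1 → (∀ x ∈ u, x ∈ Z) ∧ d ∈ posMonOn M Z := by
          intro u
          induction u with
          | nil =>
            intro l1 h1 _ h2
            rw [word_nil, one_mul] at h2
            exact ⟨by simp, mem_posMonOn.2 ⟨l1, h1, h2.symm⟩⟩
          | cons x u ihu =>
            intro l1 h1 h2 h3
            rw [word_cons, mul_assoc] at h3
            obtain ⟨hx, hx'⟩ := ih _ h2 h1 (mul_mem (word_mem u) hd) h3 rfl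
            obtain ⟨l2, hl2, he2⟩ := mem_posMonOn.1 hx'
            have hlen : l2.length < (j :: l).length := by
              have := congrArg deg h3
              rw [← he2, deg_mul, deg_gen, deg_word, deg_word] at this
              omega
            obtain ⟨h4, h5⟩ := ihu l2 hl2 hlen he2.symm
            exact ⟨by simpa using ⟨hx, h4⟩, h5⟩
        obtain ⟨h1, h2⟩ := key _ l (fun x hx => hl x (by simp [hx])) (by simp) he
        have hjZ := hl j (by simp)
        have hs : s ∈ Z := by
          refine h1 s ?_
          obtain ⟨m, hm'⟩ : ∃ m, M j s - 1 = m + 1 := ⟨M j s - 2, by omega⟩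
          rw [hm', altList]; simp
        refine ⟨hs, ?_⟩
        have h3 : c = word M (altList j s (M j s - 1)) * d := by
          have hmm : M j s = (M j s - 1) + 1 := by omega
          have hb := word_altList hsj hm
          rw [hmm, altList, altList, word_cons, word_cons] at hb
          rw [word_cons, ← he, ← mul_assoc, hb, mul_assoc, mul_right_inj] at h
          exact h
        rw [h3]
        refine mul_mem (mem_posMonOn.2 ⟨_, fun x hx => ?_, rfl⟩) h2
        rcases mem_altList hx with rfl | rfl
        · exact hjZ
        · exact hs

theorem mem_of_mul_mem {Z : Set B} {a c : Artin M} (ha : a ∈ posMon M) (hc : c ∈ posMon M)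
    (h : a * c ∈ posMonOn M Z) : a ∈ posMonOn M Z ∧ c ∈ posMonOn M Z := by
  obtain ⟨u, rfl⟩ := mem_posMon.1 ha
  induction u with
  | nil => rw [word_nil, one_mul] at h; exact ⟨one_mem _, h⟩
  | cons x u ih =>
    rw [word_cons, mul_assoc] at h
    obtain ⟨l, hl, he⟩ := mem_posMonOn.1 h
    obtain ⟨h1, h2⟩ := mem_of_gen_ldvd_word hl (mul_mem (word_mem u) hc) he.symm
    obtain ⟨h3, h4⟩ := ih (word_mem u) h2
    exact ⟨word_cons (M := M) x u ▸ mul_mem (gen_mem_on h1) h3, h4⟩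

theorem mem_of_gen_ldvd {Z : Set B} {s : B} {b : Artin M} (hb : b ∈ posMonOn M Z)
    (h : ldvd M (gen M s) b) : s ∈ Z := by
  obtain ⟨l, hl, rfl⟩ := mem_posMonOn.1 hb
  obtain ⟨c, hc, h⟩ := h
  exact (mem_of_gen_ldvd_word hl hc h).1

end Lcm

end

section

variable {B : Type*} {M : CoxeterMatrix B} [Finite B]

theorem exists_lcm {a b e : Artin M} (ha : a ∈ posMon M) (hb : b ∈ posMon M)
    (hae : ldvd M a e) (hbe : ldvd M b e) :
    ∃ L, ldvd M a L ∧ ldvd M b L ∧ (∀ m, ldvd M a m → ldvd M b m → ldvd M L m) ∧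
      ∀ Z, a ∈ posMonOn M Z → b ∈ posMonOn M Z → L ∈ posMonOn M Z := by
  obtain ⟨n, hn⟩ : ∃ n : ℕ, deg e ≤ n := ⟨(deg e).toNat, Int.self_le_toNat _⟩
  induction n using Nat.strong_induction_on generalizing a b e with
  | _ n ih =>
    have he := hae.mem ha
    by_cases hna : a = 1
    · subst hna
      exact ⟨b, one_ldvd hb, ldvd_refl b, fun m _ h => h, fun Z _ h => h⟩
    by_cases hnb : b = 1
    · subst hnb
      exact ⟨a, ldvd_refl a, one_ldvd ha, fun m h _ => h, fun Z h _ => h⟩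
    obtain ⟨s, a1, ha1, rfl⟩ := exists_gen_mul ha hna
    obtain ⟨t, b1, hb1, rfl⟩ := exists_gen_mul hb hnb
    have hs : ldvd M (gen M s) e := (ldvd_mul_right _ ha1).trans hae
    have ht : ldvd M (gen M t) e := (ldvd_mul_right _ hb1).trans hbe
    have hpos : 0 < n := by
      have := hs.deg_le
      rw [deg_gen] at this
      omega
    -- the case of two elements with a common first letter
    have same : ∀ {s : B} {x y e : Artin M}, x ∈ posMon M → y ∈ posMon M → deg e ≤ n →
        ldvd M (gen M s * x) e → ldvd M (gen M s * y) e →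
        ∃ L, ldvd M (gen M s * x) L ∧ ldvd M (gen M s * y) L ∧
          (∀ m, ldvd M (gen M s * x) m → ldvd M (gen M s * y) m → ldvd M L m) ∧
          ∀ Z, gen M s * x ∈ posMonOn M Z → gen M s * y ∈ posMonOn M Z → L ∈ posMonOn M Z := by
      intro s x y e hx hy hn hxe hye
      obtain ⟨c, hc, rfl⟩ := (ldvd_mul_right (gen M s) hx).trans hxe
      rw [ldvd_mul_left_iff] at hxe hye
      rw [deg_mul, deg_gen] at hn
      obtain ⟨L, h1, h2, h3, h4⟩ := ih (n - 1) (by omega) hx hy hxe hye (by omega)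
      refine ⟨gen M s * L, h1.mul_left _, h2.mul_left _, fun m hxm hym => ?_, fun Z hxZ hyZ => ?_⟩
      · obtain ⟨d, hd, rfl⟩ := (ldvd_mul_right (gen M s) hx).trans hxm
        rw [ldvd_mul_left_iff] at hxm hym ⊢
        exact h3 _ hxm hym
      · have hx' := mem_of_mul_mem (gen_mem s) hx hxZ
        have hy' := mem_of_mul_mem (gen_mem s) hy hyZ
        exact mul_mem hx'.1 (h4 Z hx'.2 hy'.2)
    by_cases hst : s = t
    · subst hst
      exact same ha1 hb1 hn hae hbe
    obtain ⟨hm, hD⟩ := ldvd_altList hst he hs ht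
    obtain ⟨m, hm'⟩ := Nat.exists_eq_succ_of_ne_zero hm
    have hD' : word M (altList s t (M s t)) = gen M s * word M (altList t s m) := by
      rw [hm', altList, word_cons]
    have hD'' : word M (altList s t (M s t)) = gen M t * word M (altList s t m) := by
      rw [word_altList hst hm, hm', altList, word_cons]
    have hDm : ∀ m, ldvd M (gen M s) m → ldvd M (gen M t) m →
        ldvd M (word M (altList s t (M s t))) m :=
      fun m h1 h2 => (ldvd_altList hst (h1.mem (gen_mem s)) h1 h2).2
    obtain ⟨A, hA1, hA2, hA3, hA4⟩ := same ha1 (word_mem _) hn hae (hD' ▸ hD)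
    obtain ⟨A', hA1', hA2', hA3', hA4'⟩ := same hb1 (word_mem _) hn hbe (hD'' ▸ hD)
    rw [← hD'] at hA2 hA3 hA4
    rw [← hD''] at hA2' hA3' hA4'
    have hAe := hA3 _ hae hD
    have hAe' := hA3' _ hbe hD
    have hsD : ldvd M (gen M s) (word M (altList s t (M s t))) := by
      rw [hD']
      exact ldvd_mul_right _ (word_mem _)
    have hsA := hsD.trans hA2
    have hsA' := hsD.trans hA2'
    obtain ⟨x, hx, rfl⟩ := hsA
    obtain ⟨y, hy, rfl⟩ := hsA'
    obtain ⟨L, hL1, hL2, hL3, hL4⟩ := same hx hy hn hAe hAe'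
    refine ⟨L, hA1.trans hL1, hA1'.trans hL2, fun m h1 h2 => ?_, fun Z h1 h2 => ?_⟩
    · have := hDm m ((ldvd_mul_right _ ha1).trans h1) ((ldvd_mul_right _ hb1).trans h2)
      exact hL3 m (hA3 m h1 this) (hA3' m h2 this)
    · have hsZ := mem_of_gen_ldvd h1 (ldvd_mul_right _ ha1)
      have htZ := mem_of_gen_ldvd h2 (ldvd_mul_right _ hb1)
      have : word M (altList s t (M s t)) ∈ posMonOn M Z :=
        mem_posMonOn.2 ⟨_, fun x hx => by rcases mem_altList hx with rfl | rfl <;> assumption, rfl⟩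
      exact hL4 Z (hA4 Z h1 this) (hA4' Z h2 this)

theorem exists_lcm_gens {Z : Set B} {e : Artin M} (he : e ∈ posMon M)
    (h : ∀ s ∈ Z, ldvd M (gen M s) e) :
    ∃ L ∈ posMonOn M Z, (∀ s ∈ Z, ldvd M (gen M s) L) ∧
      ∀ m ∈ posMon M, (∀ s ∈ Z, ldvd M (gen M s) m) → ldvd M L m := by
  induction Z, Set.toFinite Z using Set.Finite.induction_on with
  | empty => exact ⟨1, one_mem _, by simp, fun m hm _ => one_ldvd hm⟩
  | @insert t Z _ _ ih =>
    obtain ⟨L, hL, h1, h2⟩ := ih fun s hs => h s (.inr hs)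
    have hLe := h2 e he fun s hs => h s (.inr hs)
    obtain ⟨K, k1, k2, k3, k4⟩ :=
      exists_lcm (gen_mem t) (posMonOn_le _ hL) (h t (.inl rfl)) hLe
    refine ⟨K, k4 _ (gen_mem_on (.inl rfl)) (posMonOn_mono (Set.subset_insert _ _) hL), ?_, ?_⟩
    · rintro s (rfl | hs)
      · exact k1
      · exact (h1 s hs).trans k2
    · exact fun m hm hs => k3 m (hs t (.inl rfl)) (h2 m hm fun s hsZ => hs s (.inr hsZ))

theorem exists_isDelta {Z : Set B} {e : Artin M} (he : e ∈ posMon M)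
    (h : ∀ s ∈ Z, ldvd M (gen M s) e) : ∃ d, IsDelta M Z d := by
  obtain ⟨L, hL, h1, h2⟩ := exists_lcm_gens he h
  refine ⟨L, hL, fun s hs => ?_, fun m hm hs => ?_⟩
  · obtain ⟨c, hc, rfl⟩ := h1 s hs
    exact ⟨c, (mem_of_mul_mem (gen_mem s) hc hL).2, rfl⟩
  · obtain ⟨c, hc, rfl⟩ := h2 m (posMonOn_le _ hm) fun s hs' => by
      obtain ⟨c, hc, h⟩ := hs s hs'
      exact ⟨c, posMonOn_le _ hc, h⟩
    exact ⟨c, (mem_of_mul_mem (posMonOn_le _ hL) hc hm).2, rfl⟩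

theorem IsDelta.mem {Z : Set B} {d : Artin M} (h : IsDelta M Z d) : d ∈ posMon M :=
  posMonOn_le _ h.1

theorem IsDelta.gen_ldvd {Z : Set B} {d : Artin M} (h : IsDelta M Z d) {s : B} (hs : s ∈ Z) :
    ldvd M (gen M s) d := by
  obtain ⟨c, hc, h⟩ := h.2.1 s hs
  exact ⟨c, posMonOn_le _ hc, h⟩

theorem IsDelta.ldvd_of {Z : Set B} {d m : Artin M} (hd : IsDelta M Z d) (hm : m ∈ posMon M)
    (h : ∀ s ∈ Z, ldvd M (gen M s) m) : ldvd M d m := by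
  obtain ⟨L, hL, h1, h2⟩ := exists_lcm_gens hm h
  refine ldvd.trans ?_ (h2 m hm h)
  obtain ⟨c, hc, he⟩ := hd.2.2 L hL fun s hs => by
    obtain ⟨c, hc, rfl⟩ := h1 s hs
    exact ⟨c, (mem_of_mul_mem (gen_mem s) hc hL).2, rfl⟩
  exact ⟨c, posMonOn_le _ hc, he⟩

end

section

variable {B : Type*} {M : CoxeterMatrix B}

namespace Unfold

open SmallType

variable [Fintype B] [DecidableEq B] {N : ℕ}

/-- No root supported over `Z` survives an element divisible by all of `Z`. -/
theorem Rel.not_of_support {Z : Set B} {l : List B} (h : ∀ s ∈ Z, ldvd M (gen M s) (word M l))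
    {β : B × Sheet M N → ℤ} (hβ : IsRoot (graph M N) β) (hs : ∀ v, v.1 ∉ Z → β v = 0)
    (γ : B × Sheet M N → ℤ) : ¬ Rel M N l β γ := by
  classical
  obtain ⟨n, hn⟩ : ∃ n : ℕ, ∑ v, β v ≤ n := ⟨(∑ v, β v).toNat, Int.self_le_toNat _⟩
  induction n generalizing β with
  | zero =>
    have := hβ.sum_pos
    simp at hn
    omega
  | succ n ih =>
    intro hr
    obtain ⟨v, hv⟩ := hβ.exists_pair_pos
    have hvZ : v.1 ∈ Z := by
      by_contra hvZ
      have h0 := hs v hvZ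
      rw [pair, h0] at hv
      have : 0 ≤ ∑ j, if (graph M N).Adj v j then β j else 0 :=
        Finset.sum_nonneg fun j _ => by
          split_ifs
          · exact hβ.nonneg j
          · exact le_rfl
      omega
    obtain ⟨l', hl'⟩ := exists_word_of_ldvd (h v.1 hvZ)
    obtain ⟨h1, h2⟩ := Rel.descend hβ hv (Rel.congr hl' hβ hr)
    refine ih h1 (fun w hw => ?_) ?_ (Rel.congr hl'.symm h1 h2)
    · rw [refl_apply_ne, hs w hw]
      rintro rfl
      exact hw hvZ
    · rw [sum_refl]
      push_cast at hn
      omega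

/-- If `c` is not divisible by `s` and `a c` is divisible by all of `Z`, then `a` ends in `s`. -/
theorem gen_ldvd_reverse {Z : Set B} {l l' : List B} (hl : ∀ x ∈ l, x ∈ Z)
    (hd : ∀ s ∈ Z, ldvd M (gen M s) (word M (l ++ l'))) {s : B} (hs : s ∈ Z)
    (hc : ¬ ldvd M (gen M s) (word M l')) : ldvd M (gen M s) (word M l.reverse) := by
  by_contra ha
  obtain ⟨p⟩ := exists_sheet M ((l ++ l').length + 1)
  obtain ⟨γ, hγ⟩ := exists_rel (by simp) hc p
  obtain ⟨β, hβ⟩ := exists_rel (by simp) ha p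
  have hβr := hβ.root (IsRoot.simple _)
  have hβ' := hβ.reverse (IsRoot.simple _)
  rw [List.reverse_reverse] at hβ'
  refine Rel.not_of_support hd hβr (fun v hv => ?_) γ (Rel.append_iff.2 ⟨_, hβ', hγ⟩)
  rw [Rel.apply_eq (fun h => hv (hl _ (List.mem_reverse.1 h))) hβ, sroot_ne]
  rintro rfl
  exact hv hs

end Unfold

variable [Finite B] {Z : Set B}

theorem gen_ldvd_rev {a c : Artin M} (ha : a ∈ posMonOn M Z) (hc : c ∈ posMon M)
    (hd : ∀ s ∈ Z, ldvd M (gen M s) (a * c)) {s : B} (hs : s ∈ Z)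
    (hn : ¬ ldvd M (gen M s) c) : ldvd M (gen M s) (rev a) := by
  cases nonempty_fintype B
  classical
  obtain ⟨l, hl, rfl⟩ := mem_posMonOn.1 ha
  obtain ⟨l', rfl⟩ := mem_posMon.1 hc
  rw [rev_word]
  exact Unfold.gen_ldvd_reverse hl (by rwa [word_append]) hs hn

theorem rev_ldvd {e : Artin M} (he : e ∈ posMonOn M Z) (h : ∀ s ∈ Z, ldvd M (gen M s) e)
    {s : B} (hs : s ∈ Z) : ldvd M (gen M s) (rev e) := by
  refine gen_ldvd_rev he (one_mem _) (by rwa [mul_one]) hs fun h => ?_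
  have := h.deg_le
  rw [deg_gen, deg_one] at this
  omega

/-- A doubled letter in an element divisible by all of `Z` may be dropped. -/
theorem gen_ldvd_drop {u w : Artin M} {s : B} (hu : u ∈ posMonOn M Z) (hw : w ∈ posMonOn M Z)
    (h : ∀ z ∈ Z, ldvd M (gen M z) (u * gen M s * gen M s * w)) {z : B} (hz : z ∈ Z) :
    ldvd M (gen M z) (u * gen M s * w) := by
  cases nonempty_fintype B
  classical
  obtain ⟨l, hl, rfl⟩ := mem_posMonOn.1 hu
  obtain ⟨l', hl', rfl⟩ := mem_posMonOn.1 hw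
  have e1 : word M l * gen M s * word M l' = word M (l ++ s :: l') := by
    rw [word_append, word_cons, mul_assoc]
  have e2 : word M l * gen M s * gen M s * word M l' = word M (l ++ s :: s :: l') := by
    rw [word_append, word_cons, word_cons]; simp only [mul_assoc]
  rw [e2] at h
  rw [e1]
  by_contra hcon
  obtain ⟨p⟩ := Unfold.exists_sheet M ((l ++ s :: l').length + 1)
  obtain ⟨γ, hγ⟩ := Unfold.exists_rel (Nat.lt_succ_self _) hcon p
  obtain ⟨δ, h1, h2⟩ := Unfold.Rel.append_iff.1 hγ
  refine Unfold.Rel.not_of_support h (SmallType.IsRoot.simple (z, p)) (fun v hv => ?_) γ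
    (Unfold.Rel.append_iff.2 ⟨δ, h1, h2.loop (h1.root (SmallType.IsRoot.simple _))⟩)
  rw [SmallType.sroot_ne]
  rintro rfl
  exact hv hz

namespace IsDelta

variable {d : Artin M}

theorem rev_eq (hd : IsDelta M Z d) : rev d = d := by
  have h := hd.ldvd_of (rev_mem hd.mem) fun s hs => rev_ldvd hd.1 (fun s hs => hd.gen_ldvd hs) hs
  exact (h.eq_of_deg (deg_rev hd.mem).le).symm

theorem isSpherical (hd : IsDelta M Z d) : IsSpherical M Z := by
  classical
  set T : Set M.Group := {x | ∃ a ∈ posMon M, ldvd M a d ∧ proj M a = x} with hT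
  have hfin : T.Finite := by
    have hf := (List.finite_length_le B (deg d).toNat).image fun l => proj M (word M l)
    refine hf.subset ?_
    rintro _ ⟨a, ha, had, rfl⟩
    obtain ⟨l, rfl⟩ := mem_posMon.1 ha
    have := had.deg_le
    rw [deg_word] at this
    exact ⟨l, show l.length ≤ _ by omega, rfl⟩
  have hproj : ∀ s, proj M (gen M s) = M.simple s := fun s => PresentedGroup.toGroup.of _
  have hsq : ∀ s, M.simple s * M.simple s = 1 := fun s => by
    have := M.toCoxeterSystem.simple_mul_simple_self s
    rwa [CoxeterMatrix.toCoxeterSystem_simple] at this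
  have hmul : ∀ x ∈ T, ∀ s ∈ Z, x * M.simple s ∈ T := by
    rintro _ ⟨a, ha, ⟨c, hc, hac⟩, rfl⟩ s hs
    by_cases h : ldvd M (gen M s) c
    · obtain ⟨c', hc', rfl⟩ := h
      refine ⟨a * gen M s, mul_mem ha (gen_mem s), ⟨c', hc', by rw [← hac, mul_assoc]⟩, ?_⟩
      rw [map_mul, hproj]
    · have haZ := (mem_of_mul_mem ha hc (hac ▸ hd.1)).1
      obtain ⟨a', ha', he⟩ := gen_ldvd_rev haZ hc (by rw [hac]; exact fun s hs => hd.gen_ldvd hs)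
        hs h
      have he' := congrArg rev he
      rw [rev_mul, rev_gen, rev_rev_of_mem ha] at he'
      refine ⟨rev a', rev_mem ha', ?_, ?_⟩
      · rw [← hac, ← he', mul_assoc]
        exact ldvd_mul_right _ (mul_mem (gen_mem s) hc)
      · rw [← he', map_mul, hproj, mul_assoc, hsq, mul_one]
  have hsub : (coxSub M Z : Set M.Group) ⊆ T := by
    intro x hx
    have hx' : x ∈ Subgroup.closure (M.simple '' Z) := hx
    clear hx
    induction hx' using Subgroup.closure_induction_right with
    | one => exact ⟨1, one_mem _, one_ldvd hd.mem, map_one _⟩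
    | mul_right x _ y hy ih =>
      obtain ⟨s, hs, rfl⟩ := hy
      exact hmul x ih s hs
    | mul_inv_cancel x _ y hy ih =>
      obtain ⟨s, hs, rfl⟩ := hy
      rw [← eq_inv_of_mul_eq_one_left (hsq s)]
      exact hmul x ih s hs
  exact (hfin.subset hsub).to_subtype

theorem squarefree (hd : IsDelta M Z d) {u w : Artin M} {s : B} (hu : u ∈ posMon M)
    (hw : w ∈ posMon M) : u * gen M s * gen M s * w ≠ d := by
  intro he
  have hs := gen_mem (M := M) s
  have huw := hd.1
  rw [← he] at huw
  obtain ⟨h1, hwZ⟩ := mem_of_mul_mem (mul_mem (mul_mem hu hs) hs) hw huw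
  obtain ⟨h1, hsZ⟩ := mem_of_mul_mem (mul_mem hu hs) hs h1
  have huZ := (mem_of_mul_mem hu hs h1).1
  have h2 := fun (z : B) (hz : z ∈ Z) => gen_ldvd_drop huZ hwZ
    (fun z hz => he.symm ▸ hd.gen_ldvd hz) hz
  have := (hd.ldvd_of (mul_mem (mul_mem hu hs) hw) h2).deg_le
  rw [← he] at this
  simp only [deg_mul, deg_gen] at this
  omega

theorem exists_mul_eq (hd : IsDelta M Z d) {u r : Artin M} {l : List B} (hu : u ∈ posMon M)
    (hr : r ∈ posMon M) (he : u * word M l * r = d) : ∃ h ∈ posMon M, h * word M l = d := by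
  induction l generalizing u with
  | nil => exact ⟨d, hd.mem, by rw [word_nil, mul_one]⟩
  | cons s l ih =>
    obtain ⟨g, hg, hgd⟩ := ih (mul_mem hu (gen_mem s)) (by rwa [mul_assoc u, ← word_cons])
    have hsZ : s ∈ Z := by
      have h1 := hd.1
      rw [← he] at h1
      have h2 := (mem_of_mul_mem (mul_mem hu (word_mem _)) hr h1).1
      exact mem_of_gen_ldvd (mem_of_mul_mem hu (word_mem _) h2).2 (gen_ldvd_word_cons s l)
    have hgZ := (mem_of_mul_mem hg (word_mem l) (hgd ▸ hd.1)).1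
    by_cases hs : ldvd M (gen M s) (word M l)
    · obtain ⟨c, hc, hce⟩ := hs
      exfalso
      refine hd.squarefree (s := s) hu (mul_mem hc hr) ?_
      rw [← he, word_cons, ← hce]
      simp only [mul_assoc]
    · obtain ⟨c, hc, hce⟩ := gen_ldvd_rev hgZ (word_mem l)
        (by rw [hgd]; exact fun s hs => hd.gen_ldvd hs) hsZ hs
      have he' := congrArg rev hce
      rw [rev_mul, rev_gen, rev_rev_of_mem hg] at he'
      exact ⟨rev c, rev_mem hc, by rw [word_cons, ← mul_assoc, he', hgd]⟩

theorem exists_conj (hd : IsDelta M Z d) {z : B} (hz : z ∈ Z) :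
    ∃ s ∈ Z, d * gen M z = gen M s * d := by
  obtain ⟨c, hc, hcd⟩ := hd.gen_ldvd hz
  have hf : rev c * gen M z = d := by
    have := congrArg rev hcd
    rwa [rev_mul, rev_gen, hd.rev_eq] at this
  obtain ⟨l, hl⟩ := mem_posMon.1 (rev_mem hc)
  obtain ⟨h, hh, hhd⟩ := hd.exists_mul_eq (u := 1) (l := l) (one_mem _) (gen_mem z)
    (by rw [one_mul, hl, hf])
  have hdeg : deg h = 1 := by
    have h1 := congrArg deg hhd
    rw [← hf, hl, deg_mul, deg_mul, deg_gen] at h1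
    omega
  obtain ⟨s, c', hc', rfl⟩ := exists_gen_mul hh (by rintro rfl; rw [deg_one] at hdeg; omega)
  rw [deg_mul, deg_gen] at hdeg
  rw [eq_one_of_deg hc' (by omega), mul_one, hl] at hhd
  refine ⟨s, mem_of_gen_ldvd hd.1 ⟨_, rev_mem hc, hhd⟩, ?_⟩
  conv_lhs => rw [← hhd, mul_assoc, hf]

theorem exists_conj' (hd : IsDelta M Z d) {z : B} (hz : z ∈ Z) :
    ∃ s ∈ Z, gen M z * d = d * gen M s := by
  obtain ⟨s, hs, h⟩ := hd.exists_conj hz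
  refine ⟨s, hs, ?_⟩
  have := congrArg rev h
  rwa [rev_mul, rev_mul, rev_gen, rev_gen, hd.rev_eq] at this

theorem mul_inv_mem {t : B} {d' : Artin M} (hd : IsDelta M Z d) (hd' : IsDelta M (Z \ {t}) d') :
    d * d'⁻¹ ∈ posMon M := by
  obtain ⟨c, hc, h⟩ := hd'.ldvd_of hd.mem fun s hs => hd.gen_ldvd hs.1
  have := congrArg rev h
  rw [rev_mul, hd.rev_eq, hd'.rev_eq] at this
  rw [← this, mul_inv_cancel_right]
  exact rev_mem hc

end IsDelta

end

section

section
variable {B : Type*} {M : CoxeterMatrix B} {Z Z' : Set B} {s t a b : B}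

theorem self_mem_comp (ht : t ∈ Z) : t ∈ comp M Z t := ⟨ht, .refl⟩

theorem comp_diff_union_self (ht : t ∈ Z) : comp M Z t \ {t} ∪ {t} = comp M Z t := by
  rw [Set.sdiff_union_self, Set.union_eq_self_of_subset_right]
  exact Set.singleton_subset_iff.2 (self_mem_comp ht)

theorem mem_comp_of_adj (ha : a ∈ comp M Z t) (hb : b ∈ Z) (h : M a b ≠ 2) : b ∈ comp M Z t := by
  by_cases hab : a = b
  · rwa [← hab]
  · exact ⟨hb, ha.2.tail ⟨ha.1, hb, hab, h⟩⟩

theorem eq_two_of_mem_comp (ha : a ∈ comp M Z t) (hb : b ∈ Z) (hn : b ∉ comp M Z t) :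
    M a b = 2 := by
  by_contra h
  exact hn (mem_comp_of_adj ha hb h)

theorem comp_induction {P : B → Prop} (ht : t ∈ Z) (hP : P t)
    (hs : ∀ a ∈ comp M Z t, ∀ b ∈ comp M Z t, a ≠ b → M a b ≠ 2 → P a → P b)
    (ha : a ∈ comp M Z t) : P a := by
  obtain ⟨h1, h2⟩ := ha
  clear h1
  have key : a ∈ comp M Z t ∧ P a := by
    induction h2 with
    | refl => exact ⟨self_mem_comp ht, hP⟩
    | tail _ h ih =>
      obtain ⟨-, hc, hne, hm⟩ := h
      have := mem_comp_of_adj ih.1 hc hm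
      exact ⟨this, hs _ ih.1 _ this hne hm ih.2⟩
  exact key.2

theorem mem_comp_comp (ht : t ∈ Z) (ha : a ∈ comp M Z t) : a ∈ comp M (comp M Z t) t :=
  comp_induction (P := fun a => a ∈ comp M (comp M Z t) t) ht (self_mem_comp (self_mem_comp ht))
    (fun _ _ _ hb _ hm h => mem_comp_of_adj h hb hm) ha

theorem gen_commute (h : M a b = 2) : gen M a * gen M b = gen M b * gen M a := by
  by_cases hab : a = b
  · rw [hab]
  · have := word_altList (M := M) hab (by rw [h]; exact two_ne_zero)
    rw [h] at this
    simpa [altList, word_cons, word_nil] using this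

theorem commute_gen_of_mem {e : Artin M} (he : e ∈ posMonOn M Z) (h : ∀ b ∈ Z, M a b = 2) :
    gen M a * e = e * gen M a := by
  obtain ⟨l, hl, rfl⟩ := mem_posMonOn.1 he
  clear he
  induction l with
  | nil => rw [word_nil, mul_one, one_mul]
  | cons s l ih =>
    rw [word_cons, ← mul_assoc, gen_commute (h s (hl s (by simp))), mul_assoc,
      ih fun x hx => hl x (by simp [hx]), mul_assoc]

theorem commute_of_mem {e d : Artin M} (he : e ∈ posMonOn M Z) (hd : d ∈ posMonOn M Z')
    (h : ∀ a ∈ Z, ∀ b ∈ Z', M a b = 2) : e * d = d * e := by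
  obtain ⟨l, hl, rfl⟩ := mem_posMonOn.1 he
  clear he
  induction l with
  | nil => rw [word_nil, mul_one, one_mul]
  | cons s l ih =>
    rw [word_cons, mul_assoc, ih fun x hx => hl x (by simp [hx]), ← mul_assoc,
      commute_gen_of_mem hd (h s (hl s (by simp))), mul_assoc]

theorem exists_mul_eq_mul {e v : Artin M} (he : e ∈ posMonOn M Z)
    (h : ∀ x ∈ Z, ∃ y, gen M x * v = v * gen M y) : ∃ e' ∈ posMon M, e * v = v * e' := by
  obtain ⟨l, hl, rfl⟩ := mem_posMonOn.1 he
  clear he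
  induction l with
  | nil => exact ⟨1, one_mem _, by rw [word_nil, mul_one, one_mul]⟩
  | cons s l ih =>
    obtain ⟨e', he', hh⟩ := ih fun x hx => hl x (by simp [hx])
    obtain ⟨y, hy⟩ := h s (hl s (by simp))
    exact ⟨gen M y * e', mul_mem (gen_mem y) he', by
      rw [word_cons, mul_assoc, hh, ← mul_assoc, hy, mul_assoc]⟩

end

variable {B : Type*} {M : CoxeterMatrix B} [Finite B] {Z : Set B}

/-- If `b` is conjugated to a letter by `a v` and `m_{a,b} ≠ 2`, then `b` divides `v`. -/
theorem gen_ldvd_of_conj {a b y : B} {v : Artin M} (hab : a ≠ b) (hm : M a b ≠ 2)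
    (hv : v ∈ posMon M) (h : gen M b * (gen M a * v) = gen M a * v * gen M y) :
    ldvd M (gen M b) v := by
  have hm' : M b a ≠ 2 := by rwa [M.symmetric b a]
  obtain ⟨h0, h1⟩ := ldvd_altList_tail hab.symm (mul_mem (gen_mem a) hv)
    (show ldvd M (gen M a) (gen M b * (gen M a * v)) by
      rw [h, mul_assoc]
      exact ldvd_mul_right _ (mul_mem hv (gen_mem y)))
  have h2 := two_le_of_ne hab.symm h0
  obtain ⟨k, hk⟩ : ∃ k, M b a - 1 = k + 1 + 1 := ⟨M b a - 3, by omega⟩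
  rw [hk, altList, altList, word_cons, word_cons, ldvd_mul_left_iff] at h1
  exact (ldvd_mul_right _ (word_mem _)).trans h1

/-- Sets with common multiples can be merged when the overlap splits off. -/
theorem exists_common_multiple_union {K L : Set B} {e e' : Artin M} (he : e ∈ posMonOn M K)
    (hK : ∀ x ∈ K, ldvd M (gen M x) e) (he' : e' ∈ posMonOn M L)
    (hL : ∀ x ∈ L, ldvd M (gen M x) e') (h : ∀ a ∈ K, ∀ b ∈ L \ K, M a b = 2) :
    ∃ f ∈ posMonOn M (K ∪ L), ∀ x ∈ K ∪ L, ldvd M (gen M x) f := by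
  obtain ⟨d, hd⟩ := exists_isDelta (posMonOn_le L he') fun x (hx : x ∈ L \ K) => hL x hx.1
  refine ⟨e * d, mul_mem (posMonOn_mono Set.subset_union_left he)
    (posMonOn_mono (Set.sdiff_subset.trans Set.subset_union_right) hd.1), fun x hx => ?_⟩
  by_cases hxK : x ∈ K
  · exact (hK x hxK).trans (ldvd_mul_right _ hd.mem)
  · rw [commute_of_mem he hd.1 h]
    exact (hd.gen_ldvd ⟨hx.resolve_left hxK, hxK⟩).trans (ldvd_mul_right _ (posMonOn_le K he))

/-- If `t v` conjugates to letters the letters of a set `C` connected to `t`, then `C` has a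
common multiple. -/
theorem exists_common_multiple {C : Set B} {t : B} {v : Artin M} (ht : t ∉ C)
    (hC : ∀ x ∈ C, x ∈ comp M (C ∪ {t}) t) (hv : v ∈ posMon M)
    (h : ∀ x ∈ C, ∃ y, gen M x * (gen M t * v) = gen M t * v * gen M y) :
    ∃ e ∈ posMonOn M C, ∀ x ∈ C, ldvd M (gen M x) e := by
  obtain ⟨n, hn⟩ : ∃ n, C.ncard = n := ⟨_, rfl⟩
  induction n using Nat.strong_induction_on generalizing C t v with
  | _ n ih =>
    set C' : Set B := {x ∈ C | M x t = 2} with hC'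
    have hconj : ∀ x ∈ C', ∃ y, gen M x * v = v * gen M y := by
      rintro x ⟨hx, hxt⟩
      obtain ⟨y, hy⟩ := h x hx
      refine ⟨y, mul_left_cancel (a := gen M t) ?_⟩
      rw [← mul_assoc, ← gen_commute hxt, mul_assoc, hy, mul_assoc]
    have hD : ∀ x ∈ C \ C', ldvd M (gen M x) v := by
      rintro x ⟨hx, hx'⟩
      obtain ⟨y, hy⟩ := h x hx
      refine gen_ldvd_of_conj ?_ ?_ hv hy
      · rintro rfl
        exact ht hx
      · intro h2
        exact hx' ⟨hx, by rwa [M.symmetric x t]⟩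
    have hcover : ∀ x ∈ C', ∃ s ∈ C \ C', x ∈ comp M (C' ∪ {s}) s := by
      intro x hx
      refine comp_induction (P := fun x => x ∈ C' → ∃ s ∈ C \ C', x ∈ comp M (C' ∪ {s}) s)
        (show t ∈ C ∪ {t} from Or.inr rfl) (fun h => absurd h.1 ht) ?_ (hC x hx.1) hx
      intro a ha b _ hab hm hPa hb
      by_cases haC' : a ∈ C'
      · obtain ⟨s, hs, has⟩ := hPa haC'
        exact ⟨s, hs, mem_comp_of_adj has (Or.inl hb) hm⟩
      · rcases ha.1 with haC | rfl
        · exact ⟨a, ⟨haC, haC'⟩, mem_comp_of_adj (self_mem_comp (Or.inr rfl)) (Or.inl hb) hm⟩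
        · exact absurd (by rw [M.symmetric]; exact hb.2) hm
    have hstep : ∀ s ∈ C \ C', ∃ e ∈ posMonOn M (comp M (C' ∪ {s}) s \ {s}),
        ∀ x ∈ comp M (C' ∪ {s}) s \ {s}, ldvd M (gen M x) e := by
      intro s hs
      obtain ⟨w, hw, rfl⟩ := hD s hs
      have hsub : comp M (C' ∪ {s}) s \ {s} ⊆ C' := fun x hx => hx.1.1.resolve_right hx.2
      refine ih _ ?_ (fun h => h.2 rfl) (fun x hx => ?_) hw (fun x hx => hconj x (hsub hx)) rfl
      · rw [← hn]
        refine Set.ncard_lt_ncard ⟨fun x hx => (hsub hx).1, fun hle => ?_⟩ (Set.toFinite C)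
        exact (hle hs.1).2 rfl
      · rw [comp_diff_union_self (show s ∈ C' ∪ {s} from Or.inr rfl)]
        exact mem_comp_comp (Or.inr rfl) hx.1
    have hall : ∀ F : Set B, F ⊆ C \ C' →
        ∃ e ∈ posMonOn M (⋃ s ∈ F, comp M (C' ∪ {s}) s \ {s}),
        ∀ x ∈ ⋃ s ∈ F, comp M (C' ∪ {s}) s \ {s}, ldvd M (gen M x) e := by
      intro F
      induction F, Set.toFinite F using Set.Finite.induction_on with
      | empty => exact fun _ => ⟨1, one_mem _, by simp⟩
      | @insert s F _ _ ihF =>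
        intro hF
        obtain ⟨e', he', hL⟩ := ihF ((Set.subset_insert _ _).trans hF)
        have hs := hF (Set.mem_insert s F)
        obtain ⟨e, he, hK⟩ := hstep s hs
        rw [Set.biUnion_insert]
        refine exists_common_multiple_union he hK he' hL fun a ha b hb => ?_
        obtain ⟨hb1, hb2⟩ := hb
        simp only [Set.mem_iUnion] at hb1
        obtain ⟨r, _, hbr⟩ := hb1
        have hbC := hbr.1.1.resolve_right hbr.2
        refine eq_two_of_mem_comp ha.1 (Or.inl hbC) fun h => hb2 ⟨h, ?_⟩
        rintro rfl
        exact hs.2 hbC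
    obtain ⟨e, he, hx⟩ := hall _ subset_rfl
    have he' : e ∈ posMonOn M C' := by
      refine posMonOn_mono (Set.iUnion₂_subset fun s _ x hx => ?_) he
      exact hx.1.1.resolve_right hx.2
    obtain ⟨f, hf, hef⟩ := exists_mul_eq_mul he' hconj
    obtain ⟨d, hd⟩ := exists_isDelta (Z := C) (mul_mem (posMonOn_le _ he') hv) fun x hxC => by
      by_cases hxC' : x ∈ C'
      · obtain ⟨s, hs, hxs⟩ := hcover x hxC'
        refine (hx x ?_).trans (ldvd_mul_right _ hv)
        simp only [Set.mem_iUnion]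
        refine ⟨s, hs, hxs, ?_⟩
        rintro rfl
        exact hs.2 hxC'
      · rw [hef]
        exact (hD x ⟨hxC, hxC'⟩).trans (ldvd_mul_right _ hf)
    exact ⟨d, hd.1, fun x hx => hd.gen_ldvd hx⟩

end

section

section
variable {B : Type*} {M : CoxeterMatrix B} {X Y Z : Set B} {f g : Artin M}

theorem rightMul_mul (X : Set B) (f g : Artin M) :
    rightMul M X (g * f) = (g * ·) '' rightMul M X f := by
  simp only [rightMul, Set.image_image, mul_assoc]

theorem leftMul_mul (X : Set B) (f g : Artin M) :
    leftMul M X (g * f) = (· * f) '' leftMul M X g := by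
  simp only [leftMul, Set.image_image, mul_assoc]

theorem image_mul_rightMul (X : Set B) (f g : Artin M) :
    (· * f) '' rightMul M X g = (g * ·) '' leftMul M X f := by
  simp only [leftMul, rightMul, Set.image_image, mul_assoc]

theorem IsRibbon.cons_left {d : Artin M} (h : IsElemRibbon M X Y d) (hg : IsRibbon M Y Z g) :
    IsRibbon M X Z (g * d) := by
  induction hg with
  | nil =>
    have := IsRibbon.cons (IsRibbon.nil X) h
    rwa [mul_one, ← one_mul d] at this
  | cons _ h2 ih => rw [mul_assoc]; exact ih.cons h2

theorem leftMul_eq_rightMul (h : ∀ x ∈ X, ∃ a ∈ Z, f * gen M x = gen M a * f) :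
    leftMul M {a ∈ Z | ∃ x ∈ X, f * gen M x = gen M a * f} f = rightMul M X f := by
  ext u
  constructor
  · rintro ⟨a, ⟨_, x, hx, he⟩, rfl⟩
    exact ⟨x, hx, he⟩
  · rintro ⟨x, hx, rfl⟩
    obtain ⟨a, ha, he⟩ := h x hx
    exact ⟨a, ⟨ha, x, hx, he⟩, he.symm⟩

theorem rightMul_eq_of_mul (hg : rightMul M X (g * f) = leftMul M Y (g * f))
    (hf : leftMul M Z f = rightMul M X f) : rightMul M Z g = leftMul M Y g := by
  have : Function.Injective (· * f : Artin M → Artin M) := mul_left_injective f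
  apply this.image_injective
  show (· * f) '' _ = (· * f) '' _
  rw [image_mul_rightMul, hf, ← rightMul_mul, hg, leftMul_mul]

end

variable {B : Type*} {M : CoxeterMatrix B} [Finite B] {X Y Z : Set B} {f g d : Artin M}

theorem IsElemRibbon.mem_posMon (h : IsElemRibbon M X Y g) : g ∈ posMon M := by
  obtain ⟨t, _, ⟨_, hd⟩ | ⟨_, d₁, d₂, h1, h2, rfl⟩, _⟩ := h
  · exact hd.mem
  · exact h1.mul_inv_mem h2

theorem IsRibbon.mem_conjPos (h : IsRibbon M X Y g) : g ∈ conjPos M X Y := by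
  induction h with
  | nil => exact ⟨one_mem _, by simp [rightMul, leftMul]⟩
  | cons _ h ih =>
    refine ⟨mul_mem h.mem_posMon ih.1, ?_⟩
    obtain ⟨_, _, _, _, h⟩ := h
    rw [rightMul_mul, ih.2, leftMul_mul, h, image_mul_rightMul]

/-- The letters of a component all divide an element starting with one of them, provided that the
element conjugates them to letters. -/
theorem gen_ldvd_of_mem_comp {t : B} {v : Artin M} (ht : t ∈ Z) (hv : ldvd M (gen M t) v)
    (h : ∀ x ∈ comp M Z t, ∃ y, gen M x * v = v * gen M y) {x : B} (hx : x ∈ comp M Z t) :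
    ldvd M (gen M x) v := by
  refine comp_induction (P := fun x => ldvd M (gen M x) v) ht hv ?_ hx
  rintro a ha b hb hab hm ⟨w, hw, rfl⟩
  obtain ⟨y, hy⟩ := h b hb
  obtain ⟨z, hz⟩ := h a ha
  obtain ⟨c, hc, he⟩ := gen_ldvd_of_conj hab hm hw hy
  rw [mul_assoc] at hz
  rw [mul_left_cancel hz, ← he, mul_assoc]
  exact ldvd_mul_right _ (mul_mem hc (gen_mem z))

theorem exists_gen_of_notMem_comp {t x : B} (hx : x ∈ Z) (hxt : x ∉ comp M Z t)
    (hd : d ∈ posMonOn M (comp M Z t)) : d * gen M x = gen M x * d :=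
  (commute_gen_of_mem hd fun b hb => by
    rw [M.symmetric]; exact eq_two_of_mem_comp hb hx hxt).symm

theorem exists_conj_delta {t : B} (hd : IsDelta M (comp M Z t) d) {x : B} (hx : x ∈ Z) :
    ∃ a ∈ Z, d * gen M x = gen M a * d := by
  by_cases hxt : x ∈ comp M Z t
  · obtain ⟨s, hs, h⟩ := hd.exists_conj hxt
    exact ⟨s, hs.1, h⟩
  · exact ⟨x, hx, exists_gen_of_notMem_comp hx hxt hd.1⟩

theorem exists_conj_delta_mul_inv {t : B} {d' : Artin M} (hd : IsDelta M (comp M Z t) d)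
    (hd' : IsDelta M (comp M Z t \ {t}) d') {x : B} (hx : x ∈ Z) (hxt : x ≠ t) :
    ∃ a ∈ Z, d * d'⁻¹ * gen M x = gen M a * (d * d'⁻¹) := by
  obtain ⟨y, hy, hxy⟩ : ∃ y ∈ Z, gen M x * d' = d' * gen M y := by
    by_cases hxc : x ∈ comp M Z t
    · obtain ⟨s, hs, h⟩ := hd'.exists_conj' ⟨hxc, hxt⟩
      exact ⟨s, hs.1.1, h⟩
    · exact ⟨x, hx, (exists_gen_of_notMem_comp hx hxc
        (posMonOn_mono Set.sdiff_subset hd'.1)).symm⟩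
  obtain ⟨a, ha, hya⟩ := exists_conj_delta hd hy
  refine ⟨a, ha, ?_⟩
  have : d'⁻¹ * gen M x = gen M y * d'⁻¹ := by
    rw [inv_mul_eq_iff_eq_mul, ← mul_assoc, ← hxy, mul_inv_cancel_right]
  rw [mul_assoc, this, ← mul_assoc, hya, mul_assoc]

/-- A nontrivial positive conjugator is right-divisible by an elementary ribbon. -/
theorem exists_isElemRibbon (hg : g ∈ conjPos M X Y) (h1 : g ≠ 1) :
    ∃ X' f g', IsElemRibbon M X X' f ∧ f ≠ 1 ∧ g' ∈ posMon M ∧ g = g' * f := by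
  obtain ⟨hgp, hXY⟩ := hg
  have hg' := rev_rev_of_mem hgp
  have hv := rev_mem hgp
  have hconj : ∀ x ∈ X, ∃ y, gen M x * rev g = rev g * gen M y := by
    intro x hx
    obtain ⟨y, _, hy⟩ : g * gen M x ∈ leftMul M Y g := hXY ▸ ⟨x, hx, rfl⟩
    refine ⟨y, ?_⟩
    have := congrArg rev hy
    simp only [rev_mul, rev_gen] at this
    exact this.symm
  obtain ⟨t, w, hw, htw⟩ := exists_gen_mul hv fun h => h1 (by rw [← hg', h, rev_one])
  have htv : ldvd M (gen M t) (rev g) := ⟨w, hw, htw.symm⟩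
  have htZ : t ∈ X ∪ {t} := Or.inr rfl
  have htc := self_mem_comp (M := M) htZ
  have hne : ∀ {f : Artin M}, f = 1 → ¬ ldvd M (gen M t) f := by
    rintro _ rfl h
    have := h.deg_le
    rw [deg_gen, deg_one] at this
    omega
  by_cases htX : t ∈ X
  · have hXt : X ∪ {t} = X := Set.union_eq_self_of_subset_right (by simpa)
    have hall := fun (x : B) (hx : x ∈ comp M (X ∪ {t}) t) =>
      gen_ldvd_of_mem_comp htZ htv (fun x hx => hconj x (hXt ▸ hx.1)) hx
    obtain ⟨d, hd⟩ := exists_isDelta hv hall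
    obtain ⟨c, hc, hdc⟩ := hd.ldvd_of hv hall
    refine ⟨_, d, rev c, ⟨t, hd.isSpherical, Or.inl ⟨htX, hd⟩, Set.sep_subset _ _,
      leftMul_eq_rightMul fun x hx => exists_conj_delta hd (Or.inl hx)⟩,
      fun h => hne h (hd.gen_ldvd htc), rev_mem hc, ?_⟩
    rw [← hg', ← hdc, rev_mul, hd.rev_eq]
  · have hCX : comp M (X ∪ {t}) t \ {t} ⊆ X := fun x hx => hx.1.1.resolve_right hx.2
    obtain ⟨e, he, hxe⟩ := exists_common_multiple (C := comp M (X ∪ {t}) t \ {t}) (t := t)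
      (fun h => h.2 rfl) (fun x hx => by
        rw [comp_diff_union_self htZ]; exact mem_comp_comp htZ hx.1) hw
      (fun x hx => htw ▸ hconj x (hCX hx))
    obtain ⟨d', hd'⟩ := exists_isDelta (posMonOn_le _ he) hxe
    obtain ⟨e', he', hde⟩ := exists_mul_eq_mul hd'.1 fun x hx => hconj x (hCX hx)
    have hall : ∀ x ∈ comp M (X ∪ {t}) t, ldvd M (gen M x) (d' * rev g) := by
      intro x hx
      by_cases hxt : x = t
      · rw [hde, hxt]
        exact htv.trans (ldvd_mul_right _ he')
      · exact (hd'.gen_ldvd ⟨hx, hxt⟩).trans (ldvd_mul_right _ hv)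
    have hdv := mul_mem hd'.mem hv
    obtain ⟨d, hd⟩ := exists_isDelta hdv hall
    obtain ⟨c, hc, hdc⟩ := hd.ldvd_of hdv hall
    refine ⟨_, d * d'⁻¹, rev c, ⟨t, hd.isSpherical, Or.inr ⟨htX, d, d', hd, hd', rfl⟩,
      Set.sep_subset _ _, leftMul_eq_rightMul fun x hx =>
        exists_conj_delta_mul_inv hd hd' (Or.inl hx) ?_⟩, fun h => ?_, rev_mem hc, ?_⟩
    · rintro rfl
      exact htX hx
    · have := hd.gen_ldvd htc
      rw [mul_inv_eq_one.1 h] at this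
      exact (mem_of_gen_ldvd hd'.1 this).2 rfl
    · have := congrArg rev hdc
      rw [rev_mul, rev_mul, hd.rev_eq, hd'.rev_eq, hg'] at this
      rw [← mul_assoc, this, mul_inv_cancel_right]

theorem isRibbon_of_mem_conjPos (hg : g ∈ conjPos M X Y) : IsRibbon M X Y g := by
  obtain ⟨n, hn⟩ : ∃ n : ℕ, deg g ≤ n := ⟨(deg g).toNat, Int.self_le_toNat _⟩
  induction n generalizing X g with
  | zero =>
    obtain rfl := eq_one_of_deg hg.1 (by simpa using hn)
    have h := hg.2
    simp only [rightMul, leftMul, one_mul, mul_one] at h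
    rw [gen_injective.image_injective h]
    exact IsRibbon.nil Y
  | succ n ih =>
    by_cases h1 : g = 1
    · exact ih hg (by rw [h1, deg_one]; omega)
    · obtain ⟨X', f, g', hf, hf1, hg', rfl⟩ := exists_isElemRibbon hg h1
      refine (ih (g := g') ⟨hg', ?_⟩ ?_).cons_left hf
      · obtain ⟨_, _, _, _, h⟩ := hf
        exact rightMul_eq_of_mul hg.2 h
      · have : ¬ deg f ≤ 0 := fun h => hf1 (eq_one_of_deg hf.mem_posMon h)
        rw [deg_mul] at hn
        push_cast at hn
        omega

end

/-- **Theorem 4 (Godelle).** In any Artin-Tits system, the elements of `Conj⁺(S;X,Y)`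
are exactly the positive `Y`-ribbons-`X`. -/
theorem conjPos_iff_isRibbon
    [Finite B] (M : CoxeterMatrix B) (X Y : Set B) (g : Artin M) :
    g ∈ conjPos M X Y ↔ IsRibbon M X Y g := by
  exact ⟨isRibbon_of_mem_conjPos, IsRibbon.mem_conjPos⟩

end ArtinTitsPaper
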